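/- arXiv:1503.08790 — 2 statements merged into one kernel-verified Lean document; each statement's English description precedes it below -/
import Mathlib

section
/- Let H_n be the height of a random admissible walk of length n on ℕ₀. Its variance V H_n = E H_n² − (E H_n)², where E H_n^r = (Σ_{h≥0} h^r V(n,h))/(Σ_{h≥0} V(n,h)), satisfies, as n → ∞, V H_n = ((π³ − 32G²)/(4π)) n + (π³ − 40G²)/(6π) − (π³ − 12G²)/(180πn) + (11π³ − 265G²)/(1890πn²) + O(n^{−3}), where G = Σ_{k≥0} (−1)^k/(2k+1)² is the Catalan constant. -/
open Real

/-- Partial sum `S_k` of the `±1`-walk encoded by `ε : Fin n → Bool`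
(`true` = step `+1`, `false` = step `-1`). -/
def walkSum (n : ℕ) (ε : Fin n → Bool) (k : ℕ) : ℤ :=
  ∑ i : Fin n, if (i : ℕ) < k then (if ε i then 1 else -1) else 0

/-- `V n h`: number of `±1`-paths of length `n` with `|S_k| ≤ h` for all `k` and `|S_n| = h`. -/
noncomputable def V (n h : ℕ) : ℕ :=
  Nat.card {ε : Fin n → Bool //
    (∀ k ≤ n, |walkSum n ε k| ≤ (h : ℤ)) ∧ |walkSum n ε n| = (h : ℤ)}

/-- The `r`-th moment `E H_n^r = (Σ_h h^r·V(n,h))/(Σ_h V(n,h))` of the height of a random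
admissible walk on `ℕ₀`. -/
noncomputable def heightMoment (n r : ℕ) : ℝ :=
  (∑' h : ℕ, (h : ℝ) ^ r * (V n h : ℝ)) / (∑' h : ℕ, (V n h : ℝ))

/-- The variance `V H_n = E H_n² − (E H_n)²` of the height of a random admissible walk on `ℕ₀`. -/
noncomputable def heightVar (n : ℕ) : ℝ := heightMoment n 2 - (heightMoment n 1) ^ 2

/-- The Catalan constant `G = Σ_{k≥0} (−1)^k/(2k+1)²`. -/
noncomputable def catalanG : ℝ := ∑' k : ℕ, (-1 : ℝ) ^ k / (2 * (k : ℝ) + 1) ^ 2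


/-- shifted count -/
def okWalk (h : ℕ) (n : ℕ) (x : ℤ) (ε : Fin n → Bool) : Prop :=
  (∀ k ≤ n, |x + walkSum n ε k| ≤ (h : ℤ)) ∧ |x + walkSum n ε n| = (h : ℤ)

noncomputable def cntW (h n : ℕ) (x : ℤ) : ℕ := Nat.card {ε : Fin n → Bool // okWalk h n x ε}

theorem walkSum_zero_right (n : ℕ) (ε : Fin n → Bool) : walkSum n ε 0 = 0 := by
  simp [walkSum]

theorem walkSum_cons (n : ℕ) (b : Bool) (ε : Fin n → Bool) (k : ℕ) :
    walkSum (n+1) (Fin.cons b ε) (k+1) = (if b then 1 else -1) + walkSum n ε k := by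
  simp [walkSum, Fin.sum_univ_succ]

theorem okWalk_cons (h n : ℕ) (x : ℤ) (b : Bool) (ε : Fin n → Bool) :
    okWalk h (n+1) x (Fin.cons b ε) ↔ |x| ≤ (h:ℤ) ∧ okWalk h n (x + if b then 1 else -1) ε := by
  unfold okWalk
  rw [walkSum_cons]
  constructor
  · rintro ⟨h1, h2⟩
    refine ⟨by simpa [walkSum_zero_right] using h1 0 (by omega), fun k hk => ?_, ?_⟩
    · have := h1 (k+1) (by omega)
      rw [walkSum_cons] at this
      rwa [add_assoc]
    · rwa [add_assoc]
  · rintro ⟨h0, h1, h2⟩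
    refine ⟨fun k hk => ?_, by rwa [← add_assoc]⟩
    rcases k with _ | k
    · simpa [walkSum_zero_right] using h0
    · rw [walkSum_cons, ← add_assoc]
      exact h1 k (by omega)

theorem cntW_zero (h : ℕ) (x : ℤ) : cntW h 0 x = if |x| = (h:ℤ) then 1 else 0 := by
  unfold cntW okWalk
  split_ifs with hx
  · rw [Nat.card_eq_one_iff_unique]
    refine ⟨inferInstance, ⟨⟨fun i => i.elim0, ?_, ?_⟩⟩⟩
    · intro k hk; simp [walkSum, hx]
    · simp [walkSum, hx]
  · rw [Nat.card_eq_zero]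
    left
    constructor
    rintro ⟨ε, _, h2⟩
    simp [walkSum] at h2
    exact hx h2

theorem cntW_succ (h n : ℕ) (x : ℤ) (hx : |x| ≤ (h:ℤ)) :
    cntW h (n+1) x = cntW h n (x+1) + cntW h n (x-1) := by
  classical
  unfold cntW
  rw [← Nat.card_sum]
  refine Nat.card_congr ?_
  refine
    { toFun := fun e => if hb : e.1 0 = true then Sum.inl ⟨Fin.tail e.1, ?_⟩ else
        Sum.inr ⟨Fin.tail e.1, ?_⟩
      invFun := fun s => Sum.elim (fun e => ⟨Fin.cons true e.1, ?_⟩)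
        (fun e => ⟨Fin.cons false e.1, ?_⟩) s
      left_inv := ?_
      right_inv := ?_ }
  · have := e.2
    rw [← Fin.cons_self_tail e.1, okWalk_cons] at this
    simpa [hb] using this.2
  · have := e.2
    rw [← Fin.cons_self_tail e.1, okWalk_cons] at this
    simpa [hb, sub_eq_add_neg] using this.2
  · rw [okWalk_cons]; exact ⟨hx, by simpa using e.2⟩
  · rw [okWalk_cons]; exact ⟨hx, by simpa [sub_eq_add_neg] using e.2⟩
  · rintro ⟨e, he⟩
    by_cases hb : e 0 = true
    · simp only [hb, dite_true, Sum.elim_inl]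
      ext1
      simp only
      conv_rhs => rw [← Fin.cons_self_tail e, hb]
    · simp only [hb]
      ext1
      have hb' : e 0 = false := by simpa using hb
      change Fin.cons false (Fin.tail e) = e
      conv_rhs => rw [← Fin.cons_self_tail e, hb']
  · rintro (⟨e, he⟩ | ⟨e, he⟩)
    · simp
    · simp

theorem cntW_out (h n : ℕ) (x : ℤ) (hx : (h:ℤ) < |x|) : cntW h n x = 0 := by
  unfold cntW okWalk
  rw [Nat.card_eq_zero]
  left
  constructor
  rintro ⟨ε, h1, _⟩
  have := h1 0 (by omega)
  rw [walkSum_zero_right, add_zero] at this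
  omega

theorem V_eq_cntW (n h : ℕ) : V n h = cntW h n 0 := by
  simp [V, cntW, okWalk]

/-- angle -/
noncomputable def alp (H j : ℕ) : ℝ := π * (2 * j + 1) / (2 * H)

theorem sum_cos_odd (H : ℕ) (β : ℝ) :
    (∑ j ∈ Finset.range H, cos ((2 * j + 1) * β)) * (2 * sin β) = sin (2 * H * β) := by
  induction H with
  | zero => simp
  | succ H ih =>
    rw [Finset.sum_range_succ, add_mul, ih]
    have e1 : (2 * ((H+1 : ℕ):ℝ) * β) = (2 * H + 1) * β + β := by push_cast; ring
    have e2 : (2 * (H:ℝ) * β) = (2 * H + 1) * β - β := by ring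
    rw [e1, e2, sin_add, sin_sub]; ring

theorem sum_cos_zero (H : ℕ) (r : ℤ) (h0 : r ≠ 0) (h1 : |r| < 2 * H) :
    ∑ j ∈ Finset.range H, cos (alp H j * r) = 0 := by
  have hH : (H:ℝ) ≠ 0 := by
    rintro h
    have : H = 0 := by exact_mod_cast h
    subst this
    simp at h1
    have := abs_nonneg r
    omega
  have key := sum_cos_odd H (π * r / (2 * H))
  have e1 : (2 * H * (π * r / (2 * H)) : ℝ) = r * π := by field_simp
  rw [e1, sin_int_mul_pi] at key
  have hs : sin (π * r / (2 * H)) ≠ 0 := by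
    intro hs
    rw [sin_eq_zero_iff] at hs
    obtain ⟨m, hm⟩ := hs
    have hpi := pi_ne_zero
    field_simp at hm
    have hm' : (m * (2 * H) : ℤ) = r := by
      have : ((m:ℝ) * (2 * H) ) = r := by linarith
      exact_mod_cast this
    have hmm : m ≠ 0 := by rintro rfl; simp at hm'; exact h0 hm'.symm
    have : 1 ≤ |m| := Int.one_le_abs hmm
    have h3 : |r| = |m| * (2 * H) := by rw [← hm', abs_mul]; simp
    nlinarith
  have : ∑ j ∈ Finset.range H, cos (alp H j * r) =
      ∑ j ∈ Finset.range H, cos ((2 * j + 1) * (π * r / (2 * H))) := by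
    refine Finset.sum_congr rfl fun j _ => ?_
    congr 1
    unfold alp
    field_simp
  rw [this]
  rcases mul_eq_zero.1 key with h | h
  · exact h
  · exact absurd (by linarith) hs

theorem alp_mul_H (H j : ℕ) (hH : 0 < H) : alp H j * H = j * π + π / 2 := by
  unfold alp; have : (H:ℝ) ≠ 0 := by positivity
  field_simp

theorem cos_alp_H (H j : ℕ) (hH : 0 < H) : cos (alp H j * H) = 0 := by
  rw [alp_mul_H H j hH, cos_add_pi_div_two, sin_nat_mul_pi, neg_zero]

theorem sin_alp_H (H j : ℕ) (hH : 0 < H) : sin (alp H j * H) = (-1) ^ j := by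
  rw [alp_mul_H H j hH, sin_add_pi_div_two, cos_nat_mul_pi]

noncomputable def specF (H n : ℕ) (x : ℤ) : ℝ :=
  (2 / H) * ∑ j ∈ Finset.range H, (-1)^j * (2 * cos (alp H j))^n * cos (alp H j * x) * sin (alp H j)

theorem specF_zero (h : ℕ) (hh : 0 < h) (x : ℤ) (hx : |x| ≤ (h:ℤ)) :
    specF (h+1) 0 x = if |x| = (h:ℤ) then 1 else 0 := by
  have e : ∀ j ∈ Finset.range (h+1), (-1:ℝ)^j * (2 * cos (alp (h+1) j))^0 * cos (alp (h+1) j * x)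
      * sin (alp (h+1) j) = (cos (alp (h+1) j * ((h + x : ℤ):ℝ)) + cos (alp (h+1) j * ((h - x : ℤ):ℝ)))/2 := by
    intro j _
    have h1 := cos_alp_H (h+1) j (by omega)
    have h2 := sin_alp_H (h+1) j (by omega)
    have e1 : alp (h+1) j * ((h + x : ℤ):ℝ) = (alp (h+1) j * (h+1:ℕ) - alp (h+1) j) + alp (h+1) j * x := by
      push_cast; ring
    have e2 : alp (h+1) j * ((h - x : ℤ):ℝ) = (alp (h+1) j * (h+1:ℕ) - alp (h+1) j) - alp (h+1) j * x := by
      push_cast; ring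
    rw [e1, e2, cos_add, cos_sub (_ - _), cos_sub, sin_sub, h1, h2]
    ring
  unfold specF
  rw [Finset.sum_congr rfl e, ← Finset.sum_div, Finset.sum_add_distrib]
  have hH : (((h+1:ℕ)):ℝ) ≠ 0 := by positivity
  rw [abs_le] at hx
  have s0 : ∑ j ∈ Finset.range (h+1), cos (alp (h+1) j * ((0:ℤ):ℝ)) = (h+1:ℕ) := by simp
  split_ifs with hxh
  · rcases abs_eq (by omega : (0:ℤ) ≤ h) |>.1 hxh with rfl | rfl
    · rw [sub_self, s0, sum_cos_zero _ _ (by omega) (by rw [abs_of_nonneg] <;> push_cast <;> omega)]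
      field_simp; ring
    · rw [show (h:ℤ) + -h = 0 by ring, s0, sum_cos_zero _ _ (by omega) (by rw [abs_of_nonneg] <;> push_cast <;> omega)]
      field_simp; ring
  · have : x ≠ h := by rintro rfl; simp at hxh
    have : x ≠ -h := by rintro rfl; simp at hxh
    rw [sum_cos_zero _ _ (by omega) (by rw [abs_of_nonneg] <;> push_cast <;> omega),
      sum_cos_zero _ _ (by omega) (by rw [abs_of_nonneg] <;> push_cast <;> omega)]
    simp

theorem specF_succ (H n : ℕ) (x : ℤ) : specF H (n+1) x = specF H n (x+1) + specF H n (x-1) := by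
  unfold specF
  rw [← mul_add, ← Finset.sum_add_distrib]
  congr 1
  refine Finset.sum_congr rfl fun j _ => ?_
  push_cast
  rw [mul_add, mul_sub, mul_one, cos_add, cos_sub]
  ring

theorem specF_bdry (H n : ℕ) (hH : 0 < H) (x : ℤ) (hx : |x| = H) : specF H n x = 0 := by
  unfold specF
  rw [Finset.sum_eq_zero, mul_zero]
  intro j _
  have : cos (alp H j * x) = 0 := by
    rcases abs_eq (by omega : (0:ℤ) ≤ H) |>.1 hx with rfl | rfl
    · exact_mod_cast cos_alp_H H j hH
    · push_cast; rw [mul_neg, cos_neg]; exact cos_alp_H H j hH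
  rw [this]; ring

theorem cntW_eq (h : ℕ) (hh : 0 < h) (n : ℕ) : ∀ x : ℤ, |x| ≤ h + 1 → (cntW h n x : ℝ) = specF (h+1) n x := by
  induction n with
  | zero =>
    intro x hx
    rcases lt_or_ge (h:ℤ) |x| with h1 | h1
    · rw [cntW_out _ _ _ h1, specF_bdry _ _ (by omega) _ (by push_cast; omega)]; simp
    · rw [cntW_zero, specF_zero h hh x h1]; push_cast; rfl
  | succ n ih =>
    intro x hx
    rcases lt_or_ge (h:ℤ) |x| with h1 | h1
    · rw [cntW_out _ _ _ h1, specF_bdry _ _ (by omega) _ (by push_cast; omega)]; simp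
    · rw [cntW_succ _ _ _ h1, specF_succ]
      push_cast
      rw [abs_le] at h1
      rw [ih _ (by rw [abs_le]; omega), ih _ (by rw [abs_le]; omega)]

theorem V_zero_right (n : ℕ) (hn : 0 < n) : V n 0 = 0 := by
  obtain ⟨m, rfl⟩ : ∃ m, n = m + 1 := ⟨n - 1, by omega⟩
  rw [V_eq_cntW, cntW_succ _ _ _ (by simp), cntW_out _ _ _ (by simp), cntW_out _ _ _ (by simp)]

theorem V_large (n h : ℕ) (hn : n < h) : V n h = 0 := by
  unfold V
  rw [Nat.card_eq_zero]
  left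
  constructor
  rintro ⟨ε, _, h2⟩
  have : |walkSum n ε n| ≤ n := by
    unfold walkSum
    refine (Finset.abs_sum_le_sum_abs _ _).trans ?_
    refine (Finset.sum_le_card_nsmul _ _ 1 ?_).trans (by simp)
    intro i _
    split_ifs <;> simp
  omega

theorem V_spec (n h : ℕ) (hn : 0 < n) : (V n h : ℝ) = 2^n * ((2 / (h+1:ℕ)) *
    ∑ j ∈ Finset.range (h+1), (-1)^j * (cos (alp (h+1) j)^n * sin (alp (h+1) j))) := by
  rcases Nat.eq_zero_or_pos h with rfl | hh
  · rw [V_zero_right n hn]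
    have : alp 1 0 = π / 2 := by simp [alp]
    simp [this, hn.ne']
  · rw [V_eq_cntW, cntW_eq h hh n 0 (by simp; omega)]
    unfold specF
    rw [mul_left_comm, Finset.mul_sum (s := Finset.range (h+1)) (a := (2:ℝ)^n)]
    congr 1
    refine Finset.sum_congr rfl fun j _ => ?_
    rw [mul_pow]; simp; ring

/-- truncated `cos^n sin` -/
noncomputable def Dn (n : ℕ) (θ : ℝ) : ℝ := if θ < π / 2 then cos θ ^ n * sin θ else 0

theorem alp_lt (H j : ℕ) (hH : 0 < H) : alp H j < π / 2 ↔ 2 * j + 1 < H := by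
  unfold alp
  have h1 : (0:ℝ) < H := by exact_mod_cast hH
  rw [div_lt_div_iff₀ (by positivity) (by positivity)]
  constructor
  · intro h
    have : ((2 * j + 1 : ℕ) : ℝ) < H := by push_cast; nlinarith [pi_pos]
    exact_mod_cast this
  · intro h
    have : ((2 * j + 1 : ℕ) : ℝ) < H := by exact_mod_cast h
    push_cast at this
    nlinarith [pi_pos]

theorem V_half (n h : ℕ) (hn : 0 < n) : (V n h : ℝ) = 2^n * ((2 / (h+1:ℕ)) *
    ((1 + (-1)^(h+n)) * ∑' j : ℕ, (-1)^j * Dn n (alp (h+1) j))) := by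
  rw [V_spec n h hn]
  have hts : ∑' j : ℕ, (-1)^j * Dn n (alp (h+1) j) =
      ∑ j ∈ Finset.range (h+1), (-1)^j * Dn n (alp (h+1) j) := by
    refine tsum_eq_sum fun j hj => ?_
    have : ¬ alp (h+1) j < π / 2 := by
      rw [alp_lt _ _ (by omega)]
      simp at hj; omega
    simp [Dn, this]
  rw [hts, add_mul, one_mul]
  congr 2
  have : ∑ j ∈ Finset.range (h+1), (-1:ℝ)^(h+n) * ((-1)^j * Dn n (alp (h+1) j)) =
      ∑ j ∈ Finset.range (h+1), (-1)^(h+n) * ((-1)^(h - j) * Dn n (alp (h+1) (h - j))) := by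
    rw [← Finset.sum_range_reflect]
    simp
  rw [Finset.mul_sum, this, ← Finset.sum_add_distrib]
  refine Finset.sum_congr rfl fun j hj => ?_
  have hj' : j ≤ h := by simp at hj; omega
  have hal : alp (h+1) (h-j) = π - alp (h+1) j := by
    unfold alp
    have : ((h+1:ℕ):ℝ) ≠ 0 := by positivity
    rw [Nat.cast_sub hj']
    push_cast at this ⊢
    field_simp
    ring
  have hsgn : (-1:ℝ)^(h+n) * (-1)^(h-j) = (-1)^n * (-1)^j := by
    obtain ⟨d, rfl⟩ : ∃ d, h = j + d := ⟨h - j, by omega⟩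
    rw [Nat.add_sub_cancel_left, ← pow_add, ← pow_add,
      show j + d + n + d = (n + j) + 2 * d by ring, pow_add _ _ (2*d), pow_mul]
    simp
  rw [← mul_assoc ((-1:ℝ)^(h+n)), hsgn, hal]
  unfold Dn
  rw [cos_pi_sub, sin_pi_sub]
  have hnp : (-cos (alp (h+1) j))^n = (-1)^n * cos (alp (h+1) j)^n := by rw [← mul_pow]; simp
  have hsq : (-1:ℝ)^n * (-1)^n = 1 := by rw [← mul_pow]; simp
  rcases lt_trichotomy (alp (h+1) j) (π/2) with h1 | h1 | h1
  · rw [if_pos h1, if_neg (by linarith)]; ring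
  · rw [if_neg (by linarith), if_neg (by linarith), h1]; simp [hn.ne']
  · rw [if_neg (by linarith), if_pos (by linarith), hnp]
    linear_combination (-(-1)^j * cos (alp (h+1) j)^n * sin (alp (h+1) j)) * hsq


/-- odd theta series -/
noncomputable def thTerm (k : ℕ) (t : ℝ) (j : ℕ) : ℝ :=
  (-1)^j * (2*(j:ℝ)+1)^(2*k+1) * exp (-(2*(j:ℝ)+1)^2 * t)

noncomputable def thk (k : ℕ) (t : ℝ) : ℝ := ∑' j : ℕ, thTerm k t j

theorem exp_neg_le_fact (M : ℕ) (x : ℝ) (hx : 0 < x) : exp (-x) ≤ M.factorial / x^M := by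
  have h := pow_div_factorial_le_exp x hx.le M
  rw [exp_neg, inv_eq_one_div, div_le_div_iff₀ (exp_pos x) (by positivity)]
  rw [div_le_iff₀ (by positivity)] at h
  linarith

theorem abs_thTerm_le (k M : ℕ) (hM : k + 2 ≤ M) (t : ℝ) (ht : 0 < t) (j : ℕ) :
    |thTerm k t j| ≤ M.factorial / t^M * (1 / ((j:ℝ)+1)^2) := by
  unfold thTerm
  set l : ℝ := 2*(j:ℝ)+1 with hl
  have hl1 : (j:ℝ) + 1 ≤ l := by rw [hl]; have : (0:ℝ) ≤ j := by positivity
                                 linarith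
  have hl0 : 1 ≤ l := by have : (0:ℝ) ≤ j := by positivity
                         linarith
  have hlp : 0 < l := by linarith
  rw [abs_mul, abs_mul, abs_pow, abs_neg, abs_one, one_pow, one_mul, abs_of_pos (by positivity : 0 < l^(2*k+1)),
    abs_of_pos (exp_pos _), neg_mul]
  have h1 := exp_neg_le_fact M (l^2*t) (by positivity)
  calc l^(2*k+1) * exp (-(l^2*t)) ≤ l^(2*k+1) * (M.factorial / (l^2*t)^M) := by gcongr
    _ = M.factorial / t^M * (l^(2*k+1) / l^(2*M)) := by rw [mul_pow, ← pow_mul]; field_simp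
    _ ≤ M.factorial / t^M * (1 / l^2) := by
        gcongr ?_ * ?_
        rw [div_le_div_iff₀ (by positivity) (by positivity), ← pow_add, one_mul]
        exact pow_le_pow_right₀ hl0 (by omega)
    _ ≤ _ := by gcongr

theorem summable_inv_sq : Summable (fun j : ℕ => 1 / ((j:ℝ)+1)^2) := by
  have := (summable_nat_add_iff 1).2 (Real.summable_one_div_nat_pow.2 (by norm_num : 1 < 2))
  simpa using this

theorem summable_thTerm (k : ℕ) (t : ℝ) (ht : 0 < t) : Summable (thTerm k t) :=
  Summable.of_norm_bounded (summable_inv_sq.mul_left _) fun j => abs_thTerm_le k (k+2) le_rfl t ht j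

theorem abs_thk_le (k M : ℕ) (hM : k + 2 ≤ M) : ∃ C > 0, ∀ t > 0, |thk k t| ≤ C / t^M := by
  refine ⟨M.factorial * (∑' j : ℕ, 1 / ((j:ℝ)+1)^2), ?_, fun t ht => ?_⟩
  · have : 0 < ∑' j : ℕ, 1 / ((j:ℝ)+1)^2 := summable_inv_sq.tsum_pos (fun j => by positivity) 0 (by positivity)
    positivity
  · unfold thk
    have := tsum_of_norm_bounded (f := thTerm k t) ((summable_inv_sq.mul_left (M.factorial / t^M)).hasSum)
      (fun j => abs_thTerm_le k M hM t ht j)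
    rw [tsum_mul_left] at this
    calc _ ≤ _ := this
      _ = _ := by ring

theorem hasDerivAt_thTerm (k j : ℕ) (t : ℝ) : HasDerivAt (fun t => thTerm k t j) (-thTerm (k+1) t j) t := by
  unfold thTerm
  have h := (((hasDerivAt_id t).const_mul (-(2*(j:ℝ)+1)^2)).exp).const_mul ((-1)^j * (2*(j:ℝ)+1)^(2*k+1))
  refine h.congr_deriv ?_
  simp only [id]
  ring

theorem hasDerivAt_thk (k : ℕ) (t : ℝ) (ht : 0 < t) : HasDerivAt (thk k) (-thk (k+1) t) t := by
  unfold thk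
  rw [← tsum_neg]
  refine hasDerivAt_tsum_of_isPreconnected (t := Set.Ioi (t/2)) (g := fun j t => thTerm k t j)
    (g' := fun j t => -thTerm (k+1) t j) (y₀ := t)
    (u := fun j : ℕ => (k+3).factorial / (t/2)^(k+3) * (1 / ((j:ℝ)+1)^2))
    (summable_inv_sq.mul_left _) isOpen_Ioi isPreconnected_Ioi
    (fun j y _ => hasDerivAt_thTerm k j y) ?_ ?_ (summable_thTerm k t ht) ?_
  · intro j y hy
    have hy' : t/2 < y := hy
    rw [norm_neg]
    refine (abs_thTerm_le (k+1) (k+3) (by omega) y (by linarith) j).trans ?_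
    gcongr
  · simp; linarith
  · simp; linarith

theorem hasSum_odd_of_sin (f : ℕ → ℝ) (S : ℝ)
    (h : HasSum (fun n : ℕ => f n * sin (π / 2 * n)) S) :
    HasSum (fun j : ℕ => (-1)^j * f (2*j+1)) S := by
  have hi : Function.Injective (fun j : ℕ => 2*j+1) := fun a b hab => by simpa using hab
  rw [← hi.hasSum_iff] at h
  · convert h using 2 with j
    simp only [Function.comp]
    have : sin (π/2 * ((2*j+1:ℕ):ℝ)) = (-1)^j := by
      rw [show π/2 * ((2*j+1:ℕ):ℝ) = j*π + π/2 by push_cast; ring, sin_add_pi_div_two, cos_nat_mul_pi]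
    rw [this]; ring
  · intro n hn
    have : Even n := by
      rw [← Nat.not_odd_iff_even]
      rintro ⟨m, rfl⟩
      exact hn ⟨m, rfl⟩
    obtain ⟨m, rfl⟩ := this
    rw [show π/2 * ((m+m:ℕ):ℝ) = m*π by push_cast; ring, sin_nat_mul_pi, mul_zero]

theorem sinKernel_quarter (t : ℝ) (ht : 0 < t) :
    HurwitzZeta.sinKernel ((1/4:ℝ):UnitAddCircle) t = 2 * thk 0 (π * t) := by
  have h := HurwitzZeta.hasSum_nat_sinKernel (1/4) ht
  have h2 := hasSum_odd_of_sin (fun n => 2 * n * exp (-π * n^2*t)) _ (by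
    convert h using 2 with n
    rw [show 2 * π * (1/4) * (n:ℝ) = π/2*n by ring]; ring)
  rw [← h2.tsum_eq, thk, ← tsum_mul_left]
  refine tsum_congr fun j => ?_
  unfold thTerm
  push_cast
  rw [show -π * (2 * (j:ℝ) + 1) ^ 2 * t = -(2*(j:ℝ)+1)^2 * (π * t) by ring]
  ring

theorem oddKernel_quarter (x : ℝ) (hx : 0 < x) :
    HurwitzZeta.oddKernel ((1/4:ℝ):UnitAddCircle) x = 1/4 * thk 0 (π * x / 16) := by
  have h := (HurwitzZeta.hasSum_int_oddKernel (1/4) hx).nat_add_neg_add_one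
  have hs := summable_thTerm 0 (π * x/16) (by positivity)
  have hs1 : Summable fun m => thTerm 0 (π * x/16) (2*m) :=
    hs.comp_injective (i := fun m : ℕ => 2*m) (fun a b hab => by simpa using hab)
  have hs2 : Summable fun m => thTerm 0 (π * x/16) (2*m+1) :=
    hs.comp_injective (i := fun m : ℕ => 2*m+1) (fun a b hab => by simpa using hab)
  rw [← h.tsum_eq, thk, ← tsum_even_add_odd hs1 hs2, ← hs1.tsum_add hs2, ← tsum_mul_left]
  refine tsum_congr fun j => ?_
  unfold thTerm
  push_cast
  rw [show -π * ((j:ℝ) + 1/4) ^ 2 * x = -(2*(2*(j:ℝ))+1)^2 * (π * x / 16) by ring,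
    show -π * (-((j:ℝ)+1) + 1/4) ^ 2 * x = -(2*(2*(j:ℝ)+1)+1)^2 * (π * x / 16) by ring]
  rw [pow_succ (-1:ℝ) (2*j), pow_mul (-1:ℝ), show ((-1:ℝ)^2) = 1 by norm_num, one_pow]
  ring

noncomputable def Xi (k : ℕ) (y : ℝ) : ℝ := (π/(2*y))^(2*k+1) * thk k (π^2/(8*y^2))

noncomputable def cXi : ℝ := 4 * π / (2*π)^(3/2:ℝ)

theorem cXi_pos : 0 < cXi := by unfold cXi; positivity

theorem Xi_zero_dual (y : ℝ) (hy : 0 < y) : Xi 0 y = cXi * y^2 * thk 0 (y^2/2) := by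
  have h := HurwitzZeta.oddKernel_functional_equation ((1/4:ℝ):UnitAddCircle) (2*π/y^2)
  rw [oddKernel_quarter _ (by positivity), sinKernel_quarter _ (by positivity)] at h
  rw [show π * (2*π/y^2)/16 = π^2/(8*y^2) by field_simp; norm_num,
    show π * (1/(2*π/y^2)) = y^2/2 by field_simp] at h
  have h3 : (y^2:ℝ)^(3/2:ℝ) = y^3 := by
    rw [← rpow_natCast, ← rpow_natCast, ← rpow_mul hy.le]; norm_num
  rw [div_rpow (by positivity) (by positivity), h3] at h
  unfold Xi cXi
  have h4 : thk 0 (π^2/(8*y^2)) = 4 * (1 / ((2 * π) ^ (3 / 2:ℝ) / y ^ 3) * (2 * thk 0 (y ^ 2 / 2))) := by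
    rw [← h]; ring
  rw [h4]
  have : (0:ℝ) < (2*π)^(3/2:ℝ) := by positivity
  generalize (2*π)^(3/2:ℝ) = w at *
  generalize thk 0 (y^2/2) = w' at *
  rw [show 2*0+1 = 1 from rfl, pow_one]
  field_simp
  try ring

theorem hasDerivAt_Xi (k : ℕ) (y : ℝ) (hy : 0 < y) :
    HasDerivAt (Xi k) ((-(2*k+1) * Xi k y + Xi (k+1) y)/y) y := by
  have h1 : HasDerivAt (fun y : ℝ => π/(2*y)) (-(π/(2*y))/y) y := by
    have := ((hasDerivAt_inv hy.ne').const_mul (π/2))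
    have e : (fun y : ℝ => π/(2*y)) = fun y => π/2 * y⁻¹ := by
      ext z; rw [div_mul_eq_div_div, div_eq_mul_inv (π/2)]
    rw [e]
    refine this.congr_deriv ?_
    field_simp
  have h2 : HasDerivAt (fun y : ℝ => π^2/(8*y^2)) (-(π/(2*y))^2/y) y := by
    have := (h1.pow 2).div_const 2
    have e : (fun y : ℝ => π^2/(8*y^2)) = fun x => ((fun y => π / (2 * y)) ^ 2) x / 2 := by
      ext z; simp only [Pi.pow_apply]; rw [div_pow, div_div]; ring
    rw [e]
    refine this.congr_deriv ?_
    push_cast; ring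
  have h3 := (hasDerivAt_thk k (π^2/(8*y^2)) (by positivity)).comp y h2
  have h4 := (h1.pow (2*k+1)).mul h3
  have : Xi k = (((fun y : ℝ => π/(2*y))^(2*k+1)) * (thk k ∘ fun y => π^2/(8*y^2))) := by
    ext z; simp [Xi]
  rw [this]
  refine h4.congr_deriv ?_
  unfold Xi
  simp only [Pi.pow_apply, Function.comp]
  rw [show 2*k+1-1 = 2*k by omega]
  push_cast
  simp only [Pi.mul_apply, Pi.pow_apply, Function.comp]
  rw [show 2*(k+1)+1 = 2*k+3 by ring]
  generalize π/(2*y) = z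
  ring

theorem hasDerivAt_dualTerm (i : ℕ) (y : ℝ) (hy : 0 < y) :
    HasDerivAt (fun y => y^(2*i+2) * thk i (y^2/2))
      (((2*i+2) * (y^(2*i+2) * thk i (y^2/2)) - y^(2*(i+1)+2) * thk (i+1) (y^2/2))/y) y := by
  have h2 : HasDerivAt (fun y : ℝ => y^2/2) y y := by
    have := ((hasDerivAt_id y).pow 2).div_const 2
    refine this.congr_deriv ?_
    simp
  have h3 := (hasDerivAt_thk i (y^2/2) (by positivity)).comp y h2
  have h4 := (hasDerivAt_pow (2*i+2) y).mul h3
  refine h4.congr_deriv ?_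
  rw [show 2*i+2-1 = 2*i+1 by omega, show 2*(i+1)+2 = 2*i+4 by ring]
  push_cast
  simp only [Function.comp]
  field_simp
  ring

theorem Xi_dual (k : ℕ) : ∃ a : ℕ → ℝ, ∀ y > 0, Xi k y =
    ∑ i ∈ Finset.range (k+1), a i * (y^(2*i+2) * thk i (y^2/2)) := by
  induction k with
  | zero => exact ⟨fun _ => cXi, fun y hy => by rw [Xi_zero_dual y hy]; simp; ring⟩
  | succ k ih =>
    obtain ⟨a, ha⟩ := ih
    refine ⟨fun i => (if i < k+1 then (2*k+1) * a i + (2*i+2) * a i else 0) - (if i = 0 then 0 else a (i-1)),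
      fun y hy => ?_⟩
    have h1 := hasDerivAt_Xi k y hy
    have h2 : HasDerivAt (fun y => ∑ i ∈ Finset.range (k+1), a i * (y^(2*i+2) * thk i (y^2/2)))
      (∑ i ∈ Finset.range (k+1), a i * (((2*i+2) * (y^(2*i+2) * thk i (y^2/2)) - y^(2*(i+1)+2) * thk (i+1) (y^2/2))/y)) y :=
      HasDerivAt.fun_sum fun i _ => (hasDerivAt_dualTerm i y hy).const_mul (a i)
    have h3 : HasDerivAt (Xi k)
      (∑ i ∈ Finset.range (k+1), a i * (((2*i+2) * (y^(2*i+2) * thk i (y^2/2)) - y^(2*(i+1)+2) * thk (i+1) (y^2/2))/y)) y := by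
      refine h2.congr_of_eventuallyEq ?_
      filter_upwards [lt_mem_nhds hy] with z hz
      exact ha z hz
    have h4 := h1.unique h3
    rw [div_eq_iff hy.ne', Finset.sum_mul] at h4
    have h5 : Xi (k+1) y = (2*k+1) * Xi k y + ∑ i ∈ Finset.range (k+1), a i * ((2*i+2) * (y^(2*i+2) * thk i (y^2/2)) - y^(2*(i+1)+2) * thk (i+1) (y^2/2)) := by
      have : ∑ i ∈ Finset.range (k+1), a i * ((2*i+2) * (y^(2*i+2) * thk i (y^2/2)) - y^(2*(i+1)+2) * thk (i+1) (y^2/2)) =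
        -(2*k+1) * Xi k y + Xi (k+1) y := by
        rw [h4]
        refine Finset.sum_congr rfl fun i _ => ?_
        field_simp
      rw [this]; ring
    rw [h5, ha y hy]
    simp only [sub_mul, Finset.sum_sub_distrib]
    rw [Finset.sum_range_succ _ (k+1), Finset.sum_range_succ' _ (k+1), Finset.mul_sum]
    simp only [mul_sub, Finset.sum_sub_distrib, if_true, lt_irrefl, if_false, zero_mul, add_zero,
      Nat.succ_ne_zero, Nat.add_sub_cancel]
    rw [← add_sub_assoc, ← Finset.sum_add_distrib]
    congr 1
    refine Finset.sum_congr rfl fun i hi => ?_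
    rw [if_pos (by simpa using hi)]
    ring

theorem Xi_small (k M : ℕ) : ∃ C > 0, ∀ y : ℝ, 0 < y → y ≤ 1 → |Xi k y| ≤ C * y^M := by
  obtain ⟨C, hC, h⟩ := abs_thk_le k (k+2+M) (by omega)
  refine ⟨(π/2)^(2*k+1) * (C * (8/π^2)^(k+2+M)), by positivity, fun y hy hy1 => ?_⟩
  unfold Xi
  rw [abs_mul, abs_of_pos (by positivity)]
  have h1 := h (π^2/(8*y^2)) (by positivity)
  calc _ ≤ (π/(2*y))^(2*k+1) * (C / (π^2/(8*y^2))^(k+2+M)) := by gcongr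
    _ = (π/2)^(2*k+1) * (C * (8/π^2)^(k+2+M)) * (y^(2*(k+2+M)) / y^(2*k+1)) := by
        rw [div_pow, div_pow, div_pow, div_pow, mul_pow, mul_pow, ← pow_mul y]
        field_simp
    _ ≤ _ := by
        gcongr
        rw [div_le_iff₀ (by positivity), ← pow_add]
        exact pow_le_pow_of_le_one hy.le hy1 (by omega)

theorem Xi_large (k M : ℕ) : ∃ C > 0, ∀ y : ℝ, 1 ≤ y → |Xi k y| ≤ C / y^M := by
  obtain ⟨a, ha⟩ := Xi_dual k
  have hb : ∀ i, ∃ C > 0, ∀ t > 0, |thk i t| ≤ C / t^(i+2+M) := fun i => abs_thk_le i (i+2+M) (by omega)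
  choose C hC hb using hb
  refine ⟨1 + ∑ i ∈ Finset.range (k+1), |a i| * (C i * 2^(i+2+M)), ?_, fun y hy => ?_⟩
  · have : 0 ≤ ∑ i ∈ Finset.range (k+1), |a i| * (C i * 2^(i+2+M)) :=
      Finset.sum_nonneg fun i _ => mul_nonneg (abs_nonneg _) (mul_nonneg (hC i).le (by positivity))
    linarith
  · have hy0 : 0 < y := by linarith
    rw [ha y hy0, add_div]
    refine (Finset.abs_sum_le_sum_abs _ _).trans ?_
    have : 0 ≤ 1 / y^M := by positivity
    refine le_trans ?_ (le_add_of_nonneg_left this)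
    rw [Finset.sum_div]
    refine Finset.sum_le_sum fun i _ => ?_
    rw [abs_mul, mul_div_assoc, abs_mul, abs_of_pos (by positivity : 0 < y^(2*i+2))]
    gcongr
    calc y^(2*i+2) * |thk i (y^2/2)| ≤ y^(2*i+2) * (C i / (y^2/2)^(i+2+M)) := by
          gcongr; exact hb i _ (by positivity)
      _ = C i * 2^(i+2+M) * (y^(2*i+2) / y^(2*(i+2+M))) := by
          rw [div_pow, ← pow_mul]; field_simp
      _ ≤ C i * 2^(i+2+M) * (1 / y^M) := by
          have := (hC i).le
          gcongr ?_ * ?_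
          rw [div_le_div_iff₀ (by positivity) (by positivity), ← pow_add, one_mul]
          exact pow_le_pow_right₀ hy (by omega)
      _ = _ := by ring

theorem Xi_rapid (k : ℕ) (m : ℤ) : ∃ C > 0, ∀ y : ℝ, 0 < y → |Xi k y| ≤ C * y^m := by
  obtain ⟨C, hC, h⟩ := Xi_small k m.natAbs
  obtain ⟨D, hD, h'⟩ := Xi_large k m.natAbs
  refine ⟨C + D, by positivity, fun y hy => ?_⟩
  have hp : 0 < y^m := zpow_pos hy m
  rcases le_total y 1 with hy1 | hy1
  · refine (h y hy hy1).trans ?_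
    have : y^m.natAbs ≤ y^m := by
      rw [← zpow_natCast]
      exact zpow_le_zpow_right_of_le_one₀ hy hy1 (by omega)
    nlinarith
  · refine (h' y hy1).trans ?_
    have : 1 / y^m.natAbs ≤ y^m := by
      rw [← zpow_natCast, one_div, ← zpow_neg]
      exact zpow_le_zpow_right₀ hy1 (by omega)
    rw [div_eq_mul_one_div]
    nlinarith


noncomputable def Ph (k : ℕ) (s : ℤ) (y : ℝ) : ℝ := if 0 < y then y^(s-1) * Xi k y else 0

theorem Ph_bound (k : ℕ) (s p : ℤ) : ∃ C > 0, ∀ y : ℝ, 0 < y → |Ph k s y| ≤ C * y^p := by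
  obtain ⟨C, hC, h⟩ := Xi_rapid k (p - (s-1))
  refine ⟨C, hC, fun y hy => ?_⟩
  unfold Ph
  rw [if_pos hy, abs_mul, abs_of_pos (by positivity)]
  calc y^(s-1) * |Xi k y| ≤ y^(s-1) * (C * y^(p-(s-1))) := by gcongr; exact h y hy
    _ = C * (y^(s-1) * y^(p-(s-1))) := by ring
    _ = C * y^p := by rw [← zpow_add₀ hy.ne']; congr 2; ring

theorem Ph_nonpos (k : ℕ) (s : ℤ) (y : ℝ) (hy : y ≤ 0) : Ph k s y = 0 := by
  unfold Ph; rw [if_neg (not_lt.mpr hy)]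

theorem hasDerivAt_Ph (k : ℕ) (s : ℤ) (y : ℝ) :
    HasDerivAt (Ph k s) ((s-2-2*k) * Ph k (s-1) y + Ph (k+1) (s-1) y) y := by
  rcases lt_trichotomy y 0 with hy | hy | hy
  · rw [Ph_nonpos _ _ _ hy.le, Ph_nonpos _ _ _ hy.le]
    simp only [mul_zero, add_zero]
    refine (hasDerivAt_const y (0:ℝ)).congr_of_eventuallyEq ?_
    filter_upwards [gt_mem_nhds hy] with z hz
    exact Ph_nonpos _ _ _ hz.le
  · subst hy
    rw [Ph_nonpos _ _ _ le_rfl, Ph_nonpos _ _ _ le_rfl]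
    simp only [mul_zero, add_zero]
    obtain ⟨C, hC, h⟩ := Ph_bound k s 2
    rw [hasDerivAt_iff_isLittleO]
    simp only [Ph_nonpos k s 0 le_rfl, sub_zero, smul_zero]
    refine Asymptotics.IsBigO.trans_isLittleO (g := fun x : ℝ => x^2) ?_ ?_
    · refine Asymptotics.IsBigO.of_bound C (Filter.Eventually.of_forall fun x => ?_)
      rcases le_or_gt x 0 with hx | hx
      · rw [Ph_nonpos _ _ _ hx]; simp; positivity
      · have := h x hx
        simp only [norm_eq_abs, abs_pow, sq_abs]
        exact_mod_cast this
    · have := Asymptotics.isLittleO_pow_pow (𝕜 := ℝ) (m := 1) (n := 2) (by norm_num)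
      simpa using this
  · have h1 := (hasDerivAt_zpow (s-1) y (Or.inl hy.ne')).mul (hasDerivAt_Xi k y hy)
    have h2 : HasDerivAt (Ph k s) _ y := h1.congr_of_eventuallyEq (by
      filter_upwards [lt_mem_nhds hy] with z hz
      simp [Ph, if_pos hz])
    refine h2.congr_deriv ?_
    unfold Ph
    rw [if_pos hy, if_pos hy]
    have : y^(s-1) = y^(s-1-1) * y := by rw [← zpow_add_one₀ hy.ne']; congr 1; ring
    rw [this]
    push_cast
    field_simp
    ring

theorem continuous_Ph (k : ℕ) (s : ℤ) : Continuous (Ph k s) :=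
  continuous_iff_continuousAt.mpr fun y => (hasDerivAt_Ph k s y).continuousAt

noncomputable def PhC (k : ℕ) (s : ℤ) (y : ℝ) : ℂ := (Ph k s y : ℂ)

theorem iteratedDeriv_PhC (k : ℕ) (s : ℤ) (n : ℕ) : ∃ c : ℕ → ℝ, iteratedDeriv n (PhC k s) =
    fun y => ((∑ i ∈ Finset.range (n+1), c i * Ph (k+i) (s-n) y : ℝ) : ℂ) := by
  induction n with
  | zero => exact ⟨fun _ => 1, by ext y; simp [PhC]⟩
  | succ n ih =>
    obtain ⟨c, hc⟩ := ih
    refine ⟨fun i => (if i < n+1 then c i * (s-n-2-2*(k+i)) else 0) + (if i = 0 then 0 else c (i-1)), ?_⟩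
    rw [iteratedDeriv_succ, hc]
    ext y
    have h : HasDerivAt (fun y => ∑ i ∈ Finset.range (n+1), c i * Ph (k+i) (s-n) y)
      (∑ i ∈ Finset.range (n+1), c i * ((((s-n:ℤ):ℝ)-2-2*((k+i:ℕ):ℝ)) * Ph (k+i) (s-n-1) y + Ph (k+i+1) (s-n-1) y)) y :=
      HasDerivAt.fun_sum fun i _ => (hasDerivAt_Ph (k+i) (s-n) y).const_mul (c i)
    rw [h.ofReal_comp.deriv]
    congr 1
    simp only [add_mul, Finset.sum_add_distrib]
    rw [Finset.sum_range_succ _ (n+1), Finset.sum_range_succ' _ (n+1)]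
    simp only [mul_add, Finset.sum_add_distrib, if_true, lt_irrefl, if_false, zero_mul, add_zero,
      Nat.succ_ne_zero, Nat.add_sub_cancel]
    have e : s - ((n+1:ℕ):ℤ) = s - n - 1 := by push_cast; ring
    rw [e]
    congr 1
    refine Finset.sum_congr rfl fun i hi => ?_
    rw [if_pos (by simpa using hi)]
    push_cast
    ring

theorem Ph_decay (k : ℕ) (s : ℤ) (p : ℕ) : ∃ C > 0, ∀ y : ℝ, |y|^p * |Ph k s y| ≤ C := by
  obtain ⟨C, hC, h⟩ := Ph_bound k s (-p)
  refine ⟨C, hC, fun y => ?_⟩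
  rcases le_or_gt y 0 with hy | hy
  · rw [Ph_nonpos _ _ _ hy]; simp; exact hC.le
  · rw [abs_of_pos hy]
    calc y^p * |Ph k s y| ≤ y^p * (C * y^(-(p:ℤ))) := by gcongr; exact h y hy
      _ = C := by rw [zpow_neg, zpow_natCast]; field_simp

noncomputable def PhS (k : ℕ) (s : ℤ) : SchwartzMap ℝ ℂ where
  toFun := PhC k s
  smooth' := by
    refine contDiff_of_differentiable_iteratedDeriv fun m _ => ?_
    obtain ⟨c, hc⟩ := iteratedDeriv_PhC k s m
    rw [hc]
    intro y
    have h : HasDerivAt (fun y => ∑ i ∈ Finset.range (m+1), c i * Ph (k+i) (s-m) y) _ y :=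
      HasDerivAt.fun_sum fun i _ => (hasDerivAt_Ph (k+i) (s-m) y).const_mul (c i)
    exact h.ofReal_comp.differentiableAt
  decay' := by
    intro p n
    obtain ⟨c, hc⟩ := iteratedDeriv_PhC k s n
    choose C hC h using fun i => Ph_decay (k+i) (s-n) p
    refine ⟨∑ i ∈ Finset.range (n+1), |c i| * C i, fun x => ?_⟩
    rw [norm_iteratedFDeriv_eq_norm_iteratedDeriv, hc, Complex.norm_real, norm_eq_abs, norm_eq_abs]
    calc _ ≤ |x|^p * ∑ i ∈ Finset.range (n+1), |c i * Ph (k+i) (s-n) x| := by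
          gcongr; exact Finset.abs_sum_le_sum_abs _ _
      _ = ∑ i ∈ Finset.range (n+1), |c i| * (|x|^p * |Ph (k+i) (s-n) x|) := by
          rw [Finset.mul_sum]; refine Finset.sum_congr rfl fun i _ => ?_
          rw [abs_mul]; ring
      _ ≤ _ := by
          refine Finset.sum_le_sum fun i _ => ?_
          gcongr; exact h i x

theorem PhS_apply (k : ℕ) (s : ℤ) (y : ℝ) : PhS k s y = (Ph k s y : ℂ) := rfl


open FourierTransform in
theorem fourier_scale (f : SchwartzMap ℝ ℂ) (r : ℝ) (hr : 0 < r) (w : ℝ) :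
    𝓕 (fun x : ℝ => f (r * x)) w = (1/r : ℝ) * 𝓕 f (w/r) := by
  rw [SchwartzMap.fourier_coe, Real.fourier_real_eq, Real.fourier_real_eq]
  have := MeasureTheory.Measure.integral_comp_mul_left (fun u => Real.fourierChar (-(u * (w/r))) • f u) r
  rw [abs_of_pos (by positivity)] at this
  rw [one_div, ← Complex.real_smul, ← this]
  congr 1; ext v
  congr 3
  field_simp

open FourierTransform in
theorem poisson_gen (f : SchwartzMap ℝ ℂ) (K : ℕ) (hK : 1 ≤ K) : ∃ C > 0, ∀ r x : ℝ, 0 < r →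
    ‖(∑' q : ℤ, f (r * (x + q))) - (1/r : ℝ) * ∫ u, f u‖ ≤ C * r^K := by
  obtain ⟨C, hC, h⟩ := (𝓕 f).decay (K+1) 0
  simp only [norm_iteratedFDeriv_zero] at h
  have hs : Summable (fun q : ℤ => |1/(q:ℝ)^(K+1)|) :=
    (Real.summable_one_div_int_pow.mpr (by omega : 1 < K+1)).abs
  set S := ∑' q : ℤ, |1/(q:ℝ)^(K+1)| with hS
  have hS0 : 0 ≤ S := tsum_nonneg fun _ => abs_nonneg _
  refine ⟨C * S + 1, by positivity, fun r x hr => ?_⟩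
  have hb : ∀ q : ℤ, q ≠ 0 → ‖𝓕 (fun x : ℝ => f (r * x)) (q:ℝ)‖ ≤ C * r^K * |1/(q:ℝ)^(K+1)| := by
    intro q hq
    rw [fourier_scale f r hr, norm_mul, Complex.norm_real, norm_of_nonneg (by positivity)]
    have h1 := h (q/r)
    have hq' : (0:ℝ) < |(q:ℝ)| := by positivity
    rw [norm_eq_abs, abs_div, abs_of_pos hr, div_pow, div_mul_eq_mul_div, div_le_iff₀ (by positivity)] at h1
    rw [abs_div, abs_one, abs_pow, mul_one_div, le_div_iff₀ (by positivity)]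
    calc _ = (1/r) * (|(q:ℝ)|^(K+1) * ‖𝓕 f (q/r)‖) := by ring
      _ ≤ (1/r) * (C * r^(K+1)) := by gcongr
      _ = _ := by rw [pow_succ]; field_simp
  have hsum0 : Summable (fun q : ℤ => 𝓕 (fun x : ℝ => f (r * x)) (q:ℝ)) := by
    refine Summable.of_norm_bounded_eventually (hs.mul_left (C * r^K)) ?_
    rw [Filter.eventually_cofinite]
    refine (Set.finite_singleton (0:ℤ)).subset fun q hq => ?_
    by_contra hne
    exact hq (hb q hne)
  have hO : (fun x : ℝ => f (r * x)) =O[Filter.cocompact ℝ] fun x : ℝ => |x| ^ (-(2:ℝ)) := by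
    have h1 := (f.isBigO_cocompact_rpow (-2)).comp_tendsto (Filter.tendsto_cocompact_mul_left₀ hr.ne')
    refine h1.trans ?_
    have : ((fun x : ℝ => ‖x‖ ^ (-2:ℝ)) ∘ fun x => r * x) = fun x => r^(-2:ℝ) * |x|^(-(2:ℝ)) := by
      ext x
      simp only [Function.comp, norm_mul, norm_eq_abs, abs_of_pos hr]
      rw [mul_rpow hr.le (abs_nonneg _)]
    rw [this]
    exact (Asymptotics.isBigO_refl _ _).const_mul_left _
  have hP := Real.tsum_eq_tsum_fourier_of_rpow_decay_of_summable (f := fun x : ℝ => f (r * x))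
    (f.continuous.comp (continuous_const.mul continuous_id)) (b := 2) (by norm_num) hO hsum0 x
  rw [hP]
  have hn : ∀ q : ℤ, ‖(fourier q (x : UnitAddCircle) : ℂ)‖ = 1 := fun q => Circle.norm_coe _
  have hsum : Summable (fun q : ℤ => 𝓕 (fun x : ℝ => f (r * x)) (q:ℝ) * fourier q (x : UnitAddCircle)) := by
    refine Summable.of_norm ?_
    simpa only [norm_mul, hn, mul_one] using hsum0.norm
  rw [hsum.tsum_eq_add_tsum_ite 0]
  have h0 : 𝓕 (fun x : ℝ => f (r * x)) ((0:ℤ):ℝ) * fourier (0:ℤ) (x : UnitAddCircle) = (1/r : ℝ) * ∫ u, f u := by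
    rw [fourier_scale f r hr, SchwartzMap.fourier_coe, Real.fourier_real_eq]
    simp
  rw [h0, add_sub_cancel_left]
  have := tsum_of_norm_bounded (hs.hasSum.mul_left (C * r^K)) (f := fun q : ℤ => if q = 0 then 0 else
    𝓕 (fun x : ℝ => f (r * x)) (q:ℝ) * fourier q (x : UnitAddCircle)) (by
      intro q
      split_ifs with hq
      · simp; positivity
      · rw [norm_mul, hn, mul_one]; exact hb q hq)
  refine this.trans ?_
  rw [← hS]
  have : 0 < r^K := by positivity
  nlinarith

noncomputable def omg (n H : ℕ) : ℝ := 1 + (-1)^(H+n+1)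

theorem abs_omg_le (n H : ℕ) : |omg n H| ≤ 2 := by
  unfold omg
  rcases neg_one_pow_eq_or ℝ (H+n+1) with h | h <;> rw [h] <;> norm_num

noncomputable def Aint (k : ℕ) (s : ℤ) : ℝ := ∫ u, Ph k s u

theorem tsum_PhInt (k : ℕ) (s : ℤ) (n : ℕ) : 2 * (∑' q : ℤ, Ph k s (2/√n * (((n:ℝ)+1)/2 + q))) =
    ∑' H : ℕ, omg n H * Ph k s (H/√n) := by
  set F : ℤ → ℝ := fun m => if Even (m+n+1) then Ph k s (m/√n) else 0 with hF
  have h1 : ∑' q : ℤ, F (n+1+2*q) = ∑' m : ℤ, F m := by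
    refine Function.Injective.tsum_eq (g := fun q : ℤ => (n:ℤ)+1+2*q) (fun a b h => by simpa using h) ?_
    intro m hm
    have : Even (m+n+1) := by
      by_contra hne
      exact hm (if_neg hne)
    obtain ⟨t, ht⟩ := this
    exact ⟨t - n - 1, by dsimp only; omega⟩
  have h2 : ∑' H : ℕ, F (H:ℤ) = ∑' m : ℤ, F m := by
    refine Function.Injective.tsum_eq (g := fun q : ℕ => (q:ℤ)) (fun a b h => by simpa using h) ?_
    intro m hm
    by_cases h0 : 0 ≤ m
    · exact ⟨m.toNat, by simp [h0]⟩
    · exfalso; apply hm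
      rw [hF]; dsimp only
      rw [Ph_nonpos]; · simp
      have : (m:ℝ) ≤ 0 := by exact_mod_cast (not_le.mp h0).le
      exact div_nonpos_of_nonpos_of_nonneg this (sqrt_nonneg _)
  have h3 : ∀ q : ℤ, F (n+1+2*q) = Ph k s (2/√n * (((n:ℝ)+1)/2 + q)) := by
    intro q
    rw [hF]; dsimp only
    rw [if_pos ⟨n+1+q, by ring⟩]
    congr 1; push_cast; ring
  have h4 : ∀ H : ℕ, 2 * F (H:ℤ) = omg n H * Ph k s (H/√n) := by
    intro H
    rw [hF]; unfold omg; dsimp only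
    split_ifs with h
    · have h' : Even (H+n+1) := by exact_mod_cast h
      rw [h'.neg_one_pow]; push_cast; ring
    · have h' : ¬ Even (H+n+1) := by exact_mod_cast h
      rw [(Nat.not_even_iff_odd.mp h').neg_one_pow]; ring
  rw [← tsum_congr h3, h1, ← h2, ← tsum_mul_left]
  exact tsum_congr h4

theorem summable_omgPh (k : ℕ) (s : ℤ) (n : ℕ) (hn : 1 ≤ n) :
    Summable (fun H : ℕ => omg n H * Ph k s (H/√n)) := by
  obtain ⟨C, hC, h⟩ := Ph_bound k s (-2)
  have hs : Summable (fun H : ℕ => 1/((H:ℝ))^2) := Real.summable_one_div_nat_pow.mpr (by norm_num)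
  refine Summable.of_norm_bounded (hs.mul_left (2 * (C * n))) fun H => ?_
  have hn' : (0:ℝ) < n := by exact_mod_cast hn
  rw [norm_mul, norm_eq_abs, norm_eq_abs]
  rcases Nat.eq_zero_or_pos H with h0 | h0
  · subst h0; simp [Ph_nonpos]
  · have h0' : (0:ℝ) < H := by exact_mod_cast h0
    have := h (H/√n) (by positivity)
    calc _ ≤ 2 * (C * (H/√n)^(-2:ℤ)) := by
            gcongr; exact abs_omg_le n H
      _ = _ := by
        rw [zpow_neg, show (2:ℤ) = ((2:ℕ):ℤ) from rfl, zpow_natCast, div_pow, sq_sqrt hn'.le]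
        field_simp

theorem tail_omgPh (k : ℕ) (s : ℤ) (K : ℕ) : ∃ C > 0, ∀ n : ℕ, 1 ≤ n →
    |∑' H : ℕ, omg n (H+(n+2)) * Ph k s ((H+(n+2):ℕ)/√n)| ≤ C / n^K := by
  obtain ⟨C, hC, h⟩ := Ph_bound k s (-(2*(K+2):ℕ))
  have hS : 0 ≤ ∑' j : ℕ, 1 / ((j:ℝ)+1)^2 := tsum_nonneg fun _ => by positivity
  refine ⟨2 * C * (∑' j : ℕ, 1 / ((j:ℝ)+1)^2) + 1, by positivity, fun n hn => ?_⟩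
  have hn' : (0:ℝ) < n := by exact_mod_cast hn
  have := tsum_of_norm_bounded (summable_inv_sq.hasSum.mul_left (2 * C / n^K))
    (f := fun H : ℕ => omg n (H+(n+2)) * Ph k s ((H+(n+2):ℕ)/√n)) (by
      intro H
      have hH : (0:ℝ) < ((H+(n+2):ℕ):ℝ) := by positivity
      rw [norm_mul, norm_eq_abs, norm_eq_abs]
      have := h ((H+(n+2):ℕ)/√n) (by positivity)
      calc _ ≤ 2 * (C * (((H+(n+2):ℕ):ℝ)/√n)^(-((2*(K+2):ℕ):ℤ))) := by
            gcongr; exact abs_omg_le n _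
        _ = 2 * C * (n^(K+2) / (((H+(n+2):ℕ):ℝ)^(2*(K+1)) * ((H+(n+2):ℕ):ℝ)^2)) := by
          rw [zpow_neg, zpow_natCast, pow_mul, div_pow, sq_sqrt hn'.le, div_pow, ← pow_mul, ← pow_add]
          rw [show 2*(K+1)+2 = 2*(K+2) by ring]
          field_simp
        _ ≤ 2 * C * (n^(K+2) / ((n:ℝ)^(2*(K+1)) * ((H:ℝ)+1)^2)) := by
          have h1 : (n:ℝ) ≤ ((H+(n+2):ℕ):ℝ) := by push_cast; linarith [Nat.cast_nonneg (α := ℝ) H]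
          have h2 : (H:ℝ)+1 ≤ ((H+(n+2):ℕ):ℝ) := by push_cast; linarith
          gcongr
        _ = 2 * C / n^K * (1/((H:ℝ)+1)^2) := by
          rw [show 2*(K+1) = (K+2)+K by ring, pow_add]
          field_simp
          ring)
  rw [← norm_eq_abs]
  refine this.trans ?_
  rw [div_mul_eq_mul_div]
  gcongr
  linarith

theorem sum_omgPh (k : ℕ) (s : ℤ) (K : ℕ) : ∃ C > 0, ∀ n : ℕ, 1 ≤ n →
    |∑ H ∈ Finset.range (n+2), omg n H * Ph k s (H/√n) - √n * Aint k s| ≤ C / n^K := by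
  obtain ⟨C1, hC1, h1⟩ := tail_omgPh k s K
  obtain ⟨C2, hC2, h2⟩ := poisson_gen (PhS k s) (2*K+1) (by omega)
  refine ⟨C1 + 2 * C2 * 2^(2*K+1), by positivity, fun n hn => ?_⟩
  have hn' : (1:ℝ) ≤ n := by exact_mod_cast hn
  have hn0 : (0:ℝ) < n := by linarith
  have h3 := h2 (2/√n) (((n:ℝ)+1)/2) (by positivity)
  have e1 : ∑' q : ℤ, PhS k s (2/√n * (((n:ℝ)+1)/2 + q)) =
      ((∑' q : ℤ, Ph k s (2/√n * (((n:ℝ)+1)/2 + q)) : ℝ) : ℂ) := by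
    rw [Complex.ofReal_tsum]; rfl
  have e2 : ∫ u, PhS k s u = ((Aint k s : ℝ) : ℂ) := by
    exact integral_ofReal (𝕜 := ℂ) (f := Ph k s)
  rw [e1, e2, ← Complex.ofReal_mul, ← Complex.ofReal_sub, Complex.norm_real, norm_eq_abs] at h3
  have e3 := (summable_omgPh k s n hn).sum_add_tsum_nat_add (n+2)
  rw [← tsum_PhInt] at e3
  have h4 := h1 n hn
  have h5 : (2/√n)^(2*K+1) ≤ 2^(2*K+1) / (n:ℝ)^K := by
    rw [div_pow]
    gcongr
    rw [pow_succ, pow_mul, sq_sqrt hn0.le]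
    have : 1 ≤ √(n:ℝ) := by rw [one_le_sqrt]; exact hn'
    exact le_mul_of_one_le_right (by positivity) this
  set a := ∑' q : ℤ, Ph k s (2/√n * (((n:ℝ)+1)/2 + q))
  set b := ∑' H : ℕ, omg n (H+(n+2)) * Ph k s ((H+(n+2):ℕ)/√n)
  have e4 : ∑ H ∈ Finset.range (n+2), omg n H * Ph k s (H/√n) - √n * Aint k s =
      2 * (a - 1/(2/√n) * Aint k s) - b := by
    rw [one_div_div]; linarith
  rw [e4]
  calc _ ≤ |2 * (a - 1/(2/√n) * Aint k s)| + |b| := abs_sub _ _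
    _ ≤ 2 * (C2 * (2^(2*K+1) / (n:ℝ)^K)) + C1 / n^K := by
      rw [abs_mul, abs_two]
      gcongr
      exact h3.trans (by gcongr)
    _ = _ := by ring


theorem integrable_Ph (k : ℕ) (s : ℤ) : MeasureTheory.Integrable (Ph k s) := by
  have := (PhS k s).integrable (μ := MeasureTheory.volume).re
  exact this

theorem Aint_succ (k : ℕ) (s : ℤ) : Aint (k+1) s = (2*k+1-s) * Aint k s := by
  have h := MeasureTheory.integral_eq_zero_of_hasDerivAt_of_integrable (hasDerivAt_Ph k (s+1))
    (((integrable_Ph _ _).const_mul _).add (integrable_Ph _ _)) (integrable_Ph _ _)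
  rw [MeasureTheory.integral_add ((integrable_Ph _ _).const_mul _) (integrable_Ph _ _),
    MeasureTheory.integral_const_mul, add_sub_cancel_right] at h
  change _ * Aint k s + Aint (k+1) s = 0 at h
  push_cast at h
  linarith

theorem Aint_zero (s : ℕ) : Aint 0 s = cXi * ∫ y in Set.Ioi (0:ℝ), y^(s+1) * thk 0 (y^2/2) := by
  unfold Aint
  rw [← MeasureTheory.integral_const_mul, ← MeasureTheory.integral_indicator measurableSet_Ioi]
  congr 1; ext y
  unfold Ph
  by_cases hy : 0 < y
  · rw [if_pos hy, Set.indicator_of_mem (by exact hy), Xi_zero_dual y hy]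
    rw [zpow_sub_one₀ hy.ne', zpow_natCast]
    field_simp
    ring
  · rw [if_neg hy, Set.indicator_of_notMem (by exact hy)]

noncomputable def gau (p : ℕ) (l y : ℝ) : ℝ := y^p * exp (-l^2 * (y^2/2))

theorem gau_integrable (p : ℕ) (l : ℝ) (hl : 0 < l) :
    MeasureTheory.IntegrableOn (gau p l) (Set.Ioi 0) := by
  have h := integrableOn_rpow_mul_exp_neg_mul_sq (b := l^2/2) (by positivity) (s := p) (by
    have : (0:ℝ) ≤ p := Nat.cast_nonneg p
    linarith)
  refine h.congr_fun (fun y _ => ?_) measurableSet_Ioi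
  unfold gau; dsimp only
  rw [rpow_natCast]; congr 2; ring

theorem gau_integral (p : ℕ) (l : ℝ) (hl : 0 < l) :
    ∫ y in Set.Ioi (0:ℝ), gau p l y = (l^2/2)^(-((p:ℝ)+1)/2) * (1/2) * Gamma (((p:ℝ)+1)/2) := by
  have h := integral_rpow_mul_exp_neg_mul_rpow (p := 2) (q := p) (b := l^2/2) (by norm_num) (by
    have : (0:ℝ) ≤ p := Nat.cast_nonneg p
    linarith) (by positivity)
  rw [← h]
  refine MeasureTheory.setIntegral_congr_fun measurableSet_Ioi fun y _ => ?_
  unfold gau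
  rw [rpow_natCast, rpow_two]; congr 2; ring

theorem gau_one (l : ℝ) (hl : 0 < l) : ∫ y in Set.Ioi (0:ℝ), gau 1 l y = 1/l^2 := by
  rw [gau_integral 1 l hl]
  norm_num [rpow_neg_one]

theorem gau_three (l : ℝ) (hl : 0 < l) : ∫ y in Set.Ioi (0:ℝ), gau 3 l y = 2/l^4 := by
  rw [gau_integral 3 l hl]
  norm_num [rpow_neg]
  rw [← one_div]
  norm_num
  field_simp
  

theorem gau_two (l : ℝ) (hl : 0 < l) : ∫ y in Set.Ioi (0:ℝ), gau 2 l y = √(π/2)/l^3 := by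
  rw [gau_integral 2 l hl]
  have h1 : Gamma ((((2:ℕ):ℝ)+1)/2) = √π/2 := by
    rw [show (((2:ℕ):ℝ)+1)/2 = 1/2+1 by norm_num, Gamma_add_one (by norm_num), Gamma_one_half_eq]; ring
  have h2 : (l^2/2)^(-(((2:ℕ):ℝ)+1)/2) = √2^3 / l^3 := by
    have : l^2/2 = (l/√2)^(2:ℝ) := by rw [rpow_two, div_pow, sq_sqrt]; norm_num
    rw [this, ← rpow_mul (by positivity)]
    rw [show (2:ℝ) * (-(((2:ℕ):ℝ)+1)/2) = -((3:ℕ):ℝ) by norm_num, rpow_neg (by positivity), rpow_natCast,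
      div_pow, inv_div]
  rw [h1, h2, sqrt_div' _ (by norm_num)]
  have : √2^3 = 2 * √2 := by rw [pow_succ, sq_sqrt (by norm_num)]
  rw [this]
  have h3 : √2 * √2 = (2:ℝ) := mul_self_sqrt (by norm_num)
  field_simp
  nlinarith

theorem thTerm_gau (p j : ℕ) (y : ℝ) : y^p * thTerm 0 (y^2/2) j = (-1)^j * (2*j+1) * gau p (2*j+1) y := by
  unfold thTerm gau; ring_nf

theorem hasSum_gau (p : ℕ) (κ : ℝ) (hp : 2 ≤ p)
    (hκ : ∀ l : ℝ, 0 < l → ∫ y in Set.Ioi (0:ℝ), gau p l y = κ/l^(p+1)) :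
    HasSum (fun j : ℕ => κ * ((-1)^j / (2*(j:ℝ)+1)^p)) (∫ y in Set.Ioi (0:ℝ), y^p * thk 0 (y^2/2)) := by
  have hpos : ∀ j : ℕ, (0:ℝ) < 2*j+1 := fun j => by positivity
  have h1 : ∀ j : ℕ, MeasureTheory.Integrable (fun y => (-1)^j * (2*j+1) * gau p (2*j+1) y)
      (MeasureTheory.volume.restrict (Set.Ioi 0)) := fun j => (gau_integrable p _ (hpos j)).const_mul _
  have hn : ∀ j : ℕ, ∫ y in Set.Ioi (0:ℝ), ‖(-1)^j * (2*j+1) * gau p (2*j+1) y‖ = κ * (1/(2*(j:ℝ)+1)^p) := by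
    intro j
    have : ∫ y in Set.Ioi (0:ℝ), ‖(-1)^j * (2*j+1) * gau p (2*j+1) y‖ =
        ∫ y in Set.Ioi (0:ℝ), (2*j+1) * gau p (2*j+1) y := by
      refine MeasureTheory.setIntegral_congr_fun measurableSet_Ioi fun y hy => ?_
      have hy' : (0:ℝ) < y := hy
      rw [norm_mul, norm_mul, norm_pow, norm_neg, norm_one, one_pow, one_mul,
        norm_of_nonneg (hpos j).le, norm_of_nonneg (by unfold gau; positivity)]
    rw [this, MeasureTheory.integral_const_mul, hκ _ (hpos j)]
    have := hpos j
    field_simp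
    ring
  have hs : Summable (fun j : ℕ => κ * (1/(2*(j:ℝ)+1)^p)) := by
    refine Summable.mul_left _ ?_
    refine Summable.of_nonneg_of_le (fun j => by positivity) (fun j => ?_) summable_inv_sq
    refine one_div_le_one_div_of_le (by positivity) ?_
    calc ((j:ℝ)+1)^2 ≤ (2*(j:ℝ)+1)^2 := by gcongr; linarith [Nat.cast_nonneg (α := ℝ) j]
      _ ≤ (2*(j:ℝ)+1)^p := pow_le_pow_right₀ (by linarith [Nat.cast_nonneg (α := ℝ) j]) hp
  have h := MeasureTheory.hasSum_integral_of_summable_integral_norm h1 (by simpa only [hn] using hs)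
  have e1 : ∀ j : ℕ, ∫ y in Set.Ioi (0:ℝ), (-1)^j * (2*j+1) * gau p (2*j+1) y = κ * ((-1)^j / (2*(j:ℝ)+1)^p) := by
    intro j
    rw [MeasureTheory.integral_const_mul, hκ _ (hpos j)]
    have := hpos j
    field_simp
    ring
  simp only [e1] at h
  have e2 : ∫ y in Set.Ioi (0:ℝ), y^p * thk 0 (y^2/2) =
      ∫ y in Set.Ioi (0:ℝ), ∑' j : ℕ, (-1)^j * (2*j+1) * gau p (2*j+1) y := by
    refine MeasureTheory.setIntegral_congr_fun measurableSet_Ioi fun y hy => ?_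
    unfold thk
    rw [← tsum_mul_left]
    exact tsum_congr fun j => thTerm_gau p j y
  rw [e2]; exact h

theorem Aint_zero_one : Aint 0 1 = cXi * (√(π/2) * catalanG) := by
  have h := (hasSum_gau 2 (√(π/2)) le_rfl gau_two).tsum_eq
  have := Aint_zero 1
  push_cast at this
  rw [this, ← h, tsum_mul_left]; rfl

theorem hasSum_cube : HasSum (fun j : ℕ => (-1:ℝ)^j / (2*(j:ℝ)+1)^3) (π^3/32) := by
  have h := hasSum_one_div_nat_pow_mul_sin (k := 1) (by norm_num) (x := 1/4) ⟨by norm_num, by norm_num⟩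
  have h2 := hasSum_odd_of_sin (fun n => 1/(n:ℝ)^3) _ (by
    convert h using 1
    ext n; congr 2; ring)
  convert h2 using 1
  · ext j; push_cast; ring
  · norm_num [Polynomial.bernoulli, Finset.sum_range_succ, bernoulli_eq_bernoulli'_of_ne_one, bernoulli'_three, bernoulli'_two, bernoulli_one, Nat.choose, Nat.factorial]
    ring

theorem Aint_zero_two : Aint 0 2 = cXi * (π^3/16) := by
  have h := (hasSum_gau 3 2 (by norm_num) gau_three).unique (hasSum_cube.mul_left 2)
  have := Aint_zero 2
  push_cast at this
  rw [this, h]; ring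

theorem hasSum_pair (S : ℝ) (h : HasSum (fun i : ℕ => 1/(4*(i:ℝ)+1) - 1/(4*(i:ℝ)+3)) S) : S = π/4 := by
  have h1 := h.tendsto_sum_nat
  have h2 := Real.tendsto_sum_pi_div_four.comp (Filter.tendsto_id.const_mul_atTop' (by norm_num : 0 < 2))
  refine tendsto_nhds_unique h1 (h2.congr fun N => ?_)
  simp only [Function.comp, id]
  induction N with
  | zero => simp
  | succ N ih =>
    rw [show 2*(N+1) = 2*N+1+1 by ring, Finset.sum_range_succ, Finset.sum_range_succ, Finset.sum_range_succ, ih]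
    rw [pow_succ, pow_mul]
    push_cast
    norm_num
    ring

theorem Aint_zero_zero : Aint 0 0 = cXi * (π/4) := by
  have h0 := Aint_zero 0
  push_cast at h0
  rw [h0]
  congr 1
  have hpos : ∀ i : ℕ, (0:ℝ) < 4*i+1 := fun j => by positivity
  have hpos3 : ∀ i : ℕ, (0:ℝ) < 4*i+3 := fun j => by positivity
  have hi1 := fun i : ℕ => gau_integrable 1 (4*i+1) (hpos i)
  have hi3 := fun i : ℕ => gau_integrable 1 (4*i+3) (hpos3 i)
  set F : ℕ → ℝ → ℝ := fun i y => (4*i+1) * gau 1 (4*i+1) y - (4*i+3) * gau 1 (4*i+3) y with hF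
  have h1 : ∀ i : ℕ, MeasureTheory.Integrable (F i) (MeasureTheory.volume.restrict (Set.Ioi 0)) :=
    fun i => ((hi1 i).const_mul _).sub ((hi3 i).const_mul _)
  have hn : ∀ i : ℕ, ∫ y in Set.Ioi (0:ℝ), ‖F i y‖ ≤ 10 * (1/((i:ℝ)+1)^2) := by
    intro i
    have hle : ∫ y in Set.Ioi (0:ℝ), ‖F i y‖ ≤
        ∫ y in Set.Ioi (0:ℝ), ((4*i+1) * gau 1 (4*i+1) y - (4*i-1) * gau 1 (4*i+3) y) := by
      refine MeasureTheory.setIntegral_mono_on (h1 i).norm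
        (((hi1 i).const_mul _).sub ((hi3 i).const_mul _)) measurableSet_Ioi fun y hy => ?_
      have hy' : (0:ℝ) < y := hy
      have hg : gau 1 (4*i+3) y ≤ gau 1 (4*i+1) y := by
        unfold gau
        gcongr
        nlinarith [hpos i, hpos3 i]
      have hg0 : 0 < gau 1 (4*i+3) y := by unfold gau; positivity
      rw [hF, norm_eq_abs, abs_le]
      have := mul_le_mul_of_nonneg_left hg (hpos i).le
      constructor <;> nlinarith
    refine hle.trans ?_
    rw [MeasureTheory.integral_sub ((hi1 i).const_mul _) ((hi3 i).const_mul _),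
      MeasureTheory.integral_const_mul, MeasureTheory.integral_const_mul, gau_one _ (hpos i), gau_one _ (hpos3 i)]
    have hi0 : (0:ℝ) ≤ i := Nat.cast_nonneg i
    generalize (i:ℝ) = x at *
    have e : (4*x+1) * (1/(4*x+1)^2) - (4*x-1) * (1/(4*x+3)^2) = (24*x+10) / ((4*x+1)*(4*x+3)^2) := by
      have : 4*x+1 ≠ 0 := by positivity
      have : 4*x+3 ≠ 0 := by positivity
      field_simp
      ring
    rw [e, mul_one_div, div_le_div_iff₀ (by positivity) (by positivity)]
    nlinarith [mul_nonneg hi0 hi0, mul_nonneg hi0 (mul_nonneg hi0 hi0)]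
  have hs : Summable (fun i => ∫ y in Set.Ioi (0:ℝ), ‖F i y‖) :=
    Summable.of_nonneg_of_le (fun i => MeasureTheory.integral_nonneg fun _ => norm_nonneg _) hn
      (summable_inv_sq.mul_left 10)
  have h := MeasureTheory.hasSum_integral_of_summable_integral_norm h1 hs
  have e1 : ∀ i : ℕ, ∫ y in Set.Ioi (0:ℝ), F i y = 1/(4*(i:ℝ)+1) - 1/(4*(i:ℝ)+3) := by
    intro i
    rw [hF]; dsimp only
    rw [MeasureTheory.integral_sub ((hi1 i).const_mul _) ((hi3 i).const_mul _),
      MeasureTheory.integral_const_mul, MeasureTheory.integral_const_mul, gau_one _ (hpos i), gau_one _ (hpos3 i)]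
    have := hpos i
    have := hpos3 i
    field_simp
  simp only [e1] at h
  rw [← hasSum_pair _ h]
  refine MeasureTheory.setIntegral_congr_fun measurableSet_Ioi fun y hy => ?_
  have hy' : (0:ℝ) < y := hy
  have hsum := summable_thTerm 0 (y^2/2) (by positivity)
  have hse : Summable (fun i => thTerm 0 (y^2/2) (2*i)) := hsum.comp_injective (fun a b h => by simpa using h)
  have hso : Summable (fun i => thTerm 0 (y^2/2) (2*i+1)) := hsum.comp_injective (fun a b h => by simpa using h)
  unfold thk
  rw [← tsum_even_add_odd hse hso, ← hse.tsum_add hso, ← tsum_mul_left]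
  refine tsum_congr fun i => ?_
  rw [mul_add, thTerm_gau, thTerm_gau, hF]
  dsimp only
  rw [pow_succ, pow_mul]
  push_cast
  rw [show (2:ℝ)*(2*i)+1 = 4*i+1 by ring, show (2:ℝ)*(2*i+1)+1 = 4*i+3 by ring]
  norm_num
  ring


noncomputable def tr : ℕ → ℕ → ℝ
  | 0, 0 => 1
  | 0, 1 => -1/6
  | 0, 2 => 1/120
  | 0, 3 => -1/5040
  | 0, 4 => 1/362880
  | 0, 5 => -1/39916800
  | 1, 1 => 1/12
  | 1, 2 => 1/120
  | 1, 3 => 113/30240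
  | 1, 4 => 1117/907200
  | 1, 5 => 34021/79833600
  | 2, 2 => 1/144
  | 2, 3 => 11/4320
  | 2, 4 => 1921/1814400
  | 2, 5 => 19/44800
  | 3, 3 => 1/1728
  | 3, 4 => 19/51840
  | 3, 5 => 1391/7257600
  | 4, 4 => 1/20736
  | 4, 5 => 1/23040
  | 5, 5 => 1/248832
  | _, _ => 0

noncomputable def gT (v : ℝ) : ℝ := v/12 + v^2/45 + 17*v^3/2520 + 31*v^4/14175 + 691*v^5/935550

noncomputable def sT (v : ℝ) : ℝ := 1 - v/6 + v^2/120 - v^3/5040 + v^4/362880 - v^5/39916800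

noncomputable def trp (j : ℕ) (v : ℝ) : ℝ := ∑ o ∈ Finset.range 6, tr j o * v^o

theorem bdd_unit (f : ℝ → ℝ) (hf : Continuous f) : ∃ C > 0, ∀ v : ℝ, 0 ≤ v → v ≤ 1 → |f v| ≤ C := by
  obtain ⟨C, hC⟩ := isCompact_Icc.exists_bound_of_continuousOn (s := Set.Icc (0:ℝ) 1) hf.continuousOn
  refine ⟨|C| + 1, by positivity, fun v h0 h1 => ?_⟩
  have := hC v ⟨h0, h1⟩
  rw [norm_eq_abs] at this
  linarith [le_abs_self C]

theorem trp_zero (v : ℝ) : trp 0 v = sT v := by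
  simp only [trp, Finset.sum_range_succ, Finset.sum_range_zero, tr, sT]; ring

theorem trp_step (j : ℕ) (hj : j < 5) : ∃ r : ℝ → ℝ, Continuous r ∧ ∀ v, gT v * trp j v = trp (j+1) v + v^6 * r v := by
  interval_cases j
  · refine ⟨fun v => (-593233/5588352000)*v^0 + (8747/1524096000)*v^1 + (-11579/82301184000)*v^2 + (1681/848730960000)*v^3 + (-691/37344162240000)*v^4, by fun_prop, fun v => ?_⟩
    simp only [trp, Finset.sum_range_succ, Finset.sum_range_zero, tr, gT]; ring
  · refine ⟨fun v => (5628263/33530112000)*v^0 + (15727/489888000)*v^1 + (25130011/3017710080000)*v^2 + (6251341/3394923840000)*v^3 + (23508511/74688324480000)*v^4, by fun_prop, fun v => ?_⟩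
    simp only [trp, Finset.sum_range_succ, Finset.sum_range_zero, tr, gT]; ring
  · refine ⟨fun v => (59593/653184000)*v^0 + (1371287/50295168000)*v^1 + (2904071/411505920000)*v^2 + (25909/15155910000)*v^3 + (13129/41912640000)*v^4, by fun_prop, fun v => ?_⟩
    simp only [trp, Finset.sum_range_succ, Finset.sum_range_zero, tr, gT]; ring
  · refine ⟨fun v => (7321/261273600)*v^0 + (15671/1959552000)*v^1 + (4566269/1810626048000)*v^2 + (2342023/3394923840000)*v^3 + (961181/6789847680000)*v^4, by fun_prop, fun v => ?_⟩
    simp only [trp, Finset.sum_range_succ, Finset.sum_range_zero, tr, gT]; ring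
  · refine ⟨fun v => (7/1492992)*v^0 + (337/261273600)*v^1 + (1873/4702924800)*v^2 + (6331/48498912000)*v^3 + (691/21555072000)*v^4, by fun_prop, fun v => ?_⟩
    simp only [trp, Finset.sum_range_succ, Finset.sum_range_zero, tr, gT]; ring

theorem continuous_gT : Continuous gT := by unfold gT; fun_prop

theorem continuous_sT : Continuous sT := by unfold sT; fun_prop

theorem gT_pow (j : ℕ) (hj : j < 6) : ∃ r : ℝ → ℝ, Continuous r ∧ ∀ v, gT v ^ j * sT v = trp j v + v^6 * r v := by
  induction j with
  | zero => exact ⟨fun _ => 0, continuous_const, fun v => by rw [trp_zero]; ring⟩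
  | succ j ih =>
    obtain ⟨r, hr, h⟩ := ih (by omega)
    obtain ⟨r', hr', h'⟩ := trp_step j (by omega)
    refine ⟨fun v => gT v * r v + r' v, (continuous_gT.mul hr).add hr', fun v => ?_⟩
    rw [pow_succ', mul_assoc, h, mul_add, h']; ring

theorem re_im_bound (a b T : ℝ) (h : ‖(a:ℂ) + (b:ℂ) * Complex.I‖ ≤ T) : |b| ≤ T ∧ |a| ≤ T := by
  constructor
  · simpa using (Complex.abs_im_le_norm _).trans h
  · simpa using (Complex.abs_re_le_norm _).trans h

theorem sin_cos_taylor (t : ℝ) (h0 : 0 ≤ t) (h1 : t ≤ 1) :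
    |sin t - t * sT (t^2)| ≤ t^13 ∧
    |cos t - (1 - t^2/2 + t^4/24 - t^6/720 + t^8/40320 - t^10/3628800 + t^12/479001600)| ≤ t^13 := by
  have h := Complex.exp_bound (x := (t:ℂ) * Complex.I) (by simpa [abs_of_nonneg h0] using h1) (n := 13) (by norm_num)
  have hn : ‖(t:ℂ) * Complex.I‖ = t := by simp [abs_of_nonneg h0]
  rw [hn] at h
  have hb : t^13 * ((Nat.succ 13 : ℕ) * ((Nat.factorial 13 : ℕ) * (13:ℕ) : ℝ)⁻¹ : ℝ) ≤ t^13 := by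
    refine mul_le_of_le_one_right (by positivity) ?_
    norm_num [Nat.factorial]
  have h2 := h.trans hb
  have hI2 : Complex.I^2 = -1 := Complex.I_sq
  have e : Complex.exp ((t:ℂ) * Complex.I) - ∑ m ∈ Finset.range 13, ((t:ℂ) * Complex.I)^m / (m.factorial : ℂ) =
     ((cos t - (1 - t^2/2 + t^4/24 - t^6/720 + t^8/40320 - t^10/3628800 + t^12/479001600) : ℝ) : ℂ)
     + ((sin t - t * sT (t^2) : ℝ) : ℂ) * Complex.I := by
    rw [Complex.exp_mul_I]
    have p3 : Complex.I^3 = -Complex.I := by rw [pow_succ, hI2]; ring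
    have p4 : Complex.I^4 = 1 := by rw [show 4 = 2*2 by norm_num, pow_mul, hI2]; norm_num
    have p5 : Complex.I^5 = Complex.I := by rw [pow_succ, p4]; ring
    have p6 : Complex.I^6 = -1 := by rw [pow_succ, p5, ← sq, hI2]
    have p7 : Complex.I^7 = -Complex.I := by rw [pow_succ, p6]; ring
    have p8 : Complex.I^8 = 1 := by rw [show 8 = 4*2 by norm_num, pow_mul, p4]; norm_num
    have p9 : Complex.I^9 = Complex.I := by rw [pow_succ, p8]; ring
    have p10 : Complex.I^10 = -1 := by rw [pow_succ, p9, ← sq, hI2]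
    have p11 : Complex.I^11 = -Complex.I := by rw [pow_succ, p10]; ring
    have p12 : Complex.I^12 = 1 := by rw [show 12 = 4*3 by norm_num, pow_mul, p4]; norm_num
    simp only [Finset.sum_range_succ, Finset.sum_range_zero, mul_pow, p3, p4, p5, p6, p7, p8, p9, p10, p11, p12, hI2, sT]
    push_cast [Nat.factorial]
    ring
  rw [e] at h2
  exact re_im_bound _ _ _ h2

noncomputable def tT (t : ℝ) : ℝ := t + t^3/3 + 2*t^5/15 + 17*t^7/315 + 62*t^9/2835 + 1382*t^11/155925

theorem tan_taylor : ∃ C > 0, ∀ t : ℝ, 0 ≤ t → t ≤ 1 → |sin t / cos t - tT t| ≤ C * t^13 := by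
  obtain ⟨C1, hC1, h1⟩ := bdd_unit (fun t => (16387/4561920)*t^0 + (-1901323/5588352000)*t^2 + (19753/1676505600)*t^4 + (-96827/452656512000)*t^6 + (8137/3394923840000)*t^8 + (-691/37344162240000)*t^10) (by fun_prop)
  obtain ⟨C2, hC2, h2⟩ := bdd_unit tT (by unfold tT; fun_prop)
  have hc1 : 0 < cos 1 := cos_pos_of_mem_Ioo ⟨by linarith [pi_pos], by linarith [pi_gt_three]⟩
  refine ⟨(1 + C2 + C1) / cos 1, by positivity, fun t h0 ht => ?_⟩
  have hc : cos 1 ≤ cos t := cos_le_cos_of_nonneg_of_le_pi h0 (by linarith [pi_gt_three]) ht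
  have hc0 : 0 < cos t := by linarith
  obtain ⟨hs, hco⟩ := sin_cos_taylor t h0 ht
  have hq := h1 t h0 ht
  have hT := h2 t h0 ht
  set B := 1 - t^2/2 + t^4/24 - t^6/720 + t^8/40320 - t^10/3628800 + t^12/479001600 with hB
  have e : sin t - tT t * cos t = (sin t - t * sT (t^2)) - tT t * (cos t - B) + t^13 * ((16387/4561920)*t^0 + (-1901323/5588352000)*t^2 + (19753/1676505600)*t^4 + (-96827/452656512000)*t^6 + (8137/3394923840000)*t^8 + (-691/37344162240000)*t^10) := by
    rw [hB]; unfold tT sT; ring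
  have hb : |sin t - tT t * cos t| ≤ (1 + C2 + C1) * t^13 := by
    rw [e]
    calc _ ≤ |sin t - t * sT (t^2)| + |tT t * (cos t - B)| + |t^13 * ((16387/4561920)*t^0 + (-1901323/5588352000)*t^2 + (19753/1676505600)*t^4 + (-96827/452656512000)*t^6 + (8137/3394923840000)*t^8 + (-691/37344162240000)*t^10)| :=
          (abs_add_le _ _).trans (by gcongr; exact abs_sub _ _)
      _ ≤ t^13 + C2 * t^13 + t^13 * C1 := by
          rw [abs_mul, abs_mul, abs_of_nonneg (by positivity : 0 ≤ t^13)]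
          gcongr
      _ = _ := by ring
  rw [show sin t / cos t - tT t = (sin t - tT t * cos t) / cos t by field_simp, abs_div, abs_of_pos hc0]
  calc _ ≤ (1 + C2 + C1) * t^13 / cos 1 := by gcongr
    _ = _ := by ring

theorem hasDerivAt_logcos (t : ℝ) (h : cos t ≠ 0) : HasDerivAt (fun t => -log (cos t)) (sin t / cos t) t := by
  refine ((hasDerivAt_cos t).log h).neg.congr_deriv ?_
  ring

theorem logcos_taylor : ∃ C > 0, ∀ t : ℝ, 0 ≤ t → t ≤ 1 →
    |-log (cos t) - t^2/2 - t^2 * gT (t^2)| ≤ C * t^14 := by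
  obtain ⟨C, hC, h⟩ := tan_taylor
  refine ⟨C, hC, fun t h0 h1 => ?_⟩
  have hd : ∀ x ∈ Set.Icc 0 t, HasDerivWithinAt (fun t => -log (cos t) - t^2/2 - t^2 * gT (t^2))
      (sin x / cos x - tT x) (Set.Icc 0 t) x := by
    intro x hx
    have hc : cos x ≠ 0 := (cos_pos_of_mem_Ioo ⟨by linarith [pi_pos, hx.1], by linarith [pi_gt_three, hx.2]⟩).ne'
    have hp : HasDerivAt (fun t : ℝ => t^2/2 + t^2 * gT (t^2)) (tT x) x := by
      have e : (fun t : ℝ => t^2/2 + t^2 * gT (t^2)) = fun t => (1/2)*t^2 + (1/12)*t^4 + (1/45)*t^6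
          + (17/2520)*t^8 + (31/14175)*t^10 + (691/935550)*t^12 := by
        ext t; unfold gT; ring
      rw [e]
      have := (((((((hasDerivAt_pow 2 x).const_mul (1/2)).add ((hasDerivAt_pow 4 x).const_mul (1/12))).add
        ((hasDerivAt_pow 6 x).const_mul (1/45))).add ((hasDerivAt_pow 8 x).const_mul (17/2520))).add
        ((hasDerivAt_pow 10 x).const_mul (31/14175))).add ((hasDerivAt_pow 12 x).const_mul (691/935550)))
      refine HasDerivAt.congr_deriv this ?_
      unfold tT; norm_num; ring
    have := ((hasDerivAt_logcos x hc).sub hp).hasDerivWithinAt (s := Set.Icc 0 t)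
    refine this.congr_of_eventuallyEq (Filter.Eventually.of_forall fun y => ?_) ?_
    · simp only [Pi.sub_apply]; ring
    · simp only [Pi.sub_apply]; ring
  have := (convex_Icc (0:ℝ) t).norm_image_sub_le_of_norm_hasDerivWithin_le (C := C * t^13) hd (fun x hx => by
    refine (h x hx.1 (hx.2.trans h1)).trans ?_
    have := hx.1; have := hx.2
    gcongr) ⟨le_rfl, h0⟩ ⟨h0, le_rfl⟩
  simp only [cos_zero, log_one, norm_eq_abs] at this
  rw [sub_zero t, abs_of_nonneg h0] at this
  calc _ = _ := by congr 1; ring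
    _ ≤ C * t^13 * t := this
    _ = _ := by ring

theorem cos_le_gauss (t : ℝ) (h0 : 0 ≤ t) (h1 : t < π/2) : 0 ≤ -log (cos t) - t^2/2 := by
  have hd : ∀ x ∈ Set.Ico 0 (π/2), HasDerivAt (fun t => -log (cos t) - t^2/2) (sin x / cos x - x) x := by
    intro x hx
    have hc : cos x ≠ 0 := (cos_pos_of_mem_Ioo ⟨by linarith [pi_pos, hx.1], hx.2⟩).ne'
    refine ((hasDerivAt_logcos x hc).sub ((hasDerivAt_pow 2 x).div_const 2)).congr_deriv ?_
    norm_num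
  have hm : MonotoneOn (fun t => -log (cos t) - t^2/2) (Set.Ico 0 (π/2)) := by
    refine monotoneOn_of_deriv_nonneg (convex_Ico _ _) (fun x hx => (hd x hx).continuousAt.continuousWithinAt)
      (fun x hx => ?_) (fun x hx => ?_)
    · rw [interior_Ico] at hx
      exact (hd x ⟨hx.1.le, hx.2⟩).differentiableAt.differentiableWithinAt
    · rw [interior_Ico] at hx
      rw [(hd x ⟨hx.1.le, hx.2⟩).deriv, ← tan_eq_sin_div_cos]
      linarith [le_tan hx.1.le hx.2]
  have := hm (a := 0) (b := t) ⟨le_rfl, by positivity⟩ ⟨h0, h1⟩ h0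
  simpa using this


noncomputable def PP (x v : ℝ) : ℝ := ∑ j ∈ Finset.range 6, (-1)^j / (j.factorial : ℝ) * x^j * trp j v

theorem abs_E5_le (u Y : ℝ) (hu : 0 ≤ u) (h : ∀ j < 6, u^j ≤ Y) :
    |∑ j ∈ Finset.range 6, (-u)^j / (j.factorial : ℝ)| ≤ 6 * Y := by
  calc _ ≤ ∑ j ∈ Finset.range 6, |(-u)^j / (j.factorial : ℝ)| := Finset.abs_sum_le_sum_abs _ _
    _ ≤ ∑ j ∈ Finset.range 6, Y := by
      refine Finset.sum_le_sum fun j hj => ?_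
      rw [abs_div, abs_pow, abs_neg, abs_of_nonneg hu, abs_of_pos (by positivity)]
      refine (div_le_self (by positivity) ?_).trans (h j (by simpa using hj))
      exact_mod_cast Nat.succ_le_of_lt j.factorial_pos
    _ = 6 * Y := by simp

theorem exp6 (u : ℝ) (hu : 0 ≤ u) :
    |exp (-u) - ∑ j ∈ Finset.range 6, (-u)^j / (j.factorial : ℝ)| ≤ 7 * u^6 := by
  rcases le_or_gt u 1 with h | h
  · have := Real.exp_bound (x := -u) (by rwa [abs_neg, abs_of_nonneg hu]) (n := 6) (by norm_num)
    rw [abs_neg, abs_of_nonneg hu] at this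
    refine this.trans ?_
    rw [mul_comm]
    gcongr
    norm_num [Nat.factorial]
  · have h1 : ∀ j < 7, u^j ≤ u^6 := fun j hj => pow_le_pow_right₀ h.le (by omega)
    have h2 := abs_E5_le u (u^6) hu fun j hj => h1 j (by omega)
    have h3 : |exp (-u)| ≤ u^6 := by
      rw [abs_of_pos (exp_pos _)]
      exact (exp_le_one_iff.mpr (by linarith)).trans (by simpa using h1 0 (by norm_num))
    exact (abs_sub _ _).trans (by linarith)

theorem abs_exp_sub (a b : ℝ) (ha : 0 ≤ a) (hb : 0 ≤ b) : |exp (-a) - exp (-b)| ≤ |a - b| := by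
  wlog hab : a ≤ b generalizing a b
  · rw [abs_sub_comm, abs_sub_comm a]; exact this b a hb ha (by linarith)
  rw [abs_of_nonneg (by simpa using hab), abs_of_nonpos (by linarith)]
  have h1 : exp (-b) = exp (-a) * exp (a-b) := by rw [← exp_add]; ring_nf
  have h2 := add_one_le_exp (a-b)
  have h3 : exp (-a) ≤ 1 := exp_le_one_iff.mpr (by linarith)
  have h4 := exp_pos (-a)
  rw [h1]
  nlinarith

theorem gT_bounds (v : ℝ) (h0 : 0 ≤ v) (h1 : v ≤ 1) : 0 ≤ gT v ∧ gT v ≤ v := by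
  unfold gT
  refine ⟨by positivity, ?_⟩
  have h2 : v^2 ≤ v := by nlinarith
  have h3 : v^3 ≤ v := by nlinarith [mul_nonneg h0 h0]
  have h4 : v^4 ≤ v := by nlinarith [mul_nonneg h0 h0, mul_nonneg h0 (mul_nonneg h0 h0)]
  have h5 : v^5 ≤ v := by
    have : v^5 = v^4 * v := by ring
    nlinarith
  linarith

theorem expand_small : ∃ C > 0, ∀ (n : ℕ) (t : ℝ), 0 ≤ t → t ≤ 1 →
    |cos t^n * sin t - exp (-(n*t^2)/2) * t * PP (n*t^2) (t^2)| ≤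
      C * (exp (-(n*t^2)/2) * t * (t^2)^6 * (1+n*t^2)^6) := by
  obtain ⟨C1, hC1, h1⟩ := logcos_taylor
  choose r hr hr2 using fun j : Fin 6 => gT_pow j j.2
  choose Cr hCr hr3 using fun j : Fin 6 => bdd_unit (r j) (hr j)
  have hS : 0 ≤ ∑ j, Cr j := Finset.sum_nonneg fun j _ => (hCr j).le
  refine ⟨C1 + 7 + 6 + ∑ j, Cr j, by positivity, fun n t h0 ht => ?_⟩
  have hv0 : 0 ≤ t^2 := by positivity
  have hv1 : t^2 ≤ 1 := by nlinarith
  have hw := h1 t h0 ht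
  have hw0 := cos_le_gauss t h0 (by linarith [pi_gt_three])
  have hc : 0 < cos t := cos_pos_of_mem_Ioo ⟨by linarith [pi_pos], by linarith [pi_gt_three]⟩
  obtain ⟨hg0, hg1⟩ := gT_bounds (t^2) hv0 hv1
  have hsin := (sin_cos_taylor t h0 ht).1
  have hsle : |sin t| ≤ t := (abs_sin_le_abs (x := t)).trans_eq (abs_of_nonneg h0)
  set w := -log (cos t) - t^2/2 with hwd
  have hn0 : (0:ℝ) ≤ n := Nat.cast_nonneg n
  have e1 : cos t^n = exp (-(n*t^2)/2) * exp (-(n*w)) := by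
    rw [← exp_add, ← exp_log hc, ← exp_nat_mul, hwd]
    congr 1; ring
  set x := (n:ℝ)*t^2 with hx
  have hx0 : 0 ≤ x := by positivity
  set v := t^2 with hv
  set u := x * gT v with hu
  have hu0 : 0 ≤ u := by positivity
  set E5 := ∑ j ∈ Finset.range 6, (-u)^j / (j.factorial : ℝ) with hE5
  have hY : ∀ j ≤ 6, x^j ≤ (1+x)^6 := fun j hj =>
    (pow_le_pow_left₀ hx0 (by linarith) j).trans (pow_le_pow_right₀ (by linarith) hj)
  have D1 : |exp (-(n*w)) - exp (-u)| ≤ C1 * (v^6 * (1+x)^6) := by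
    calc _ ≤ |n*w - u| := abs_exp_sub _ _ (by positivity) hu0
      _ = n * |w - v * gT v| := by
          rw [show n*w - u = n * (w - v * gT v) by rw [hu, hx]; ring, abs_mul, abs_of_nonneg hn0]
      _ ≤ n * (C1 * t^14) := by gcongr
      _ = C1 * (v^6 * x^1) := by rw [hx, hv]; ring
      _ ≤ _ := by gcongr; exact hY 1 (by norm_num)
  have hux : u ≤ x := by rw [hu]; exact mul_le_of_le_one_right hx0 (hg1.trans hv1)
  have D2 : |exp (-u) - E5| ≤ 7 * (v^6 * (1+x)^6) := by
    calc _ ≤ 7 * u^6 := exp6 u hu0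
      _ ≤ 7 * (x * v)^6 := by gcongr; exact mul_le_mul_of_nonneg_left hg1 hx0
      _ = 7 * (v^6 * x^6) := by ring
      _ ≤ _ := by gcongr; linarith
  have D3 : |E5| ≤ 6 * (1+x)^6 := abs_E5_le u _ hu0 fun j hj =>
    (pow_le_pow_left₀ hu0 hux j).trans (hY j hj.le)
  have D4 : |E5 * sT v - PP x v| ≤ (∑ j, Cr j) * (v^6 * (1+x)^6) := by
    have : E5 * sT v - PP x v = ∑ j : Fin 6, (-1)^(j:ℕ) / ((j:ℕ).factorial : ℝ) * x^(j:ℕ) * (v^6 * r j v) := by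
      rw [hE5, PP, Finset.sum_mul, ← Finset.sum_sub_distrib, Finset.sum_range]
      refine Finset.sum_congr rfl fun j _ => ?_
      have := hr2 j v
      have e : (-u)^(j:ℕ) = (-1)^(j:ℕ) * x^(j:ℕ) * gT v^(j:ℕ) := by rw [hu, neg_pow, mul_pow]; ring
      rw [e]
      linear_combination ((-1)^(j:ℕ) / ((j:ℕ).factorial : ℝ) * x^(j:ℕ)) * this
    rw [this, Finset.sum_mul]
    refine (Finset.abs_sum_le_sum_abs _ _).trans (Finset.sum_le_sum fun j _ => ?_)
    have hf : (1:ℝ) ≤ ((j:ℕ).factorial : ℝ) := by exact_mod_cast Nat.succ_le_of_lt (Nat.factorial_pos _)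
    rw [abs_mul, abs_mul, abs_mul, abs_div, abs_pow, abs_neg, abs_one, one_pow, abs_of_nonneg (by positivity : 0 ≤ x^(j:ℕ)),
      abs_of_nonneg (by positivity : 0 ≤ v^6), abs_of_pos (by positivity : (0:ℝ) < ((j:ℕ).factorial : ℝ))]
    calc _ ≤ 1 * (1+x)^6 * (v^6 * Cr j) := by
          gcongr
          · exact (div_le_one (by positivity)).mpr hf
          · exact hY j j.2.le
          · exact hr3 j v hv0 hv1
      _ = _ := by ring
  have e2 : cos t^n * sin t - exp (-x/2) * t * PP x v =
      exp (-x/2) * ((exp (-(n*w)) - exp (-u)) * sin t + (exp (-u) - E5) * sin t + E5 * (sin t - t * sT v)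
        + t * (E5 * sT v - PP x v)) := by
    rw [e1]; ring
  rw [e2, abs_mul, abs_of_pos (exp_pos _)]
  have : (C1 + 7 + 6 + ∑ j, Cr j) * (exp (-x/2) * t * v^6 * (1+x)^6) =
    exp (-x/2) * (C1 * (v^6 * (1+x)^6) * t + 7 * (v^6 * (1+x)^6) * t + 6 * (1+x)^6 * (t * v^6) + t * ((∑ j, Cr j) * (v^6 * (1+x)^6))) := by ring
  rw [this]
  gcongr
  refine (abs_add_le _ _).trans (add_le_add ((abs_add_le _ _).trans (add_le_add ((abs_add_le _ _).trans (add_le_add ?_ ?_)) ?_)) ?_)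
  · rw [abs_mul]; gcongr
  · rw [abs_mul]; gcongr
  · rw [abs_mul]; gcongr
    refine hsin.trans_eq ?_
    rw [hv]; ring
  · rw [abs_mul, abs_of_nonneg h0]; gcongr

theorem PP_bound : ∃ C > 0, ∀ x v : ℝ, 0 ≤ x → 1 ≤ v → |PP x v| ≤ C * (v^6 * (1+x)^6) := by
  refine ⟨∑ j ∈ Finset.range 6, ∑ o ∈ Finset.range 6, |tr j o| + 1, by positivity, fun x v hx hv => ?_⟩
  have hY : ∀ j ≤ 6, x^j ≤ (1+x)^6 := fun j hj =>
    (pow_le_pow_left₀ hx (by linarith) j).trans (pow_le_pow_right₀ (by linarith) hj)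
  unfold PP
  have : |∑ j ∈ Finset.range 6, (-1)^j / (j.factorial : ℝ) * x^j * trp j v| ≤
      (∑ j ∈ Finset.range 6, ∑ o ∈ Finset.range 6, |tr j o|) * (v^6 * (1+x)^6) := by
    rw [Finset.sum_mul]
    refine (Finset.abs_sum_le_sum_abs _ _).trans (Finset.sum_le_sum fun j hj => ?_)
    have hf : (1:ℝ) ≤ (j.factorial : ℝ) := by exact_mod_cast Nat.succ_le_of_lt (Nat.factorial_pos _)
    have h2 : |trp j v| ≤ (∑ o ∈ Finset.range 6, |tr j o|) * v^6 := by
      unfold trp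
      rw [Finset.sum_mul]
      refine (Finset.abs_sum_le_sum_abs _ _).trans (Finset.sum_le_sum fun o ho => ?_)
      rw [abs_mul, abs_of_nonneg (by positivity : 0 ≤ v^o)]
      gcongr
      exact (by simpa using ho : o < 6).le
    rw [abs_mul, abs_mul, abs_div, abs_pow, abs_neg, abs_one, one_pow, abs_of_nonneg (by positivity : 0 ≤ x^j),
      abs_of_pos (by positivity : (0:ℝ) < (j.factorial : ℝ))]
    calc _ ≤ 1 * (1+x)^6 * ((∑ o ∈ Finset.range 6, |tr j o|) * v^6) := by
          gcongr
          · exact (div_le_one (by positivity)).mpr hf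
          · exact hY j (by simpa using hj : j < 6).le
      _ = _ := by ring
  refine this.trans ?_
  gcongr
  linarith

theorem Dn_le (n : ℕ) (t : ℝ) (h0 : 0 ≤ t) : |Dn n t| ≤ exp (-(n*t^2)/2) * t := by
  unfold Dn
  split_ifs with h
  · have hc : 0 < cos t := cos_pos_of_mem_Ioo ⟨by linarith [pi_pos], h⟩
    have hw0 := cos_le_gauss t h0 h
    rw [abs_mul, abs_of_nonneg (by positivity)]
    have hsle : |sin t| ≤ t := (abs_sin_le_abs (x := t)).trans_eq (abs_of_nonneg h0)
    gcongr
    have : cos t ≤ exp (-t^2/2) := by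
      rw [← exp_log hc]; apply exp_le_exp.mpr; linarith
    calc cos t^n ≤ exp (-t^2/2)^n := by gcongr
      _ = _ := by rw [← exp_nat_mul]; congr 1; ring
  · rw [abs_zero]; positivity

theorem expand_all : ∃ C > 0, ∀ (n : ℕ) (t : ℝ), 0 ≤ t →
    |Dn n t - exp (-(n*t^2)/2) * t * PP (n*t^2) (t^2)| ≤
      C * (exp (-(n*t^2)/2) * t * (t^2)^6 * (1+n*t^2)^6) := by
  obtain ⟨C1, hC1, h1⟩ := expand_small
  obtain ⟨C2, hC2, h2⟩ := PP_bound
  refine ⟨C1 + C2 + 1, by positivity, fun n t h0 => ?_⟩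
  rcases le_or_gt t 1 with ht | ht
  · have e : Dn n t = cos t^n * sin t := by unfold Dn; rw [if_pos (by linarith [pi_gt_three])]
    rw [e]
    refine (h1 n t h0 ht).trans ?_
    gcongr; linarith
  · have hx : (0:ℝ) ≤ n*t^2 := by positivity
    have hv : 1 ≤ t^2 := by nlinarith
    have a1 := Dn_le n t h0
    have a2 := h2 (n*t^2) (t^2) hx hv
    have a3 : (1:ℝ) ≤ (t^2)^6 * (1+n*t^2)^6 := one_le_mul_of_one_le_of_one_le (one_le_pow₀ hv) (one_le_pow₀ (by linarith))
    set q := (t^2)^6 * (1+n*t^2)^6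
    have hp : 0 ≤ exp (-(n*t^2)/2) * t := by positivity
    calc _ ≤ |Dn n t| + |exp (-(n*t^2)/2) * t * PP (n*t^2) (t^2)| := abs_sub _ _
      _ ≤ exp (-(n*t^2)/2) * t * 1 + exp (-(n*t^2)/2) * t * (C2 * q) := by
        rw [abs_mul, abs_of_nonneg hp, mul_one]; gcongr
      _ ≤ exp (-(n*t^2)/2) * t * q + exp (-(n*t^2)/2) * t * (C2 * q) := by gcongr
      _ ≤ (C1 + C2 + 1) * (exp (-(n*t^2)/2) * t * q) := by
        have : 0 ≤ C1 * (exp (-(n*t^2)/2) * t * q) := by positivity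
        linarith
      _ = _ := by ring

theorem gauss_poly_bound : ∃ C > 0, ∀ z : ℝ, 0 ≤ z → exp (-z^2/2) * z^15 * (1+z^2)^6 ≤ C := by
  refine ⟨exp (1/2) * (Nat.factorial 14 * 2^14), by positivity, fun z hz => ?_⟩
  have h1 := exp_neg_le_fact 14 ((1+z^2)/2) (by positivity)
  have h2 : exp (-z^2/2) = exp (1/2) * exp (-((1+z^2)/2)) := by rw [← exp_add]; ring_nf
  have h3 : z^15 ≤ (1+z^2)^8 := by
    have : z ≤ 1+z^2 := by nlinarith [sq_nonneg (z-1)]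
    have e : z^15 = (z^2)^7 * z := by ring
    rw [e, show (1+z^2)^8 = (1+z^2)^7 * (1+z^2) by ring]
    gcongr; linarith
  rw [h2]
  calc _ ≤ exp (1/2) * (Nat.factorial 14 / ((1+z^2)/2)^14) * (1+z^2)^8 * (1+z^2)^6 := by gcongr
    _ = _ := by field_simp

theorem expand_final : ∃ C > 0, ∀ (n : ℕ) (t : ℝ), 1 ≤ n → 0 < t →
    |Dn n t - exp (-(n*t^2)/2) * t * PP (n*t^2) (t^2)| ≤ C / (√n^13 * (n * t^2)) := by
  obtain ⟨C1, hC1, h1⟩ := expand_all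
  obtain ⟨C2, hC2, h2⟩ := gauss_poly_bound
  refine ⟨C1 * C2, by positivity, fun n t hn ht => ?_⟩
  have hn' : (0:ℝ) < n := by exact_mod_cast hn
  refine (h1 n t ht.le).trans ?_
  have h3 := h2 (√n * t) (by positivity)
  rw [le_div_iff₀ (by positivity)]
  have e : (√n * t)^2 = n * t^2 := by rw [mul_pow, sq_sqrt hn'.le]
  rw [e, neg_div] at h3
  rw [neg_div]
  rw [mul_assoc]
  gcongr
  refine le_trans (le_of_eq ?_) h3
  have e2 : (n:ℝ) * t^2 = (√n*t)^2 := e.symm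
  nth_rewrite 3 [e2]
  ring


theorem HasSum_of_eq {f g : ℕ → ℝ} {a : ℝ} (h : HasSum f a) (e : ∀ j, f j = g j) : HasSum g a := by
  rwa [← (funext e : f = g)]

noncomputable def cf (i o : ℕ) : ℝ := (-1)^i / (i.factorial : ℝ) * tr i o

theorem PP_eq (x v : ℝ) : PP x v = ∑ i ∈ Finset.range 6, ∑ o ∈ Finset.range 6, cf i o * (x^i * v^o) := by
  unfold PP trp cf
  refine Finset.sum_congr rfl fun i _ => ?_
  rw [Finset.mul_sum]
  refine Finset.sum_congr rfl fun o _ => ?_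
  ring

theorem alp_pos (H j : ℕ) (hH : 0 < H) : 0 < alp H j := by
  have : (0:ℝ) < H := by exact_mod_cast hH
  unfold alp; positivity

theorem hasSum_theta (n H k : ℕ) (hn : 1 ≤ n) (hH : 0 < H) :
    HasSum (fun j : ℕ => (-1)^j * (alp H j^(2*k+1) * exp (-(n * alp H j^2)/2))) (Xi k (H/√n) / √n^(2*k+1)) := by
  have hn' : (0:ℝ) < n := by exact_mod_cast hn
  have hH' : (0:ℝ) < H := by exact_mod_cast hH
  have h := ((summable_thTerm k (π^2/(8*(H/√n)^2)) (by positivity)).hasSum.mul_left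
    ((π/(2*(H/√n)))^(2*k+1))).div_const (√n^(2*k+1))
  refine HasSum_of_eq h fun j => ?_
  unfold thTerm alp
  have e1 : -(2*(j:ℝ)+1)^2 * (π^2/(8*((H:ℝ)/√n)^2)) = -(n*(π*(2*j+1)/(2*H))^2)/2 := by
    rw [div_pow (H:ℝ), sq_sqrt hn'.le]; field_simp; norm_num
  have e2 : π*(2*(j:ℝ)+1)/(2*H) = π/(2*(H/√n)) * (2*j+1) / √n := by field_simp
  rw [e1]
  generalize exp _ = E
  rw [e2, div_pow _ (√n), mul_pow]
  ring

theorem inner_approx : ∃ C > 0, ∀ n H : ℕ, 1 ≤ n → 0 < H →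
    |∑' j : ℕ, (-1)^j * Dn n (alp H j) - (1/√n) * ∑ i ∈ Finset.range 6, ∑ o ∈ Finset.range 6,
      cf i o / n^o * Xi (i+o) (H/√n)| ≤ C * H^2 / √n^15 := by
  obtain ⟨C, hC, h⟩ := expand_final
  have hS : 0 ≤ ∑' j : ℕ, 1 / ((j:ℝ)+1)^2 := tsum_nonneg fun _ => by positivity
  refine ⟨C * (∑' j : ℕ, 1 / ((j:ℝ)+1)^2) + 1, by positivity, fun n H hn hH => ?_⟩
  have hn' : (0:ℝ) < n := by exact_mod_cast hn
  have hH' : (0:ℝ) < H := by exact_mod_cast hH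
  have hs2 : √(n:ℝ)^2 = n := sq_sqrt hn'.le
  have hs0 : 0 < √(n:ℝ) := by positivity
  have hM : HasSum (fun j : ℕ => (-1)^j * (exp (-(n*alp H j^2)/2) * alp H j * PP (n*alp H j^2) (alp H j^2)))
      ((1/√n) * ∑ i ∈ Finset.range 6, ∑ o ∈ Finset.range 6, cf i o / n^o * Xi (i+o) (H/√n)) := by
    have h1 : HasSum (fun j : ℕ => ∑ i ∈ Finset.range 6, ∑ o ∈ Finset.range 6,
        cf i o * n^i * ((-1)^j * (alp H j^(2*(i+o)+1) * exp (-(n * alp H j^2)/2))))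
        (∑ i ∈ Finset.range 6, ∑ o ∈ Finset.range 6, cf i o * n^i * (Xi (i+o) (H/√n) / √n^(2*(i+o)+1))) :=
      hasSum_sum fun i _ => hasSum_sum fun o _ => (hasSum_theta n H (i+o) hn hH).mul_left _
    have e : ∑ i ∈ Finset.range 6, ∑ o ∈ Finset.range 6, cf i o * n^i * (Xi (i+o) (H/√n) / √n^(2*(i+o)+1)) =
        (1/√n) * ∑ i ∈ Finset.range 6, ∑ o ∈ Finset.range 6, cf i o / n^o * Xi (i+o) (H/√n) := by
      rw [Finset.mul_sum]
      refine Finset.sum_congr rfl fun i _ => ?_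
      rw [Finset.mul_sum]
      refine Finset.sum_congr rfl fun o _ => ?_
      rw [pow_succ, pow_mul, hs2, pow_add]
      field_simp
    rw [e] at h1
    refine HasSum_of_eq h1 fun j => ?_
    rw [PP_eq, Finset.mul_sum, Finset.mul_sum]
    refine Finset.sum_congr rfl fun i _ => ?_
    rw [Finset.mul_sum, Finset.mul_sum]
    refine Finset.sum_congr rfl fun o _ => ?_
    rw [mul_pow, pow_succ, pow_mul, pow_add]
    ring
  have hb : ∀ j : ℕ, ‖(-1)^j * Dn n (alp H j) -
      (-1)^j * (exp (-(n*alp H j^2)/2) * alp H j * PP (n*alp H j^2) (alp H j^2))‖ ≤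
      C * H^2 / √n^15 * (1/((j:ℝ)+1)^2) := by
    intro j
    rw [← mul_sub, norm_mul, norm_pow, norm_neg, norm_one, one_pow, one_mul, norm_eq_abs]
    refine (h n (alp H j) hn (alp_pos H j hH)).trans ?_
    have h1 : ((j:ℝ)+1)^2 / H^2 ≤ alp H j^2 := by
      unfold alp
      rw [← div_pow]
      gcongr ?_^2
      rw [div_le_div_iff₀ hH' (by positivity)]
      have := pi_gt_three
      have hj : (0:ℝ) ≤ j := Nat.cast_nonneg j
      have : ((j:ℝ)+1) * 2 ≤ π * (2*j+1) := by nlinarith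
      nlinarith
    calc C / (√n^13 * (n * alp H j^2)) ≤ C / (√n^13 * (n * (((j:ℝ)+1)^2 / H^2))) := by gcongr
      _ = C * H^2 / (√n^13 * √n^2) * (1/((j:ℝ)+1)^2) := by rw [hs2]; field_simp
      _ = _ := by rw [← pow_add]
  have hsumm : Summable (fun j : ℕ => (-1)^j * Dn n (alp H j)) := by
    have := (Summable.of_norm_bounded (summable_inv_sq.mul_left (C * H^2 / √n^15)) hb).add hM.summable
    simpa using this
  rw [← hM.tsum_eq, ← hsumm.tsum_sub hM.summable, ← norm_eq_abs]
  refine (tsum_of_norm_bounded (summable_inv_sq.hasSum.mul_left (C * H^2 / √n^15)) hb).trans ?_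
  rw [div_mul_eq_mul_div]
  refine div_le_div_of_nonneg_right ?_ (by positivity)
  have : (0:ℝ) < H^2 := by positivity
  nlinarith

noncomputable def Usum (n s : ℕ) : ℝ := ∑ h ∈ Finset.range (n+1), ((h:ℝ)+1)^s * (V n h : ℝ)

noncomputable def un (n s : ℕ) : ℝ := √n * (Usum n s / 2^n) / (2 * √n^s)

theorem un_approx (s : ℕ) (hs : s ≤ 2) : ∃ C > 0, ∀ n : ℕ, 1 ≤ n →
    |un n s - ∑ i ∈ Finset.range 6, ∑ o ∈ Finset.range 6, cf i o / n^o * Aint (i+o) s| ≤ C / n^4 := by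
  obtain ⟨C, hC, h⟩ := inner_approx
  choose D hD hd using fun k => sum_omgPh k s 4
  have hS0 : 0 ≤ ∑ i ∈ Finset.range 6, ∑ o ∈ Finset.range 6, |cf i o| * D (i+o) :=
    Finset.sum_nonneg fun i _ => Finset.sum_nonneg fun o _ => mul_nonneg (abs_nonneg _) (hD _).le
  refine ⟨4 * 2^(s+1) * C + ∑ i ∈ Finset.range 6, ∑ o ∈ Finset.range 6, |cf i o| * D (i+o), by positivity, fun n hn => ?_⟩
  have hn1 : (1:ℝ) ≤ n := by exact_mod_cast hn
  have hn' : (0:ℝ) < n := by linarith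
  have hs2 : √(n:ℝ)^2 = n := sq_sqrt hn'.le
  have hs0 : 0 < √(n:ℝ) := by positivity
  have hs1 : 1 ≤ √(n:ℝ) := by rw [one_le_sqrt]; exact hn1
  set I : ℕ → ℝ := fun H => ∑' j : ℕ, (-1)^j * Dn n (alp H j) with hI
  set M : ℕ → ℝ := fun H => (1/√n) * ∑ i ∈ Finset.range 6, ∑ o ∈ Finset.range 6,
      cf i o / n^o * Xi (i+o) (H/√n) with hM
  have e1 : un n s = ∑ h ∈ Finset.range (n+1), omg n (h+1) * (√n/√n^s * ((h:ℝ)+1)^s / ((h:ℝ)+1) * I (h+1)) := by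
    unfold un Usum
    rw [Finset.sum_div, Finset.mul_sum, Finset.sum_div]
    refine Finset.sum_congr rfl fun h _ => ?_
    rw [V_half n h hn]
    have : omg n (h+1) = 1 + (-1)^(h+n) := by
      unfold omg; rw [show h+1+n+1 = (h+n)+2 by ring, pow_add]; norm_num
    rw [this, hI]
    push_cast
    field_simp
  have e2 : ∑ h ∈ Finset.range (n+1), omg n (h+1) * (√n/√n^s * ((h:ℝ)+1)^s / ((h:ℝ)+1) * M (h+1)) =
      ∑ i ∈ Finset.range 6, ∑ o ∈ Finset.range 6, cf i o / n^o * ((1/√n) * ∑ H ∈ Finset.range (n+2), omg n H * Ph (i+o) s (H/√n)) := by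
    have h1 : ∀ i o : ℕ, cf i o / n^o * ((1/√n) * ∑ H ∈ Finset.range (n+2), omg n H * Ph (i+o) s (H/√n)) =
      ∑ h ∈ Finset.range (n+1), omg n (h+1) * (√n/√n^s * ((h:ℝ)+1)^s / ((h:ℝ)+1) * ((1/√n) * (cf i o / n^o * Xi (i+o) ((h+1:ℕ)/√n)))) := by
      intro i o
      rw [Finset.sum_range_succ']
      rw [Ph_nonpos _ _ _ (by simp), mul_zero, add_zero, Finset.mul_sum, Finset.mul_sum]
      refine Finset.sum_congr rfl fun h _ => ?_
      have hp : (0:ℝ) < ((h+1:ℕ):ℝ)/√n := by positivity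
      unfold Ph
      rw [if_pos hp, zpow_sub_one₀ hp.ne', zpow_natCast, div_pow]
      push_cast
      field_simp
    simp only [h1]
    rw [Finset.sum_congr rfl fun i _ => Finset.sum_comm, Finset.sum_comm]
    refine Finset.sum_congr rfl fun h _ => ?_
    rw [hM]
    simp only [Finset.mul_sum]
  have b1 : |un n s - ∑ h ∈ Finset.range (n+1), omg n (h+1) * (√n/√n^s * ((h:ℝ)+1)^s / ((h:ℝ)+1) * M (h+1))| ≤
      4 * 2^(s+1) * C / n^4 := by
    rw [e1, ← Finset.sum_sub_distrib]
    refine (Finset.abs_sum_le_sum_abs _ _).trans ?_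
    have hterm : ∀ h ∈ Finset.range (n+1), |omg n (h+1) * (√n/√n^s * ((h:ℝ)+1)^s / ((h:ℝ)+1) * I (h+1)) -
        omg n (h+1) * (√n/√n^s * ((h:ℝ)+1)^s / ((h:ℝ)+1) * M (h+1))| ≤ 2 * 2^(s+1) * C / n^5 := by
      intro j hj
      have hj' : (j:ℝ)+1 ≤ 2*n := by
        have : j < n+1 := by simpa using hj
        have : (j:ℝ) ≤ n := by exact_mod_cast Nat.lt_succ_iff.mp this
        linarith
      rw [← mul_sub, ← mul_sub, abs_mul, abs_mul, abs_of_nonneg (by positivity : 0 ≤ √n/√n^s * ((j:ℝ)+1)^s / ((j:ℝ)+1))]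
      have := h n (j+1) hn (by omega)
      push_cast at this
      calc _ ≤ 2 * (√n/√n^s * ((j:ℝ)+1)^s / ((j:ℝ)+1) * (C * ((j:ℝ)+1)^2 / √n^15)) := by
            gcongr
            · exact abs_omg_le _ _
            · rw [hI, hM]; push_cast; exact this
        _ = 2 * C * ((j:ℝ)+1)^(s+1) / (√n^s * (√n^2)^7) := by
            rw [← pow_mul]; field_simp; ring
        _ ≤ 2 * C * (2*n)^(s+1) / (√n^s * (√n^2)^7) := by gcongr
        _ = 2 * 2^(s+1) * C * (√n^s) * n / n^7 := by
            have hns : (n:ℝ)^s = √n^s*√n^s := by rw [← mul_pow, ← sq, hs2]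
            rw [hs2, mul_pow, pow_succ (n:ℝ) s, hns]
            field_simp
        _ ≤ 2 * 2^(s+1) * C * (√n^2) * n / n^7 := by gcongr
        _ = _ := by rw [hs2]; field_simp
    refine (Finset.sum_le_sum hterm).trans ?_
    rw [Finset.sum_const, Finset.card_range, nsmul_eq_mul]
    push_cast
    calc ((n:ℝ)+1) * (2 * 2^(s+1) * C / n^5) ≤ (2 * n) * (2 * 2^(s+1) * C / n^5) := by gcongr; linarith
      _ = _ := by field_simp; norm_num
  have b2 : |∑ h ∈ Finset.range (n+1), omg n (h+1) * (√n/√n^s * ((h:ℝ)+1)^s / ((h:ℝ)+1) * M (h+1)) -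
      ∑ i ∈ Finset.range 6, ∑ o ∈ Finset.range 6, cf i o / n^o * Aint (i+o) s| ≤
      (∑ i ∈ Finset.range 6, ∑ o ∈ Finset.range 6, |cf i o| * D (i+o)) / n^4 := by
    rw [e2, ← Finset.sum_sub_distrib, Finset.sum_div]
    refine (Finset.abs_sum_le_sum_abs _ _).trans (Finset.sum_le_sum fun i _ => ?_)
    rw [← Finset.sum_sub_distrib, Finset.sum_div]
    refine (Finset.abs_sum_le_sum_abs _ _).trans (Finset.sum_le_sum fun o _ => ?_)
    rw [← mul_sub, abs_mul, abs_div, abs_of_pos (by positivity : (0:ℝ) < (n:ℝ)^o)]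
    have h1 := hd (i+o) n hn
    have e3 : (1/√n) * ∑ H ∈ Finset.range (n+2), omg n H * Ph (i+o) s (H/√n) - Aint (i+o) s =
      (1/√n) * (∑ H ∈ Finset.range (n+2), omg n H * Ph (i+o) s (H/√n) - √n * Aint (i+o) s) := by
      field_simp
    rw [e3, abs_mul, abs_of_pos (by positivity : 0 < 1/√(n:ℝ))]
    calc _ ≤ |cf i o| / 1 * (1 / 1 * (D (i+o) / n^4)) := by
          gcongr
          exact one_le_pow₀ hn1
      _ = _ := by ring
  calc _ ≤ _ := abs_sub_le _ _ _
    _ ≤ _ := add_le_add b1 b2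
    _ = _ := by ring


noncomputable def e0 (x : ℝ) : ℝ := (1)*x^0 + (-5/12)*x^1 + (127/480)*x^2 + (-1571/8064)*x^3 + (43661/276480)*x^4 + (-539063/4055040)*x^5

noncomputable def e2 (x : ℝ) : ℝ := (1)*x^0 + (1/4)*x^1 + (-17/480)*x^2 + (569/40320)*x^3 + (-543/71680)*x^4 + (41027/12165120)*x^5

noncomputable def rho1 (x : ℝ) : ℝ := (1)*x^0 + (2/3)*x^1 + (-1/45)*x^2 + (22/945)*x^3

noncomputable def rho2 (x : ℝ) : ℝ := (1)*x^0 + (5/6)*x^1 + (-1/120)*x^2 + (53/3024)*x^3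

noncomputable def rem1 (x : ℝ) : ℝ := (-284/14175)*x^0 + (13514/467775)*x^1 + (5553184157/67060224000)*x^2 + (-30234273143/804722688000)*x^3 + (468710428721/19313344512000)*x^4 + (-8635728066709/540773646336000)*x^5 + (597387780826687/40789783609344000)*x^6 + (-1013976672335567/69925343330304000)*x^7 + (1824938720597/1331911301529600)*x^8 + (-41512702567/100902371328000)*x^9

noncomputable def rem2 (x : ℝ) : ℝ := (-35003/1814400)*x^0 + (157699/5987520)*x^1 + (107348571361/536481792000)*x^2 + (-48596113331/643778150400)*x^3 + (27113277033067/618027024384000)*x^4 + (-58683989623927/2163094585344000)*x^5 + (6613478227144549/326318268874752000)*x^6 + (-4593125861723099/279701373321216000)*x^7 + (47050201590503/53276452061184000)*x^8 + (-2200173236051/7103526941491200)*x^9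

theorem rem1_eq (x : ℝ) : e2 x * e0 x - e0 x ^ 2 * rho1 x = x^4 * rem1 x := by
  unfold e2 e0 rho1 rem1; ring

theorem rem2_eq (x : ℝ) : 1 - e0 x ^ 2 * rho2 x = x^4 * rem2 x := by
  unfold e0 rho2 rem2; ring

theorem main_zero (x : ℝ) : ∑ i ∈ Finset.range 6, ∑ o ∈ Finset.range 6, cf i o * x^o * Aint (i+o) 0 = Aint 0 0 * e0 x := by
  simp only [Finset.sum_range_succ, Finset.sum_range_zero, cf, tr, Nat.reduceAdd, Nat.factorial, e0]
  have h := fun k => Aint_succ k 0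
  rw [h 9, h 8, h 7, h 6, h 5, h 4, h 3, h 2, h 1, h 0]
  push_cast
  ring

theorem main_one (x : ℝ) : ∑ i ∈ Finset.range 6, ∑ o ∈ Finset.range 6, cf i o * x^o * Aint (i+o) 1 = Aint 0 1 := by
  simp only [Finset.sum_range_succ, Finset.sum_range_zero, cf, tr, Nat.reduceAdd, Nat.factorial]
  have h := fun k => Aint_succ k 1
  rw [h 9, h 8, h 7, h 6, h 5, h 4, h 3, h 2, h 1, h 0]
  push_cast
  ring

theorem main_two (x : ℝ) : ∑ i ∈ Finset.range 6, ∑ o ∈ Finset.range 6, cf i o * x^o * Aint (i+o) 2 = Aint 0 2 * e2 x := by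
  simp only [Finset.sum_range_succ, Finset.sum_range_zero, cf, tr, Nat.reduceAdd, Nat.factorial, e2]
  have h := fun k => Aint_succ k 2
  rw [h 9, h 8, h 7, h 6, h 5, h 4, h 3, h 2, h 1, h 0]
  push_cast
  ring

theorem div_form (n : ℕ) (σ : ℤ) : ∑ i ∈ Finset.range 6, ∑ o ∈ Finset.range 6, cf i o / (n:ℝ)^o * Aint (i+o) σ =
    ∑ i ∈ Finset.range 6, ∑ o ∈ Finset.range 6, cf i o * ((n:ℝ)⁻¹)^o * Aint (i+o) σ := by
  simp only [div_eq_mul_inv, inv_pow]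

/-- Normalised errors. -/
noncomputable def dl (n s : ℕ) : ℝ :=
  (un n s - ∑ i ∈ Finset.range 6, ∑ o ∈ Finset.range 6, cf i o / n^o * Aint (i+o) s) * n^4

theorem un_eq (n s : ℕ) (hn : 1 ≤ n) : un n s =
    ∑ i ∈ Finset.range 6, ∑ o ∈ Finset.range 6, cf i o / n^o * Aint (i+o) s + ((n:ℝ)⁻¹)^4 * dl n s := by
  have hn' : (0:ℝ) < n := by exact_mod_cast hn
  unfold dl
  field_simp
  ring

theorem dl_bound (s : ℕ) (hs : s ≤ 2) : ∃ C > 0, ∀ n : ℕ, 1 ≤ n → |dl n s| ≤ C := by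
  obtain ⟨C, hC, h⟩ := un_approx s hs
  refine ⟨C, hC, fun n hn => ?_⟩
  have hn' : (0:ℝ) < (n:ℝ)^4 := by have : (0:ℝ) < n := by exact_mod_cast hn
                                   positivity
  unfold dl
  rw [abs_mul, abs_of_pos hn', ← le_div_iff₀ hn']
  exact h n hn

theorem un0 (n : ℕ) (hn : 1 ≤ n) : un n 0 = Aint 0 0 * e0 ((n:ℝ)⁻¹) + ((n:ℝ)⁻¹)^4 * dl n 0 := by
  have h := un_eq n 0 hn
  rw [div_form n] at h
  rw [h, Nat.cast_zero, main_zero]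

theorem un1 (n : ℕ) (hn : 1 ≤ n) : un n 1 = Aint 0 1 + ((n:ℝ)⁻¹)^4 * dl n 1 := by
  have h := un_eq n 1 hn
  rw [div_form n] at h
  rw [h, Nat.cast_one, main_one]

theorem un2 (n : ℕ) (hn : 1 ≤ n) : un n 2 = Aint 0 2 * e2 ((n:ℝ)⁻¹) + ((n:ℝ)⁻¹)^4 * dl n 2 := by
  have h := un_eq n 2 hn
  rw [div_form n] at h
  rw [h, Nat.cast_ofNat, main_two]

theorem tsum_moment (n r : ℕ) : ∑' h : ℕ, (h : ℝ) ^ r * (V n h : ℝ) = ∑ h ∈ Finset.range (n+1), (h:ℝ)^r * (V n h : ℝ) := by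
  refine tsum_eq_sum fun h hh => ?_
  rw [V_large n h (by simpa using hh)]
  simp

theorem heightVar_eq (n : ℕ) (hn : 1 ≤ n) (h0 : un n 0 ≠ 0) :
    heightVar n = n * (un n 2 * un n 0 - un n 1 ^ 2) / un n 0 ^ 2 := by
  have hn' : (0:ℝ) < n := by exact_mod_cast hn
  have hs2 : √(n:ℝ)^2 = n := sq_sqrt hn'.le
  have hs0 : 0 < √(n:ℝ) := by positivity
  have t0 := tsum_moment n 0
  have t1 := tsum_moment n 1
  have t2 := tsum_moment n 2
  simp only [pow_zero, one_mul] at t0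
  unfold heightVar heightMoment
  rw [t0, t1, t2]
  set S0 := ∑ h ∈ Finset.range (n+1), (V n h : ℝ) with hS0
  set S1 := ∑ h ∈ Finset.range (n+1), (h:ℝ)^1 * (V n h : ℝ) with hS1
  set S2 := ∑ h ∈ Finset.range (n+1), (h:ℝ)^2 * (V n h : ℝ) with hS2
  have U0 : Usum n 0 = S0 := by simp [Usum, hS0]
  have U1 : Usum n 1 = S1 + S0 := by
    rw [Usum, hS1, hS0, ← Finset.sum_add_distrib]
    exact Finset.sum_congr rfl fun h _ => by ring
  have U2 : Usum n 2 = S2 + 2 * S1 + S0 := by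
    rw [Usum, hS1, hS0, hS2, Finset.mul_sum, ← Finset.sum_add_distrib, ← Finset.sum_add_distrib]
    exact Finset.sum_congr rfl fun h _ => by ring
  have hS : S0 ≠ 0 := by
    intro h
    apply h0
    unfold un
    rw [U0, h]; simp
  unfold un
  rw [U0, U1, U2]
  generalize √(n:ℝ) = q at *
  rw [← hs2]
  field_simp
  ring

theorem e0_lower (x : ℝ) (h0 : 0 ≤ x) (h1 : x ≤ 1) : 1/4 ≤ e0 x := by
  unfold e0
  have a2 : 0 ≤ x^2 := by positivity
  have a4 : 0 ≤ x^4 := by positivity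
  have b3 : x^3 ≤ 1 := pow_le_one₀ h0 h1
  have b5 : x^5 ≤ 1 := pow_le_one₀ h0 h1
  linarith

/-- Normalised numerator. -/
noncomputable def FF (x d0 d1 d2 : ℝ) : ℝ :=
  Aint 0 0 ^ 2 * (π^2/4) * rem1 x - Aint 0 1 ^ 2 * rem2 x + Aint 0 2 * e2 x * d0 + Aint 0 0 * e0 x * d2 + x^4 * d0 * d2
   - 2 * Aint 0 1 * d1 - x^4 * d1^2 - (2 * Aint 0 0 * e0 x * d0 + x^4 * d0^2) * (π^2/4 * rho1 x - 8*catalanG^2/π * rho2 x)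

theorem FF_bound (D : ℝ) : ∃ B > 0, ∀ x d0 d1 d2 : ℝ, 0 ≤ x → x ≤ 1 → |d0| ≤ D → |d1| ≤ D → |d2| ≤ D → |FF x d0 d1 d2| ≤ B := by
  have hc : Continuous (fun p : ℝ × ℝ × ℝ × ℝ => FF p.1 p.2.1 p.2.2.1 p.2.2.2) := by
    unfold FF rem1 rem2 e0 e2 rho1 rho2
    fun_prop
  have hK : IsCompact (Set.Icc (0:ℝ) 1 ×ˢ Set.Icc (-D) D ×ˢ Set.Icc (-D) D ×ˢ Set.Icc (-D) D) :=
    isCompact_Icc.prod (isCompact_Icc.prod (isCompact_Icc.prod isCompact_Icc))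
  obtain ⟨B, hB⟩ := hK.exists_bound_of_continuousOn hc.continuousOn
  refine ⟨|B| + 1, by positivity, fun x d0 d1 d2 h0 h1 a b c => ?_⟩
  have := hB (x, d0, d1, d2) ⟨⟨h0, h1⟩, abs_le.mp a, abs_le.mp b, abs_le.mp c⟩
  rw [norm_eq_abs] at this
  simp only at this
  linarith [le_abs_self B]

theorem A_rel2 : Aint 0 2 = Aint 0 0 * (π^2/4) := by
  rw [Aint_zero_two, Aint_zero_zero]; ring

theorem A_rel1 : Aint 0 1 ^ 2 = Aint 0 0 ^ 2 * (8*catalanG^2/π) := by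
  rw [Aint_zero_one, Aint_zero_zero, mul_pow, mul_pow, sq_sqrt (by positivity)]
  have := pi_pos
  field_simp
  ring

theorem num_eq (n : ℕ) (hn : 1 ≤ n) :
    un n 2 * un n 0 - un n 1 ^ 2 - un n 0 ^ 2 * (π^2/4 * rho1 ((n:ℝ)⁻¹) - 8*catalanG^2/π * rho2 ((n:ℝ)⁻¹)) =
    ((n:ℝ)⁻¹)^4 * FF ((n:ℝ)⁻¹) (dl n 0) (dl n 1) (dl n 2) := by
  rw [un0 n hn, un1 n hn, un2 n hn]
  generalize (n:ℝ)⁻¹ = x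
  generalize dl n 0 = d0
  generalize dl n 1 = d1
  generalize dl n 2 = d2
  unfold FF
  have h1 := rem1_eq x
  have h2 := rem2_eq x
  have h3 := A_rel1
  have h4 := A_rel2
  rw [h4]
  generalize 8*catalanG^2/π = g at *
  generalize Aint 0 0 = a0 at *
  generalize Aint 0 1 = a1 at *
  linear_combination a0^2*(π^2/4) * h1 - a1^2*h2 - e0 x^2*rho2 x * h3

/-- Asymptotic expansion of the variance of the height of admissible walks on `ℕ₀`:
`V H_n = ((π³−32G²)/(4π)) n + (π³−40G²)/(6π) − (π³−12G²)/(180πn) + (11π³−265G²)/(1890πn²)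
 + O(n^{−3})`. -/
theorem heightVar_asymptotics :
    ∃ C > (0 : ℝ), ∃ N₀ : ℕ, ∀ n : ℕ, N₀ ≤ n →
      |heightVar n -
          ((π ^ 3 - 32 * catalanG ^ 2) / (4 * π) * n +
            (π ^ 3 - 40 * catalanG ^ 2) / (6 * π) -
            (π ^ 3 - 12 * catalanG ^ 2) / (180 * π * n) +
            (11 * π ^ 3 - 265 * catalanG ^ 2) / (1890 * π * (n : ℝ) ^ 2))| ≤
        C / (n : ℝ) ^ 3 := by
  obtain ⟨C0, hC0, hd0⟩ := dl_bound 0 (by norm_num)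
  obtain ⟨C1, hC1, hd1⟩ := dl_bound 1 (by norm_num)
  obtain ⟨C2, hC2, hd2⟩ := dl_bound 2 (by norm_num)
  obtain ⟨B, hB, hF⟩ := FF_bound (C0 + C1 + C2)
  have hA : 0 < Aint 0 0 := by
    rw [Aint_zero_zero]; have := cXi_pos; positivity
  obtain ⟨N, hN⟩ := exists_nat_gt (8 * C0 / Aint 0 0)
  refine ⟨B / (Aint 0 0 / 8)^2, by positivity, N + 1, fun n hn => ?_⟩
  have hn1 : 1 ≤ n := by omega
  have hn1' : (1:ℝ) ≤ n := by exact_mod_cast hn1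
  have hn' : (0:ℝ) < n := by linarith
  have hNn : 8 * C0 / Aint 0 0 < n := hN.trans (by exact_mod_cast (by omega : N < n))
  have hx0 : 0 ≤ (n:ℝ)⁻¹ := by positivity
  have hx1 : (n:ℝ)⁻¹ ≤ 1 := inv_le_one_of_one_le₀ hn1'
  have hu : Aint 0 0 / 8 ≤ un n 0 := by
    rw [un0 n hn1]
    have h1 := e0_lower _ hx0 hx1
    have h2 : |((n:ℝ)⁻¹)^4 * dl n 0| ≤ Aint 0 0 / 8 := by
      rw [abs_mul, abs_of_nonneg (by positivity : 0 ≤ ((n:ℝ)⁻¹)^4)]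
      calc ((n:ℝ)⁻¹)^4 * |dl n 0| ≤ (n:ℝ)⁻¹ * C0 := by
            gcongr
            · exact pow_le_of_le_one hx0 hx1 (by norm_num)
            · exact hd0 n hn1
        _ ≤ _ := by
            rw [div_lt_iff₀ hA] at hNn
            rw [inv_mul_le_iff₀ hn']
            linarith
    have h3 := neg_abs_le (((n:ℝ)⁻¹)^4 * dl n 0)
    nlinarith
  have hu0 : 0 < un n 0 := by linarith [div_pos hA (by norm_num : (0:ℝ) < 8)]
  have hst : (π ^ 3 - 32 * catalanG ^ 2) / (4 * π) * n +
            (π ^ 3 - 40 * catalanG ^ 2) / (6 * π) -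
            (π ^ 3 - 12 * catalanG ^ 2) / (180 * π * n) +
            (11 * π ^ 3 - 265 * catalanG ^ 2) / (1890 * π * (n : ℝ) ^ 2) =
      n * (π^2/4 * rho1 ((n:ℝ)⁻¹) - 8*catalanG^2/π * rho2 ((n:ℝ)⁻¹)) := by
    have := pi_pos
    unfold rho1 rho2
    field_simp
    ring
  have key := num_eq n hn1
  rw [hst, heightVar_eq n hn1 hu0.ne']
  have e : n * (un n 2 * un n 0 - un n 1 ^ 2) / un n 0 ^ 2 -
      n * (π^2/4 * rho1 ((n:ℝ)⁻¹) - 8*catalanG^2/π * rho2 ((n:ℝ)⁻¹)) =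
      FF ((n:ℝ)⁻¹) (dl n 0) (dl n 1) (dl n 2) / un n 0 ^ 2 / n^3 := by
    have e' : n * (un n 2 * un n 0 - un n 1 ^ 2) / un n 0 ^ 2 -
      n * (π^2/4 * rho1 ((n:ℝ)⁻¹) - 8*catalanG^2/π * rho2 ((n:ℝ)⁻¹)) =
      n * (un n 2 * un n 0 - un n 1 ^ 2 - un n 0 ^ 2 * (π^2/4 * rho1 ((n:ℝ)⁻¹) - 8*catalanG^2/π * rho2 ((n:ℝ)⁻¹))) / un n 0 ^ 2 := by
      generalize π^2/4 * rho1 ((n:ℝ)⁻¹) - 8*catalanG^2/π * rho2 ((n:ℝ)⁻¹) = R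
      field_simp
    rw [e', key]
    field_simp
  rw [e, abs_div, abs_div, abs_of_pos (by positivity : 0 < un n 0 ^ 2), abs_of_pos (by positivity : (0:ℝ) < (n:ℝ)^3)]
  gcongr
  apply hF _ _ _ _ hx0 hx1
  · linarith [hd0 n hn1]
  · linarith [hd1 n hn1]
  · linarith [hd2 n hn1]
end

section
/- Let H_n be the height of a random admissible walk of length n on ℕ₀. For every fixed integer r ≥ 1, the r-th moment satisfies E H_n^r ∼ (2^{r/2+2}/π) Γ(r/2 + 1) β(r+1) n^{r/2} as n → ∞, i.e. the ratio of the two sides tends to 1, where β(s) = Σ_{k≥0} (−1)^k (2k+1)^{−s} is the Dirichlet beta function and E H_n^r = (Σ_{h≥0} h^r V(n,h))/(Σ_{h≥0} V(n,h)). -/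
open Real Filter

/-- The Dirichlet beta function `β(s) = Σ_{k≥0} (−1)^k (2k+1)^{−s}`. -/
noncomputable def dirichletBeta (s : ℝ) : ℝ := ∑' k : ℕ, (-1 : ℝ) ^ k / (2 * (k : ℝ) + 1) ^ s


/-- Law of the simple random walk on `ℤ` at time `n`. -/
noncomputable def bb : ℕ → ℤ → ℝ
  | 0, x => if x = 0 then 1 else 0
  | n + 1, x => (bb n (x - 1) + bb n (x + 1)) / 2

lemma bb_zero (x : ℤ) : bb 0 x = if x = 0 then 1 else 0 := rfl
lemma bb_succ (n : ℕ) (x : ℤ) : bb (n + 1) x = (bb n (x - 1) + bb n (x + 1)) / 2 := rfl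

lemma bb_nonneg (n : ℕ) : ∀ x, 0 ≤ bb n x := by
  induction n with
  | zero => intro x; rw [bb_zero]; split_ifs <;> norm_num
  | succ n ih => intro x; rw [bb_succ]; linarith [ih (x - 1), ih (x + 1)]

lemma bb_neg (n : ℕ) : ∀ x, bb n (-x) = bb n x := by
  induction n with
  | zero => intro x; simp [bb_zero]
  | succ n ih =>
    intro x
    rw [bb_succ, bb_succ, show -x - 1 = -(x + 1) by ring, show -x + 1 = -(x - 1) by ring, ih, ih,
      add_comm]

lemma bb_of_lt (n : ℕ) : ∀ x : ℤ, (n : ℤ) < |x| → bb n x = 0 := by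
  induction n with
  | zero =>
    intro x hx
    rw [bb_zero, if_neg]
    rintro rfl
    simp at hx
  | succ n ih =>
    intro x hx
    push_cast at hx
    rw [bb_succ, ih, ih]
    · simp
    · grind
    · grind

lemma bb_parity (n : ℕ) : ∀ x : ℤ, ¬ (2 : ℤ) ∣ (n + x) → bb n x = 0 := by
  induction n with
  | zero =>
    intro x hx
    rw [bb_zero, if_neg]
    rintro rfl
    simp at hx
  | succ n ih =>
    intro x hx
    push_cast at hx
    rw [bb_succ, ih, ih]
    · simp
    · omega
    · omega

lemma bb_ratio (n : ℕ) : ∀ y : ℤ,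
    ((n : ℝ) + 1 - y) * bb n (y - 1) = ((n : ℝ) + 1 + y) * bb n (y + 1) := by
  induction n with
  | zero =>
    intro y
    rw [bb_zero, bb_zero]
    by_cases h1 : y = 1
    · subst h1; norm_num
    · by_cases h2 : y = -1
      · subst h2; norm_num
      · rw [if_neg (by omega), if_neg (by omega)]; simp
  | succ n ih =>
    intro y
    have h1 := ih (y - 1)
    have h2 := ih (y + 1)
    rw [bb_succ, bb_succ]
    push_cast at *
    rw [show y - 1 + 1 = y by ring] at *
    rw [show y + 1 - 1 = y by ring] at *
    linarith

lemma bb_succ_mul (n : ℕ) (y : ℤ) :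
    ((n : ℝ) + 1) * (bb n (y - 1) - bb n (y + 1)) = 2 * y * bb (n + 1) y := by
  have := bb_ratio n y
  rw [bb_succ]
  linarith

lemma bb_diff (n : ℕ) (y : ℤ) :
    bb n (y - 1) - bb n (y + 1) = 2 * y / ((n : ℝ) + 1) * bb (n + 1) y := by
  have := bb_succ_mul n y
  have h : ((n : ℝ) + 1) ≠ 0 := by positivity
  field_simp
  linarith

/-- Walk killed outside `[-h, h]`. -/
noncomputable def wr (h : ℕ) : ℕ → ℤ → ℝ
  | 0, x => if x = 0 then 1 else 0
  | n + 1, x => if |x| ≤ h then (wr h n (x - 1) + wr h n (x + 1)) / 2 else 0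

lemma wr_zero (h : ℕ) (x : ℤ) : wr h 0 x = if x = 0 then 1 else 0 := rfl
lemma wr_succ (h n : ℕ) (x : ℤ) : wr h (n + 1) x =
  if |x| ≤ h then (wr h n (x - 1) + wr h n (x + 1)) / 2 else 0 := rfl

lemma wr_neg (h n : ℕ) : ∀ x, wr h n (-x) = wr h n x := by
  induction n with
  | zero => intro x; simp [wr_zero]
  | succ n ih =>
    intro x
    rw [wr_succ, wr_succ, show -x - 1 = -(x + 1) by ring, show -x + 1 = -(x - 1) by ring, ih, ih,
      add_comm, abs_neg]

lemma wr_nonneg (h n : ℕ) : ∀ x, 0 ≤ wr h n x := by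
  induction n with
  | zero => intro x; rw [wr_zero]; split_ifs <;> norm_num
  | succ n ih => intro x; rw [wr_succ]; split_ifs <;> linarith [ih (x - 1), ih (x + 1)]

/-- Walk killed above `h`. -/
noncomputable def ur (h : ℕ) : ℕ → ℤ → ℝ
  | 0, x => if x = 0 then 1 else 0
  | n + 1, x => if x ≤ h then (ur h n (x - 1) + ur h n (x + 1)) / 2 else 0

lemma ur_zero (h : ℕ) (x : ℤ) : ur h 0 x = if x = 0 then 1 else 0 := rfl
lemma ur_succ (h n : ℕ) (x : ℤ) : ur h (n + 1) x =
  if x ≤ h then (ur h n (x - 1) + ur h n (x + 1)) / 2 else 0 := rfl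

lemma ur_nonneg (h n : ℕ) : ∀ x, 0 ≤ ur h n x := by
  induction n with
  | zero => intro x; rw [ur_zero]; split_ifs <;> norm_num
  | succ n ih => intro x; rw [ur_succ]; split_ifs <;> linarith [ih (x - 1), ih (x + 1)]

lemma wr_le_ur (h n : ℕ) : ∀ x, wr h n x ≤ ur h n x := by
  induction n with
  | zero => intro x; rw [ur_zero, wr_zero]
  | succ n ih =>
    intro x
    by_cases hx : |x| ≤ h
    · rw [ur_succ, wr_succ, if_pos hx, if_pos (le_of_abs_le hx)]
      linarith [ih (x - 1), ih (x + 1)]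
    · rw [wr_succ, if_neg hx]
      exact ur_nonneg _ _ _

lemma ur_eq (h n : ℕ) : ∀ x : ℤ, x ≤ h + 1 → ur h n x = bb n x - bb n (2 * (h + 1) - x) := by
  induction n with
  | zero =>
    intro x hx
    rw [ur_zero, bb_zero, bb_zero]
    rw [if_neg (show ¬ (2 * ((h : ℤ) + 1) - x = 0) by omega), sub_zero]
  | succ n ih =>
    intro x hx
    by_cases hx' : x ≤ h
    · rw [ur_succ, if_pos hx', ih _ (by omega), ih _ (by omega), bb_succ, bb_succ]
      rw [show 2 * ((h : ℤ) + 1) - (x - 1) = 2 * ((h : ℤ) + 1) - x + 1 by ring,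
        show 2 * ((h : ℤ) + 1) - (x + 1) = 2 * ((h : ℤ) + 1) - x - 1 by ring]
      ring
    · have : x = h + 1 := by omega
      subst this
      rw [ur_succ, if_neg hx', show 2 * ((h : ℤ) + 1) - (h + 1) = h + 1 by ring, sub_self]

lemma wr_le (h n : ℕ) : wr h n h ≤ 2 * ((h : ℝ) + 1) / ((n : ℝ) + 1) * bb (n + 1) (h + 1) := by
  refine (wr_le_ur h n h).trans (le_of_eq ?_)
  rw [ur_eq h n h (by omega)]
  have := bb_diff n (h + 1)
  push_cast at this
  rw [← this]
  congr 2 <;> ring_nf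

/-- Image sum. -/
noncomputable def zz (h n : ℕ) (x : ℤ) : ℝ := ∑' k : ℤ, (-1 : ℝ) ^ k * bb n (x + 2 * k * (h + 1))

lemma zz_summable (h n : ℕ) (x : ℤ) :
    Summable (fun k : ℤ => (-1 : ℝ) ^ k * bb n (x + 2 * k * (h + 1))) := by
  apply summable_of_ne_finset_zero (s := Finset.Icc (-(n + |x|)) (n + |x|))
  intro k hk
  rw [bb_of_lt, mul_zero]
  rw [Finset.mem_Icc, ← abs_le, not_le] at hk
  have h1 : |2 * k * ((h : ℤ) + 1)| = 2 * |k| * (h + 1) := by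
    rw [abs_mul, abs_mul, abs_of_nonneg (show (0 : ℤ) ≤ h + 1 by positivity)]; simp
  have h2 : |2 * k * ((h : ℤ) + 1)| ≤ |x + 2 * k * (h + 1)| + |x| := by
    have := abs_sub (x + 2 * k * (h + 1)) x
    simpa using this
  have h3 : |k| ≤ 2 * |k| * (h + 1) := by nlinarith [abs_nonneg k]
  have := abs_nonneg x
  linarith

lemma zz_succ (h n : ℕ) (x : ℤ) : zz h (n + 1) x = (zz h n (x - 1) + zz h n (x + 1)) / 2 := by
  unfold zz
  rw [← (zz_summable h n (x - 1)).tsum_add (zz_summable h n (x + 1)), ← tsum_div_const]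
  congr 1
  ext k
  rw [bb_succ, show x - 1 + 2 * k * ((h : ℤ) + 1) = x + 2 * k * (h + 1) - 1 by ring,
    show x + 1 + 2 * k * ((h : ℤ) + 1) = x + 2 * k * (h + 1) + 1 by ring]
  ring

lemma zz_neg (h n : ℕ) (x : ℤ) : zz h n (-x) = zz h n x := by
  unfold zz
  rw [← (Equiv.neg ℤ).tsum_eq]
  congr 1
  ext k
  simp only [Equiv.neg_apply]
  rw [show -x + 2 * -k * ((h : ℤ) + 1) = -(x + 2 * k * (h + 1)) by ring, bb_neg]
  congr 1
  rw [zpow_neg, ← inv_zpow]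
  norm_num

lemma zz_bdry (h n : ℕ) : zz h n (h + 1) = 0 := by
  have : zz h n (h + 1) = - zz h n (h + 1) := by
    unfold zz
    rw [← tsum_neg]
    conv_lhs => rw [← (Equiv.subLeft (-1 : ℤ)).tsum_eq]
    congr 1
    ext k
    simp only [Equiv.subLeft_apply]
    rw [show (h : ℤ) + 1 + 2 * (-1 - k) * (h + 1) = -((h : ℤ) + 1 + 2 * k * (h + 1)) by ring,
      bb_neg, ← neg_mul]
    congr 1
    rw [zpow_sub₀ (by norm_num)]
    rcases Int.even_or_odd k with hk | hk
    · rw [hk.neg_one_zpow]; norm_num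
    · rw [hk.neg_one_zpow]; norm_num
  linarith

lemma wr_eq_zz (h n : ℕ) : ∀ x : ℤ, |x| ≤ h + 1 → wr h n x = zz h n x := by
  have key : ∀ x : ℤ, |x| = h + 1 → wr h n x = zz h n x := by
    have key2 : wr h n (h + 1) = zz h n (h + 1) := by
      rw [zz_bdry]
      cases n with
      | zero => rw [wr_zero, if_neg (by omega)]
      | succ n => rw [wr_succ, if_neg]; rw [abs_of_nonneg (by positivity)]; omega
    intro x hx
    rcases (abs_eq (by positivity)).1 hx with hx | hx
    · rw [hx, key2]
    · rw [hx, wr_neg, zz_neg, key2]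
  induction n with
  | zero =>
    intro x hx
    rcases hx.eq_or_lt with hx | hx
    · exact key x hx
    · unfold zz
      rw [tsum_eq_single 0, wr_zero, bb_zero]
      · simp
      · intro k hk
        rw [bb_zero, if_neg, mul_zero]
        intro h0
        have h1 : |2 * k * ((h : ℤ) + 1)| = 2 * |k| * (h + 1) := by
          rw [abs_mul, abs_mul, abs_of_nonneg (show (0 : ℤ) ≤ h + 1 by positivity)]; simp
        have h2 : x = - (2 * k * ((h : ℤ) + 1)) := by linarith
        rw [h2, abs_neg, h1] at hx
        have := Int.one_le_abs hk
        nlinarith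
  | succ n ih =>
    intro x hx
    rcases hx.eq_or_lt with hx | hx
    · exact key x hx
    · have hx' : |x| ≤ h := by omega
      have key' : ∀ x : ℤ, |x| ≤ h + 1 → wr h n x = zz h n x := by
        apply ih
        intro x hx
        have key2 : wr h n (h + 1) = zz h n (h + 1) := by
          rw [zz_bdry]
          cases n with
          | zero => rw [wr_zero, if_neg (by omega)]
          | succ n => rw [wr_succ, if_neg]; rw [abs_of_nonneg (by positivity)]; omega
        rcases (abs_eq (by positivity)).1 hx with hx | hx
        · rw [hx, key2]
        · rw [hx, wr_neg, zz_neg, key2]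
      rw [wr_succ, if_pos hx', zz_succ, key', key']
      · grind
      · grind

lemma wr_eq (h n : ℕ) : wr h n h = ∑' k : ℕ, (-1 : ℝ) ^ k *
    (2 * ((2 * k + 1) * (h + 1)) / ((n : ℝ) + 1) * bb (n + 1) ((2 * k + 1) * (h + 1))) := by
  rw [wr_eq_zz h n h (by rw [abs_of_nonneg] <;> omega)]
  have hs := zz_summable h n h
  have hn : Summable (fun k : ℕ => (-1 : ℝ) ^ (k : ℤ) * bb n (h + 2 * (k : ℤ) * (h + 1))) :=
    hs.comp_injective (i := fun k : ℕ => (k : ℤ)) Nat.cast_injective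
  have hn' : Summable (fun k : ℕ => (-1 : ℝ) ^ (-((k : ℤ) + 1)) *
      bb n (h + 2 * (-((k : ℤ) + 1)) * (h + 1))) :=
    hs.comp_injective (i := fun k : ℕ => (-((k : ℤ) + 1))) (by intro a b; simp)
  have e1 : zz h n h = ∑' k : ℕ, ((-1 : ℝ) ^ (k : ℤ) * bb n (h + 2 * (k : ℤ) * (h + 1)) +
      (-1 : ℝ) ^ (-((k : ℤ) + 1)) * bb n (h + 2 * (-((k : ℤ) + 1)) * (h + 1))) := by
    rw [hn.tsum_add hn']
    exact tsum_of_nat_of_neg_add_one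
      (f := fun k : ℤ => (-1 : ℝ) ^ k * bb n (h + 2 * k * (h + 1))) hn hn'
  rw [e1]
  congr 1
  ext k
  have := bb_diff n ((2 * k + 1) * (h + 1))
  push_cast at this
  rw [← this]
  rw [zpow_natCast]
  rw [← bb_neg n (h + 2 * -((k : ℤ) + 1) * (h + 1))]
  rw [show (-(h + 2 * -((k : ℤ) + 1) * (h + 1)) : ℤ) = (2 * k + 1) * (h + 1) + 1 by ring,
    show ((h : ℤ) + 2 * k * (h + 1)) = (2 * k + 1) * (h + 1) - 1 by ring]
  have : (-1 : ℝ) ^ (-((k : ℤ) + 1)) = - (-1) ^ k := by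
    rw [zpow_neg, ← inv_zpow, show ((k : ℤ) + 1) = ((k + 1 : ℕ) : ℤ) by push_cast; rfl, zpow_natCast]
    rw [pow_succ]; norm_num
  rw [this]
  ring

lemma wr_parity (h n : ℕ) : ∀ x : ℤ, ¬ (2 : ℤ) ∣ (n + x) → wr h n x = 0 := by
  induction n with
  | zero =>
    intro x hx
    rw [wr_zero, if_neg]
    rintro rfl
    simp at hx
  | succ n ih =>
    intro x hx
    push_cast at hx
    rw [wr_succ, ih, ih]
    · simp
    · omega
    · omega

lemma wr_of_lt (h n : ℕ) (hn : n < h) : wr h n h = 0 := by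
  apply le_antisymm _ (wr_nonneg _ _ _)
  refine (wr_le h n).trans ?_
  rw [bb_of_lt, mul_zero]
  rw [abs_of_nonneg (by positivity)]
  push_cast
  omega

lemma walkSum_snoc_le (n : ℕ) (ε : Fin n → Bool) (b : Bool) (k : ℕ) (hk : k ≤ n) :
    walkSum (n + 1) (Fin.snoc ε b) k = walkSum n ε k := by
  unfold walkSum
  rw [Fin.sum_univ_castSucc]
  simp [not_lt.2 hk]

lemma walkSum_snoc (n : ℕ) (ε : Fin n → Bool) (b : Bool) :
    walkSum (n + 1) (Fin.snoc ε b) (n + 1) = walkSum n ε n + if b then 1 else -1 := by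
  unfold walkSum
  rw [Fin.sum_univ_castSucc]
  simp only [Fin.snoc_castSucc, Fin.val_castSucc, Fin.snoc_last, Fin.val_last, lt_add_iff_pos_right,
    zero_lt_one, if_true]
  congr 1
  apply Finset.sum_congr rfl
  intro i _
  have := i.isLt
  rw [if_pos (show (i : ℕ) < n + 1 by omega), if_pos this]

open Classical in
/-- indicator of confined paths ending at `x` -/
noncomputable def ind (h n : ℕ) (x : ℤ) (ε : Fin n → Bool) : ℝ :=
  if (∀ k ≤ n, |walkSum n ε k| ≤ (h : ℤ)) ∧ walkSum n ε n = x then 1 else 0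

lemma ind_snoc (h n : ℕ) (x : ℤ) (ε : Fin n → Bool) (b : Bool) :
    ind h (n + 1) x (Fin.snoc ε b) =
      if |x| ≤ h then ind h n (x - if b then 1 else -1) ε else 0 := by
  unfold ind
  have h1 : (∀ k ≤ n + 1, |walkSum (n + 1) (Fin.snoc ε b) k| ≤ (h : ℤ)) ↔
    (∀ k ≤ n, |walkSum n ε k| ≤ (h : ℤ)) ∧ |walkSum n ε n + if b then 1 else -1| ≤ (h : ℤ) := by
    constructor
    · intro H
      refine ⟨fun k hk => ?_, ?_⟩
      · rw [← walkSum_snoc_le n ε b k hk]; exact H k (by omega)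
      · rw [← walkSum_snoc]; exact H _ le_rfl
    · rintro ⟨H1, H2⟩ k hk
      rcases hk.eq_or_lt with hk | hk
      · rw [hk, walkSum_snoc]; exact H2
      · rw [walkSum_snoc_le n ε b k (by omega)]; exact H1 k (by omega)
  simp only [h1, walkSum_snoc]
  by_cases hx : |x| ≤ h
  · rw [if_pos hx]
    apply if_congr _ rfl rfl
    constructor
    · rintro ⟨⟨a, _⟩, c⟩; exact ⟨a, by omega⟩
    · rintro ⟨a, c⟩
      have : (walkSum n ε n + if b then 1 else -1) = x := by omega
      exact ⟨⟨a, by rw [this]; exact hx⟩, this⟩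
  · rw [if_neg hx, if_neg]
    rintro ⟨⟨_, a⟩, c⟩
    rw [c] at a
    exact hx a

lemma sum_ind (h n : ℕ) : ∀ x, ∑ ε, ind h n x ε = 2 ^ n * wr h n x := by
  induction n with
  | zero =>
    intro x
    have : ∀ ε : Fin 0 → Bool, ind h 0 x ε = if x = 0 then 1 else 0 := by
      intro ε
      unfold ind
      simp [walkSum, eq_comm (a := x)]
    simp [this, wr_zero]
  | succ n ih =>
    intro x
    rw [← (Fin.snocEquiv (fun _ => Bool)).sum_comp, Fintype.sum_prod_type]
    have : ∀ (b : Bool) (ε : Fin n → Bool),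
      (Fin.snocEquiv (fun _ : Fin (n + 1) => Bool)) (b, ε) = (Fin.snoc ε b : Fin (n + 1) → Bool) :=
      fun b ε => rfl
    simp only [this, ind_snoc]
    rw [wr_succ]
    by_cases hx : |x| ≤ h
    · simp only [if_pos hx, ih]
      simp only [Fintype.sum_bool]
      simp
      ring
    · simp [if_neg hx]

lemma V_eq (n h : ℕ) (hn : 1 ≤ n) : (V n h : ℝ) = 2 ^ n * (2 * wr h n h) := by
  classical
  have hV : (V n h : ℝ) = ∑ ε : Fin n → Bool, if (∀ k ≤ n, |walkSum n ε k| ≤ (h : ℤ)) ∧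
      |walkSum n ε n| = (h : ℤ) then (1 : ℝ) else 0 := by
    unfold V
    rw [Nat.card_eq_fintype_card, Fintype.card_subtype, Finset.sum_boole]
  rcases Nat.eq_zero_or_pos h with rfl | hpos
  · have h0 : wr 0 n (0 : ℕ) = 0 := by
      obtain ⟨n, rfl⟩ := Nat.exists_eq_succ_of_ne_zero (by omega : n ≠ 0)
      have hz : ∀ x : ℤ, |x| = 1 → wr 0 n x = 0 := by
        intro x hx
        cases n with
        | zero => rw [wr_zero, if_neg]; rintro rfl; simp at hx
        | succ n => rw [wr_succ, if_neg]; rw [hx]; simp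
      rw [Nat.succ_eq_add_one, wr_succ, hz _ (by simp), hz _ (by simp)]; simp
    rw [h0, hV]
    have := sum_ind 0 n 0
    simp only [ind] at this
    simp only [Nat.cast_zero] at *
    simp only [abs_eq_zero] at *
    rw [this, h0]; simp
  · rw [hV]
    have h1 := sum_ind h n h
    have h2 := sum_ind h n (-h)
    rw [wr_neg] at h2
    rw [two_mul, mul_add]
    nth_rw 1 [← h1]
    rw [← h2, ← Finset.sum_add_distrib]
    apply Finset.sum_congr rfl
    intro ε _
    unfold ind
    by_cases hA : ∀ k ≤ n, |walkSum n ε k| ≤ (h : ℤ)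
    · have hpos' : (0 : ℤ) < h := by exact_mod_cast hpos
      by_cases c1 : walkSum n ε n = h
      · rw [if_pos ⟨hA, by rw [c1]; simp⟩, if_pos ⟨hA, c1⟩, if_neg (by rintro ⟨-, c⟩; omega),
          add_zero]
      · by_cases c2 : walkSum n ε n = -h
        · rw [if_pos ⟨hA, by rw [c2]; simp⟩, if_neg (by rintro ⟨-, c⟩; omega), if_pos ⟨hA, c2⟩,
            zero_add]
        · rw [if_neg, if_neg (by rintro ⟨-, c⟩; omega), if_neg (by rintro ⟨-, c⟩; omega), add_zero]
          rintro ⟨-, c⟩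
          rcases (abs_eq hpos'.le).1 c with c | c <;> omega
    · rw [if_neg (by tauto), if_neg (by tauto), if_neg (by tauto), add_zero]

open MeasureTheory in
lemma bb_eq_integral (m : ℕ) : ∀ y : ℤ, (2 : ℤ) ∣ m + y →
    bb m y = 1 / π * ∫ θ in (-(π / 2))..(π / 2), cos θ ^ m * cos (y * θ) := by
  induction m with
  | zero =>
    intro y hy
    obtain ⟨j, hj⟩ := hy
    have hj : y = 2 * j := by simpa using hj
    rw [bb_zero]
    by_cases h0 : y = 0
    · subst h0
      simp
    · rw [if_neg h0]
      have h0' : (y : ℝ) ≠ 0 := by exact_mod_cast h0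
      simp only [pow_zero, one_mul]
      rw [intervalIntegral.integral_comp_mul_left (fun t => cos t) h0', integral_cos]
      have : (y : ℝ) * (π / 2) = j * π := by rw [hj]; push_cast; ring
      rw [mul_neg, Real.sin_neg, this, Real.sin_int_mul_pi]
      simp
  | succ m ih =>
    intro y hy
    push_cast at hy
    rw [bb_succ, ih _ (by omega), ih _ (by omega), ← mul_add, ← intervalIntegral.integral_add,
      mul_div_assoc, ← intervalIntegral.integral_div]
    · congr 2
      ext θ
      push_cast
      rw [sub_mul, add_mul, Real.cos_sub, Real.cos_add]
      ring_nf
    · apply Continuous.intervalIntegrable; fun_prop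
    · apply Continuous.intervalIntegrable; fun_prop

/-- integrand on the whole line -/
noncomputable def gg (m : ℕ) (y : ℤ) : ℝ → ℝ :=
  Set.indicator (Set.Ioc (-(π / 2)) (π / 2)) (fun θ => cos θ ^ m * cos (y * θ))

lemma gg_le (m : ℕ) (y : ℤ) (θ : ℝ) : ‖gg m y θ‖ ≤ exp (-(2 / π ^ 2 * m) * θ ^ 2) := by
  unfold gg
  by_cases h : θ ∈ Set.Ioc (-(π / 2)) (π / 2)
  · rw [Set.indicator_of_mem h, norm_mul, norm_pow, Real.norm_eq_abs, Real.norm_eq_abs]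
    have h0 : 0 ≤ cos θ := Real.cos_nonneg_of_neg_pi_div_two_le_of_le h.1.le h.2
    have h1 : cos θ ≤ exp (-(2 / π ^ 2 * θ ^ 2)) := by
      have := Real.cos_le_one_sub_mul_cos_sq (x := θ)
        (abs_le.2 ⟨by linarith [h.1, Real.pi_pos], by linarith [h.2, Real.pi_pos]⟩)
      refine this.trans ?_
      have := Real.add_one_le_exp (-(2 / π ^ 2 * θ ^ 2))
      linarith
    rw [abs_of_nonneg h0]
    calc cos θ ^ m * |cos (y * θ)| ≤ cos θ ^ m * 1 := by gcongr; exact Real.abs_cos_le_one _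
      _ ≤ (exp (-(2 / π ^ 2 * θ ^ 2))) ^ m := by rw [mul_one]; gcongr
      _ = _ := by rw [← Real.exp_nat_mul]; congr 1; ring
  · rw [Set.indicator_of_notMem h, norm_zero]; positivity

lemma bb_eq_gg (m : ℕ) (y : ℤ) (h : (2 : ℤ) ∣ m + y) : bb m y = 1 / π * ∫ θ, gg m y θ := by
  rw [bb_eq_integral m y h, intervalIntegral.integral_of_le (by linarith [Real.pi_pos])]
  unfold gg
  rw [MeasureTheory.integral_indicator measurableSet_Ioc]

lemma bb_le (m : ℕ) (hm : 1 ≤ m) (y : ℤ) : bb m y ≤ 2 / √m := by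
  by_cases h : (2 : ℤ) ∣ m + y
  · rw [bb_eq_gg m y h]
    have hm' : (0 : ℝ) < m := by exact_mod_cast hm
    have hp := Real.pi_pos
    have hc : 0 < 2 / π ^ 2 * (m : ℝ) := by positivity
    have h1 : ∫ θ, gg m y θ ≤ √(π / (2 / π ^ 2 * m)) := by
      rw [← integral_gaussian]
      refine (le_abs_self _).trans ?_
      rw [← Real.norm_eq_abs]
      apply MeasureTheory.norm_integral_le_of_norm_le (integrable_exp_neg_mul_sq hc)
      exact Filter.Eventually.of_forall (gg_le m y)
    calc 1 / π * ∫ θ, gg m y θ ≤ 1 / π * √(π / (2 / π ^ 2 * m)) := by gcongr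
      _ ≤ 2 / √m := by
        rw [show π / (2 / π ^ 2 * m) = π ^ 2 * (π / 2) / m by field_simp,
          Real.sqrt_div (by positivity), Real.sqrt_mul (by positivity), Real.sqrt_sq hp.le]
        have : √(π / 2) ≤ 2 := by
          rw [Real.sqrt_le_left (by norm_num)]; linarith [Real.pi_le_four]
        rw [show 1 / π * (π * √(π / 2) / √m) = √(π / 2) / √m by field_simp]
        gcongr
  · rw [bb_parity m y h]; positivity

lemma integral_gauss_cos (x : ℝ) :
    ∫ s : ℝ, exp (-(s ^ 2 / 2)) * cos (x * s) = √(2 * π) * exp (-(x ^ 2 / 2)) := by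
  have h := fourierIntegral_gaussian (b := 1 / 2) (by norm_num) (x : ℂ)
  have hi : MeasureTheory.Integrable
      (fun s : ℝ => Complex.exp (Complex.I * x * s) * Complex.exp (-(1 / 2) * s ^ 2)) := by
    have := integrable_cexp_quadratic (b := 1 / 2) (by norm_num) (Complex.I * x) 0
    refine this.congr (Filter.Eventually.of_forall fun s => ?_)
    simp only
    rw [← Complex.exp_add]; congr 1; ring
  have h2 := Complex.reCLM.integral_comp_comm hi
  rw [h] at h2
  have e1 : ∀ s : ℝ, Complex.reCLM (Complex.exp (Complex.I * x * s) *
      Complex.exp (-(1 / 2) * s ^ 2)) = exp (-(s ^ 2 / 2)) * cos (x * s) := by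
    intro s
    rw [show (-(1 / 2) * (s : ℂ) ^ 2) = ((-(s ^ 2 / 2) : ℝ) : ℂ) by push_cast; ring,
      ← Complex.ofReal_exp, show Complex.I * x * s = ((x * s : ℝ) : ℂ) * Complex.I by push_cast; ring,
      Complex.exp_mul_I, ← Complex.ofReal_cos, ← Complex.ofReal_sin]
    rw [Complex.reCLM_apply, Complex.re_mul_ofReal, Complex.add_re, Complex.ofReal_re,
      Complex.re_ofReal_mul, Complex.I_re]
    ring
  simp only [e1] at h2
  rw [h2]
  have e2 : ((π : ℂ) / (1 / 2)) ^ (1 / 2 : ℂ) = ((√(2 * π) : ℝ) : ℂ) := by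
    rw [Real.sqrt_eq_rpow, Complex.ofReal_cpow (by positivity)]
    push_cast
    congr 1
    ring
  rw [e2, show (-(x : ℂ) ^ 2 / (4 * (1 / 2))) = ((-(x ^ 2 / 2) : ℝ) : ℂ) by push_cast; ring,
    ← Complex.ofReal_exp, ← Complex.ofReal_mul]
  rfl

lemma cos_pow_tendsto (s : ℝ) :
    Tendsto (fun m : ℕ => cos (s / √m) ^ m) atTop (nhds (exp (-(s ^ 2 / 2)))) := by
  have h : Tendsto (fun m : ℕ => (m : ℝ) * (cos (s / √m) - 1)) atTop (nhds (-(s ^ 2 / 2))) := by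
    have h0 : Tendsto (fun m : ℕ => √(m : ℝ)) atTop atTop :=
      Real.tendsto_sqrt_atTop.comp tendsto_natCast_atTop_atTop
    have h1 : Tendsto (fun m : ℕ => s ^ 4 / (m : ℝ)) atTop (nhds 0) :=
      tendsto_const_div_atTop_nhds_zero_nat _
    rw [tendsto_iff_dist_tendsto_zero]
    refine squeeze_zero' (Eventually.of_forall fun _ => dist_nonneg) ?_ h1
    filter_upwards [h0.eventually_ge_atTop |s|, eventually_ge_atTop 1] with m hm hm1
    have hm' : (0 : ℝ) < m := by exact_mod_cast hm1
    have hsq : √(m : ℝ) ^ 2 = m := Real.sq_sqrt hm'.le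
    have hs : |s / √m| ≤ 1 := by
      rw [abs_div, abs_of_nonneg (Real.sqrt_nonneg _)]
      apply div_le_one_of_le₀ hm (Real.sqrt_nonneg _)
    have := Real.cos_bound hs
    rw [Real.dist_eq]
    have e1 : (m : ℝ) * (cos (s / √m) - 1) - -(s ^ 2 / 2) =
        m * (cos (s / √m) - (1 - (s / √m) ^ 2 / 2)) := by
      rw [div_pow, hsq]; field_simp; ring
    rw [e1, abs_mul, abs_of_pos hm']
    have e2 : |s / √m| ^ 4 = s ^ 4 / (m : ℝ) ^ 2 := by
      rw [pow_abs, abs_of_nonneg (by positivity), div_pow, show √(m : ℝ) ^ 4 = (√(m : ℝ) ^ 2) ^ 2 by ring, hsq]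
    rw [e2] at this
    calc (m : ℝ) * |cos (s / √m) - (1 - (s / √m) ^ 2 / 2)|
        ≤ m * (s ^ 4 / (m : ℝ) ^ 2 * (5 / 96)) := by gcongr
      _ = s ^ 4 / m * (5 / 96) := by field_simp
      _ ≤ s ^ 4 / m := by
        have : 0 ≤ s ^ 4 / (m : ℝ) := by positivity
        linarith
  have := Real.tendsto_one_add_pow_exp_of_tendsto h
  simpa using this

open MeasureTheory in
lemma bb_llt (y : ℕ → ℤ) (hy : ∀ m : ℕ, (2 : ℤ) ∣ m + y m) (x : ℝ)
    (hx : Tendsto (fun m : ℕ => (y m : ℝ) / √m) atTop (nhds x)) :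
    Tendsto (fun m : ℕ => √m * bb m (y m)) atTop (nhds (√(2 / π) * exp (-(x ^ 2 / 2)))) := by
  have hp := Real.pi_pos
  have key : Tendsto (fun m : ℕ => ∫ s, gg m (y m) (s / √m)) atTop
      (nhds (∫ s : ℝ, exp (-(s ^ 2 / 2)) * cos (x * s))) := by
    apply tendsto_integral_filter_of_dominated_convergence
      (fun s : ℝ => exp (-(2 / π ^ 2) * s ^ 2))
    · refine Eventually.of_forall fun m => ?_
      apply Measurable.aestronglyMeasurable
      unfold gg
      have : Measurable (Set.indicator (Set.Ioc (-(π / 2)) (π / 2))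
        (fun θ => cos θ ^ m * cos (y m * θ))) := by
        apply Measurable.indicator _ measurableSet_Ioc
        fun_prop
      exact this.comp (by fun_prop)
    · filter_upwards [eventually_ge_atTop 1] with m hm
      refine Eventually.of_forall fun s => ?_
      refine (gg_le _ _ _).trans (le_of_eq ?_)
      have hm' : (0 : ℝ) < m := by exact_mod_cast hm
      rw [div_pow, Real.sq_sqrt hm'.le]
      congr 1
      field_simp
    · exact integrable_exp_neg_mul_sq (by positivity)
    · refine Eventually.of_forall fun s => ?_
      have h0 : Tendsto (fun m : ℕ => √(m : ℝ)) atTop atTop :=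
        Real.tendsto_sqrt_atTop.comp tendsto_natCast_atTop_atTop
      have h1 : Tendsto (fun m : ℕ => s / √(m : ℝ)) atTop (nhds 0) :=
        tendsto_const_nhds.div_atTop h0
      have h2 : Tendsto (fun m : ℕ => cos ((y m : ℝ) * (s / √m))) atTop (nhds (cos (x * s))) := by
        apply (Real.continuous_cos.tendsto _).comp
        refine (hx.mul_const s).congr fun m => ?_
        ring
      refine ((cos_pow_tendsto s).mul h2).congr' ?_
      have h3 : Set.Ioc (-(π / 2)) (π / 2) ∈ nhds (0 : ℝ) := Ioc_mem_nhds (by linarith) (by linarith)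
      filter_upwards [h1 h3] with m hm
      unfold gg
      rw [Set.indicator_of_mem (show s / √(m : ℝ) ∈ Set.Ioc (-(π / 2)) (π / 2) from hm)]
  rw [integral_gauss_cos] at key
  have := key.const_mul (1 / π)
  have e : 1 / π * (√(2 * π) * exp (-(x ^ 2 / 2))) = √(2 / π) * exp (-(x ^ 2 / 2)) := by
    rw [← mul_assoc]
    congr 1
    rw [show 2 / π = (2 * π) / π ^ 2 by field_simp, Real.sqrt_div (by positivity), Real.sqrt_sq hp.le]
    ring
  rw [e] at this
  refine this.congr fun m => ?_
  rw [Measure.integral_comp_div, bb_eq_gg m _ (hy m), abs_of_nonneg (Real.sqrt_nonneg _), smul_eq_mul]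
  ring

lemma bb_step (m y : ℕ) : bb m (y + 2) ≤ bb m y * exp (-(((y : ℝ) + 1) / (m + 1))) := by
  by_cases hy : m < y
  · rw [bb_of_lt m (y + 2)]
    · exact mul_nonneg (bb_nonneg _ _) (Real.exp_nonneg _)
    · rw [abs_of_nonneg (by positivity)]; omega
  · push Not at hy
    have hy' : (y : ℝ) ≤ m := by exact_mod_cast hy
    have h := bb_ratio m (y + 1)
    push_cast at h
    rw [show ((y : ℤ) + 1 - 1) = y by ring, show ((y : ℤ) + 1 + 1) = y + 2 by ring] at h
    have h1 : bb m (y + 2) = bb m y * (((m : ℝ) - y) / (m + 2 + y)) := by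
      field_simp
      linarith
    rw [h1]
    apply mul_le_mul_of_nonneg_left _ (bb_nonneg _ _)
    have h2 := Real.add_one_le_exp (-((2 * (y : ℝ) + 2) / (m + 2 + y)))
    have h3 : ((m : ℝ) - y) / (m + 2 + y) = -((2 * (y : ℝ) + 2) / (m + 2 + y)) + 1 := by
      field_simp; ring
    rw [h3]
    refine h2.trans ?_
    apply Real.exp_le_exp.2
    apply neg_le_neg
    rw [div_le_div_iff₀ (by positivity) (by positivity)]
    nlinarith [Nat.cast_nonneg (α := ℝ) y]

lemma bb_gauss (m : ℕ) (hm : 1 ≤ m) (y : ℕ) :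
    bb m y ≤ 6 / √m * exp (-((y : ℝ) ^ 2 / (4 * (m + 1)))) := by
  induction y using Nat.twoStepInduction with
  | zero =>
    have := bb_le m hm 0
    have h0 : 0 ≤ 2 / √(m : ℝ) := by positivity
    have h1 : 6 / √(m : ℝ) = 3 * (2 / √(m : ℝ)) := by ring
    simp only [Nat.cast_zero]
    norm_num
    linarith
  | one =>
    have := bb_le m hm 1
    have h0 : 0 ≤ 2 / √(m : ℝ) := by positivity
    have h1 : 6 / √(m : ℝ) = 3 * (2 / √(m : ℝ)) := by ring
    have h2 : (1 : ℝ) / 3 ≤ exp (-(((1 : ℕ) : ℝ) ^ 2 / (4 * (m + 1)))) := by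
      have := Real.add_one_le_exp (-(((1 : ℕ) : ℝ) ^ 2 / (4 * ((m : ℝ) + 1))))
      refine le_trans ?_ this
      have : ((1 : ℕ) : ℝ) ^ 2 / (4 * ((m : ℝ) + 1)) ≤ 1 / 4 := by
        rw [div_le_div_iff₀ (by positivity) (by positivity)]
        have := Nat.cast_nonneg (α := ℝ) m
        norm_num
      linarith
    rw [h1]
    push_cast at *
    nlinarith
  | more y ih _ =>
    have h := bb_step m y
    push_cast
    refine h.trans ?_
    calc bb m y * exp (-(((y : ℝ) + 1) / (m + 1)))
        ≤ 6 / √m * exp (-((y : ℝ) ^ 2 / (4 * (m + 1)))) * exp (-(((y : ℝ) + 1) / (m + 1))) := by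
          gcongr
      _ = _ := by
        rw [mul_assoc, ← Real.exp_add]
        congr 2
        field_simp
        ring

/-- `K p = ∫ u^p e^{-u²/2}` -/
noncomputable def KK (p : ℕ) : ℝ := ∫ u in Set.Ioi (0 : ℝ), u ^ p * exp (-(u ^ 2 / 2))

lemma gint_integrable (p : ℕ) (q : ℝ) (hq : 0 < q) :
    MeasureTheory.IntegrableOn (fun u : ℝ => u ^ p * exp (-((q * u) ^ 2 / 2))) (Set.Ioi 0) := by
  have h := integrableOn_rpow_mul_exp_neg_mul_sq (b := q ^ 2 / 2) (by positivity) (s := p)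
    (by have := Nat.cast_nonneg (α := ℝ) p; linarith)
  refine h.congr_fun (fun u _ => ?_) measurableSet_Ioi
  simp only [Real.rpow_natCast]
  congr 2
  ring

lemma gint (p : ℕ) (q : ℝ) (hq : 0 < q) :
    ∫ u in Set.Ioi (0 : ℝ), u ^ p * exp (-((q * u) ^ 2 / 2)) = KK p / q ^ (p + 1) := by
  have h := MeasureTheory.integral_comp_mul_left_Ioi (fun u : ℝ => u ^ p * exp (-(u ^ 2 / 2))) 0 hq
  rw [mul_zero] at h
  change _ = q⁻¹ • KK p at h
  have e : ∀ u : ℝ, (q * u) ^ p * exp (-((q * u) ^ 2 / 2)) =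
      q ^ p * (u ^ p * exp (-((q * u) ^ 2 / 2))) := by intro u; rw [mul_pow]; ring
  simp only [e] at h
  rw [MeasureTheory.integral_const_mul] at h
  rw [smul_eq_mul] at h
  rw [eq_div_iff (by positivity), pow_succ q p]
  generalize (∫ u in Set.Ioi (0 : ℝ), u ^ p * exp (-((q * u) ^ 2 / 2))) = I at h ⊢
  field_simp at h
  linarith

lemma KK_eq (r : ℕ) : KK (r + 1) = 2 ^ ((r : ℝ) / 2) * Real.Gamma ((r : ℝ) / 2 + 1) := by
  have h := integral_rpow_mul_exp_neg_mul_rpow (p := 2) (q := (r : ℝ) + 1) (b := 1 / 2)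
    (by norm_num) (by have := Nat.cast_nonneg (α := ℝ) r; linarith) (by norm_num)
  have e : KK (r + 1) = ∫ x in Set.Ioi (0 : ℝ), x ^ ((r : ℝ) + 1) * exp (-(1 / 2) * x ^ (2 : ℝ)) := by
    unfold KK
    apply MeasureTheory.setIntegral_congr_fun measurableSet_Ioi
    intro x hx
    simp only
    rw [show (r : ℝ) + 1 = ((r + 1 : ℕ) : ℝ) by push_cast; ring, Real.rpow_natCast,
      Real.rpow_two]
    congr 2
    ring
  rw [e, h]
  rw [show ((r : ℝ) + 1 + 1) / 2 = (r : ℝ) / 2 + 1 by ring,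
    show -((r : ℝ) + 1 + 1) / 2 = -((r : ℝ) / 2 + 1) by ring]
  rw [one_div, Real.inv_rpow (by norm_num), ← Real.rpow_neg (by norm_num), neg_neg,
    Real.rpow_add (by norm_num), Real.rpow_one]
  ring

lemma KK_nonneg (p : ℕ) : 0 ≤ KK p := by
  unfold KK
  apply MeasureTheory.setIntegral_nonneg measurableSet_Ioi
  intro x hx
  have : (0 : ℝ) < x := hx
  positivity

/-- limiting term -/
noncomputable def tt (q u : ℝ) : ℝ := 4 * (q * u) * (√(2 / π) * exp (-((q * u) ^ 2 / 2)))

/-- pairs -/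
noncomputable def DD (r j : ℕ) : ℝ := 1 / (4 * (j : ℝ) + 1) ^ (r + 1) - 1 / (4 * (j : ℝ) + 3) ^ (r + 1)

lemma tt_integrable (r : ℕ) (q : ℝ) (hq : 0 < q) :
    MeasureTheory.IntegrableOn (fun u : ℝ => u ^ r * tt q u) (Set.Ioi 0) := by
  refine ((gint_integrable (r + 1) q hq).const_mul (4 * q * √(2 / π))).congr ?_
  refine Eventually.of_forall fun u => ?_
  simp only [tt]
  ring

lemma tt_integral (r : ℕ) (q : ℝ) (hq : 0 < q) :
    ∫ u in Set.Ioi (0 : ℝ), u ^ r * tt q u = 4 * √(2 / π) * KK (r + 1) * (1 / q ^ (r + 1)) := by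
  have e : ∀ u, u ^ r * tt q u = (4 * q * √(2 / π)) * (u ^ (r + 1) * exp (-((q * u) ^ 2 / 2))) := by
    intro u; simp only [tt]; ring
  simp only [e]
  rw [MeasureTheory.integral_const_mul, gint (r + 1) q hq]
  field_simp
  ring

lemma tt_diff (q u : ℝ) (hq : 1 ≤ q) (hu : 0 < u) :
    |tt q u - tt (q + 2) u| ≤
      4 * √(2 / π) * ((2 * u + 4 * q ^ 2 * u ^ 3) * exp (-((q * u) ^ 2 / 2))) := by
  set a := exp (-((q * u) ^ 2 / 2)) with ha
  set b := exp (-(((q + 2) * u) ^ 2 / 2)) with hb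
  have h1 : b ≤ a := by
    apply Real.exp_le_exp.2
    have : (q * u) ^ 2 ≤ ((q + 2) * u) ^ 2 := by gcongr; linarith
    linarith
  have hapos : 0 < a := Real.exp_pos _
  have hbpos : 0 < b := Real.exp_pos _
  have h2 : a - b ≤ a * ((2 * q + 2) * u ^ 2) := by
    have h3 : b = a * exp (-((2 * q + 2) * u ^ 2)) := by
      rw [ha, hb, ← Real.exp_add]; congr 1; ring
    have h4 := Real.add_one_le_exp (-((2 * q + 2) * u ^ 2))
    rw [h3]
    nlinarith
  have e : tt q u - tt (q + 2) u = 4 * √(2 / π) * (q * u * (a - b) - 2 * u * b) := by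
    simp only [tt, ← ha, ← hb]; ring
  rw [e, abs_mul, abs_of_nonneg (by positivity)]
  gcongr
  rw [abs_le]
  have h5 : 0 ≤ q * u * (a - b) := by
    apply mul_nonneg (by positivity); linarith
  have h6 : q * u * (a - b) ≤ q * u * (a * ((2 * q + 2) * u ^ 2)) := by gcongr
  have h7 : q * u * (a * ((2 * q + 2) * u ^ 2)) ≤ 4 * q ^ 2 * u ^ 3 * a := by
    have : 0 ≤ a * u ^ 3 := by positivity
    nlinarith [mul_nonneg this (mul_nonneg (by linarith : 0 ≤ q) (by linarith : 0 ≤ q - 1))]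
  have h8 : 2 * u * b ≤ 2 * u * a := by gcongr
  have h9 : 0 ≤ 2 * u * b := by positivity
  have h10 : 0 ≤ 4 * q ^ 2 * u ^ 3 * a := by positivity
  constructor <;> nlinarith

lemma summable_sq_aux : Summable (fun j : ℕ => 1 / (4 * (j : ℝ) + 1) ^ 2) := by
  have h := (summable_nat_add_iff 1).2 (Real.summable_one_div_nat_pow.2 (by norm_num : 1 < 2))
  refine Summable.of_nonneg_of_le (fun j => by positivity) (fun j => ?_) h
  push_cast
  gcongr
  have := Nat.cast_nonneg (α := ℝ) j
  linarith

lemma pair_hasSum (r : ℕ) :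
    HasSum (fun j : ℕ => 4 * √(2 / π) * KK (r + 1) * DD r j)
      (∫ u in Set.Ioi (0 : ℝ), u ^ r * ∑' j : ℕ, (tt (4 * j + 1) u - tt (4 * j + 3) u)) := by
  have hIntg : ∀ j : ℕ, MeasureTheory.Integrable
      (fun u : ℝ => u ^ r * (tt (4 * j + 1) u - tt (4 * j + 3) u))
      (MeasureTheory.volume.restrict (Set.Ioi 0)) := by
    intro j
    have := (tt_integrable r (4 * j + 1) (by positivity)).sub
      (tt_integrable r (4 * j + 3) (by positivity))
    refine this.congr (Eventually.of_forall fun u => ?_)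
    simp only [Pi.sub_apply]
    ring
  have hs : Summable (fun j : ℕ =>
      ∫ u in Set.Ioi (0 : ℝ), ‖u ^ r * (tt (4 * j + 1) u - tt (4 * j + 3) u)‖) := by
    refine Summable.of_nonneg_of_le (fun j => ?_) (fun j => ?_)
      (summable_sq_aux.mul_left (4 * √(2 / π) * (2 * KK (r + 1) + 4 * KK (r + 3))))
    · exact MeasureTheory.integral_nonneg fun u => norm_nonneg _
    · set q : ℝ := 4 * j + 1 with hq
      have hq1 : 1 ≤ q := by rw [hq]; have := Nat.cast_nonneg (α := ℝ) j; linarith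
      have hq0 : 0 < q := by linarith
      have hI1 := (gint_integrable (r + 1) q hq0).const_mul (4 * √(2 / π) * 2)
      have hI2 := (gint_integrable (r + 3) q hq0).const_mul (4 * √(2 / π) * (4 * q ^ 2))
      calc ∫ u in Set.Ioi (0 : ℝ), ‖u ^ r * (tt q u - tt (4 * j + 3) u)‖
          ≤ ∫ u in Set.Ioi (0 : ℝ), (4 * √(2 / π) * 2 * (u ^ (r + 1) * exp (-((q * u) ^ 2 / 2))) +
            4 * √(2 / π) * (4 * q ^ 2) * (u ^ (r + 3) * exp (-((q * u) ^ 2 / 2)))) := by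
            apply MeasureTheory.setIntegral_mono_on (hIntg j).norm (hI1.add hI2) measurableSet_Ioi
            intro u hu
            have hu : 0 < u := hu
            have := tt_diff q u hq1 hu
            rw [show q + 2 = 4 * (j : ℝ) + 3 by rw [hq]; ring] at this
            rw [norm_mul, Real.norm_eq_abs, Real.norm_eq_abs, abs_of_nonneg (by positivity)]
            calc _ ≤ u ^ r * _ := mul_le_mul_of_nonneg_left this (by positivity)
              _ = _ := by simp only [Pi.add_apply]; ring
        _ = 4 * √(2 / π) * 2 * (KK (r + 1) / q ^ (r + 1 + 1)) +
            4 * √(2 / π) * (4 * q ^ 2) * (KK (r + 3) / q ^ (r + 3 + 1)) := by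
            rw [MeasureTheory.integral_add hI1 hI2, MeasureTheory.integral_const_mul,
              MeasureTheory.integral_const_mul, gint _ _ hq0, gint _ _ hq0]
        _ = 4 * √(2 / π) * (2 * KK (r + 1) + 4 * KK (r + 3)) * (1 / q ^ (r + 2)) := by
            field_simp
            ring
        _ ≤ _ := by
            have h1 := KK_nonneg (r + 1)
            have h2 := KK_nonneg (r + 3)
            gcongr
            · omega
  have := MeasureTheory.hasSum_integral_of_summable_integral_norm hIntg hs
  simp only [tsum_mul_left] at this
  have e : ∀ j : ℕ, ∫ u in Set.Ioi (0 : ℝ), u ^ r * (tt (4 * j + 1) u - tt (4 * j + 3) u) =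
      4 * √(2 / π) * KK (r + 1) * DD r j := by
    intro j
    simp only [mul_sub]
    rw [MeasureTheory.integral_sub (tt_integrable r _ (by positivity))
      (tt_integrable r _ (by positivity)), tt_integral r _ (by positivity),
      tt_integral r _ (by positivity), DD]
    ring
  simp only [e] at this
  exact this

lemma DD_nonneg (r j : ℕ) : 0 < DD r j := by
  unfold DD
  rw [sub_pos]
  gcongr
  linarith

lemma DD_zero : HasSum (DD 0) (π / 4) := by
  rw [hasSum_iff_tendsto_nat_of_nonneg (fun j => (DD_nonneg 0 j).le)]
  have h := Real.tendsto_sum_pi_div_four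
  have h2 : Tendsto (fun n : ℕ => 2 * n) atTop atTop :=
    tendsto_id.const_mul_atTop' (by norm_num)
  refine (h.comp h2).congr fun n => ?_
  simp only [Function.comp]
  induction n with
  | zero => simp
  | succ n ih =>
    rw [Finset.sum_range_succ, ← ih, show 2 * (n + 1) = 2 * n + 1 + 1 by ring,
      Finset.sum_range_succ, Finset.sum_range_succ]
    simp only [DD]
    rw [pow_succ, pow_mul]
    push_cast
    norm_num
    ring_nf

lemma DD_beta (r : ℕ) (hr : 1 ≤ r) : Summable (DD r) ∧ ∑' j, DD r j = dirichletBeta ((r : ℝ) + 1) := by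
  have hs : Summable (fun k : ℕ => (-1 : ℝ) ^ k / (2 * (k : ℝ) + 1) ^ ((r : ℝ) + 1)) := by
    have h := (summable_nat_add_iff 1).2 (Real.summable_one_div_nat_pow.2 (by norm_num : 1 < 2))
    refine Summable.of_norm_bounded h (fun k => ?_)
    rw [norm_div, norm_pow, norm_neg, norm_one, one_pow, Real.norm_eq_abs,
      abs_of_nonneg (by positivity), show (r : ℝ) + 1 = ((r + 1 : ℕ) : ℝ) by push_cast; ring,
      Real.rpow_natCast]
    push_cast
    have hk := Nat.cast_nonneg (α := ℝ) k
    apply one_div_le_one_div_of_le (by positivity)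
    calc ((k : ℝ) + 1) ^ 2 ≤ (2 * (k : ℝ) + 1) ^ 2 := by gcongr; linarith
      _ ≤ _ := by
        apply pow_le_pow_right₀ (by linarith); omega
  have he : Summable (fun k : ℕ => (-1 : ℝ) ^ (2 * k) /
      (2 * ((2 * k : ℕ) : ℝ) + 1) ^ ((r : ℝ) + 1)) :=
    hs.comp_injective (i := fun k : ℕ => 2 * k) (by intro a b; simp)
  have ho : Summable (fun k : ℕ => (-1 : ℝ) ^ (2 * k + 1) /
      (2 * ((2 * k + 1 : ℕ) : ℝ) + 1) ^ ((r : ℝ) + 1)) :=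
    hs.comp_injective (i := fun k : ℕ => 2 * k + 1) (by intro a b; simp)
  have e : DD r = fun k : ℕ => (-1 : ℝ) ^ (2 * k) /
      (2 * ((2 * k : ℕ) : ℝ) + 1) ^ ((r : ℝ) + 1) + (-1 : ℝ) ^ (2 * k + 1) /
      (2 * ((2 * k + 1 : ℕ) : ℝ) + 1) ^ ((r : ℝ) + 1) := by
    ext j
    simp only [DD]
    rw [show (r : ℝ) + 1 = ((r + 1 : ℕ) : ℝ) by push_cast; ring,
      Real.rpow_natCast, Real.rpow_natCast, pow_succ (-1 : ℝ), pow_mul]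
    rw [show 2 * ((2 * j : ℕ) : ℝ) + 1 = 4 * j + 1 by push_cast; ring,
      show 2 * ((2 * j + 1 : ℕ) : ℝ) + 1 = 4 * j + 3 by push_cast; ring]
    norm_num
    ring
  rw [e]
  refine ⟨he.add ho, ?_⟩
  rw [he.tsum_add ho]
  exact tsum_even_add_odd (f := fun k : ℕ => (-1 : ℝ) ^ k / (2 * (k : ℝ) + 1) ^ ((r : ℝ) + 1)) he ho

lemma tsum_eq_floor (G : ℕ → ℝ) (K : ℕ) (hG : ∀ j, K ≤ j → G j = 0) :
    ∑' j, G j = ∫ t in Set.Ioi (0 : ℝ), G ⌊t⌋₊ := by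
  have hcongr : ∀ k : ℕ, Set.EqOn (fun t : ℝ => G ⌊t⌋₊) (fun _ => G k) (Set.Ico (k : ℝ) (k + 1)) := by
    intro k t ht
    simp only
    rw [(Nat.floor_eq_iff (by linarith [ht.1, Nat.cast_nonneg (α := ℝ) k])).2 ⟨ht.1, ht.2⟩]
  have hIntg : ∀ k : ℕ, IntervalIntegrable (fun t : ℝ => G ⌊t⌋₊) MeasureTheory.volume (k : ℝ)
      ((k + 1 : ℕ) : ℝ) := by
    intro k
    rw [intervalIntegrable_iff_integrableOn_Ico_of_le (by push_cast; linarith)]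
    push_cast
    refine MeasureTheory.IntegrableOn.congr_fun ?_ (hcongr k).symm measurableSet_Ico
    exact MeasureTheory.integrableOn_const (by simp)
  have hval : ∀ k : ℕ, ∫ t in (k : ℝ)..((k + 1 : ℕ) : ℝ), G ⌊t⌋₊ = G k := by
    intro k
    rw [intervalIntegral.integral_of_le (by push_cast; linarith),
      ← MeasureTheory.integral_Ico_eq_integral_Ioc]
    push_cast
    rw [MeasureTheory.setIntegral_congr_fun measurableSet_Ico (hcongr k)]
    simp
  rw [tsum_eq_sum (s := Finset.range K) (fun j hj => hG j (by simpa using hj))]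
  have h1 := intervalIntegral.sum_integral_adjacent_intervals (f := fun t : ℝ => G ⌊t⌋₊)
    (a := fun k : ℕ => (k : ℝ)) (n := K) (μ := MeasureTheory.volume) (fun k _ => hIntg k)
  simp only [hval] at h1
  rw [h1, intervalIntegral.integral_of_le (by simp)]
  simp only [Nat.cast_zero]
  symm
  apply MeasureTheory.setIntegral_eq_of_subset_of_forall_sdiff_eq_zero measurableSet_Ioi
  · exact Set.Ioc_subset_Ioi_self
  · intro t ht
    apply hG
    apply Nat.le_floor
    by_contra hc
    exact ht.2 ⟨ht.1, by linarith⟩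

/-- lattice point of the right parity -/
noncomputable def hh (m : ℕ) (u : ℝ) : ℕ := 2 * ⌊√m / 2 * u⌋₊ + (m + 1) % 2

/-- rescaled integrand -/
noncomputable def AA (r n : ℕ) (u : ℝ) : ℝ :=
  ((hh (n + 1) u : ℝ) / √(n + 1 : ℕ)) ^ r *
    (((n + 1 : ℕ) : ℝ) * (2 * wr (hh (n + 1) u) n (hh (n + 1) u)))

lemma T_eq (r n : ℕ) : ∑' h : ℕ, (h : ℝ) ^ r * wr h n h =
    √(n + 1 : ℕ) ^ r * (√(n + 1 : ℕ) / (4 * (n + 1 : ℕ)) * ∫ u in Set.Ioi (0 : ℝ), AA r n u) := by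
  set F : ℕ → ℝ := fun h => (h : ℝ) ^ r * wr h n h with hF
  have hF0 : ∀ h, n < h → F h = 0 := by
    intro h hh; simp only [hF]; rw [wr_of_lt h n hh, mul_zero]
  have hFs : ∀ i : ℕ → ℕ, (∀ j, j ≤ i j) → Summable (fun j => F (i j)) := by
    intro i hi
    apply summable_of_ne_finset_zero (s := Finset.range (n + 1))
    intro j hj
    apply hF0
    have := hi j
    simp at hj
    omega
  have hFp : ∀ h, (n + h) % 2 = 1 → F h = 0 := by
    intro h hh; simp only [hF]; rw [wr_parity h n h (by omega), mul_zero]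
  have h1 : ∑' h, F h = ∑' j, F (2 * j + n % 2) := by
    rw [← tsum_even_add_odd (hFs (fun k => 2 * k) (by intro; omega))
      (hFs (fun k => 2 * k + 1) (by intro; omega))]
    rcases Nat.mod_two_eq_zero_or_one n with h0 | h0
    · have : ∀ k, F (2 * k + 1) = 0 := fun k => hFp _ (by omega)
      simp [this, h0]
    · have : ∀ k, F (2 * k) = 0 := fun k => hFp _ (by omega)
      simp [this, h0]
  have hm : (0 : ℝ) < √(n + 1 : ℕ) := Real.sqrt_pos.2 (by positivity)
  have hsq : √(n + 1 : ℕ) ^ 2 = ((n + 1 : ℕ) : ℝ) := Real.sq_sqrt (by positivity)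
  have hm' : (0 : ℝ) < ((n + 1 : ℕ) : ℝ) := by positivity
  rw [h1, tsum_eq_floor (fun j => F (2 * j + n % 2)) (n + 1) (fun j hj => hF0 _ (by omega))]
  have h2 := MeasureTheory.integral_comp_mul_left_Ioi
    (fun t : ℝ => F (2 * ⌊t⌋₊ + n % 2)) 0 (b := √(n + 1 : ℕ) / 2) (by positivity)
  rw [mul_zero, smul_eq_mul] at h2
  have h3 : ∫ u in Set.Ioi (0 : ℝ), AA r n u = (2 * (n + 1 : ℕ) / √(n + 1 : ℕ) ^ r) *
      ∫ u in Set.Ioi (0 : ℝ), F (2 * ⌊√(n + 1 : ℕ) / 2 * u⌋₊ + n % 2) := by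
    rw [← MeasureTheory.integral_const_mul]
    congr 1
    ext u
    have : hh (n + 1) u = 2 * ⌊√(n + 1 : ℕ) / 2 * u⌋₊ + n % 2 := by
      unfold hh; congr 1; omega
    rw [← this]
    simp only [AA, hF, div_pow]
    ring
  rw [h3, h2]
  field_simp
  norm_num

lemma hh_lower (m : ℕ) (u : ℝ) : √m * u ≤ (hh m u : ℝ) + 2 := by
  have := Nat.lt_floor_add_one (√m / 2 * u)
  unfold hh
  push_cast
  have h0 : (0 : ℝ) ≤ (((m + 1) % 2 : ℕ) : ℝ) := Nat.cast_nonneg _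
  linarith

lemma hh_upper (m : ℕ) (u : ℝ) (hu : 0 < u) : (hh m u : ℝ) ≤ √m * u + 1 := by
  have := Nat.floor_le (show 0 ≤ √m / 2 * u by positivity)
  have h0 : (((m + 1) % 2 : ℕ) : ℝ) ≤ 1 := by
    have : (m + 1) % 2 ≤ 1 := by omega
    exact_mod_cast this
  have e : (hh m u : ℝ) = 2 * (⌊√m / 2 * u⌋₊ : ℝ) + (((m + 1) % 2 : ℕ) : ℝ) := by
    unfold hh; rw [Nat.cast_add, Nat.cast_mul]; norm_num
  rw [e]
  linarith

lemma hh_parity (m : ℕ) (u : ℝ) : (2 : ℤ) ∣ m + ((hh m u : ℤ) + 1) := by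
  unfold hh; push_cast; omega

lemma hh_tendsto (u : ℝ) (hu : 0 < u) :
    Tendsto (fun m : ℕ => ((hh m u : ℝ) + 1) / √m) atTop (nhds u) ∧
    Tendsto (fun m : ℕ => (hh m u : ℝ) / √m) atTop (nhds u) := by
  have h0 : Tendsto (fun m : ℕ => √(m : ℝ)) atTop atTop :=
    Real.tendsto_sqrt_atTop.comp tendsto_natCast_atTop_atTop
  have hc : ∀ c : ℝ, Tendsto (fun m : ℕ => c / √(m : ℝ)) atTop (nhds 0) :=
    fun c => tendsto_const_nhds.div_atTop h0
  have h2 : Tendsto (fun m : ℕ => (hh m u : ℝ) / √m) atTop (nhds u) := by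
    have l1 : Tendsto (fun m : ℕ => u - 2 / √(m : ℝ)) atTop (nhds u) := by
      simpa using tendsto_const_nhds.sub (hc 2)
    have l2 : Tendsto (fun m : ℕ => u + 1 / √(m : ℝ)) atTop (nhds u) := by
      simpa using tendsto_const_nhds.add (hc 1)
    refine tendsto_of_tendsto_of_tendsto_of_le_of_le' l1 l2 ?_ ?_
    · filter_upwards [h0.eventually_gt_atTop 0] with m hm
      rw [le_div_iff₀ hm, sub_mul, div_mul_cancel₀ _ hm.ne']
      linarith [hh_lower m u]
    · filter_upwards [h0.eventually_gt_atTop 0] with m hm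
      rw [div_le_iff₀ hm, add_mul, div_mul_cancel₀ _ hm.ne']
      linarith [hh_upper m u hu]
  refine ⟨?_, h2⟩
  have := h2.add (hc 1)
  rw [add_zero] at this
  refine this.congr fun m => ?_
  ring

lemma term_bound (m : ℕ) (hm : 1 ≤ m) (y : ℕ) :
    4 * (y : ℝ) * bb m y ≤ 24 * ((y : ℝ) / √m) * exp (-(((y : ℝ) / √m) ^ 2 / 8)) := by
  have h := bb_gauss m hm y
  have hm' : (1 : ℝ) ≤ m := by exact_mod_cast hm
  have hx : ((y : ℝ) / √m) ^ 2 / 8 ≤ (y : ℝ) ^ 2 / (4 * (m + 1)) := by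
    rw [div_pow, Real.sq_sqrt (by positivity), div_div]
    apply div_le_div_of_nonneg_left (by positivity) (by positivity) (by linarith)
  have hx2 := Real.exp_le_exp.2 (neg_le_neg hx)
  calc 4 * (y : ℝ) * bb m y ≤ 4 * y * (6 / √m * exp (-((y : ℝ) ^ 2 / (4 * (m + 1))))) := by gcongr
    _ ≤ 4 * y * (6 / √m * exp (-(((y : ℝ) / √m) ^ 2 / 8))) := by
      exact mul_le_mul_of_nonneg_left (mul_le_mul_of_nonneg_left hx2 (by positivity))
        (by positivity)
    _ = _ := by ring

lemma wr_scaled (h n : ℕ) : ((n + 1 : ℕ) : ℝ) * (2 * wr h n h) =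
    ∑' k : ℕ, (-1 : ℝ) ^ k * (4 * ((2 * (k : ℝ) + 1) * ((h + 1) / √(n + 1 : ℕ))) *
      (√(n + 1 : ℕ) * bb (n + 1) ((2 * k + 1) * (h + 1)))) := by
  rw [wr_eq, ← tsum_mul_left, ← tsum_mul_left]
  congr 1
  ext k
  have hm : (0 : ℝ) < √(n + 1 : ℕ) := Real.sqrt_pos.2 (by positivity)
  push_cast at *
  field_simp
  ring

lemma texp_bound (t : ℝ) (ht : 0 < t) : t * exp (-(t ^ 2 / 8)) ≤ 128 / t ^ 3 := by
  have h := Real.quadratic_le_exp_of_nonneg (show 0 ≤ t ^ 2 / 8 by positivity)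
  have h1 : (t ^ 2 / 8) ^ 2 / 2 ≤ exp (t ^ 2 / 8) := by
    have : 0 ≤ t ^ 2 / 8 := by positivity
    linarith
  rw [Real.exp_neg, ← div_eq_mul_inv, div_le_div_iff₀ (Real.exp_pos _) (by positivity)]
  nlinarith

/-- limit function -/
noncomputable def ph (u : ℝ) : ℝ := ∑' k : ℕ, (-1 : ℝ) ^ k * tt (2 * k + 1) u

lemma summable_aux2 : Summable (fun k : ℕ => 1 / ((k : ℝ) + 1) ^ 3) := by
  have h := (summable_nat_add_iff 1).2 (Real.summable_one_div_nat_pow.2 (by norm_num : 1 < 3))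
  simpa using h

lemma ptwise (u : ℝ) (hu : 0 < u) :
    Tendsto (fun n : ℕ => ((n + 1 : ℕ) : ℝ) * (2 * wr (hh (n + 1) u) n (hh (n + 1) u))) atTop
      (nhds (ph u)) := by
  simp only [wr_scaled]
  obtain ⟨hN, -⟩ := hh_tendsto u hu
  unfold ph
  apply tendsto_tsum_of_dominated_convergence
    (bound := fun k : ℕ => 24 * (128 * 8 / u ^ 3) * (1 / ((k : ℝ) + 1) ^ 3))
  · exact summable_aux2.mul_left _
  · intro k
    apply Tendsto.const_mul
    have hq : Tendsto (fun m : ℕ => (2 * (k : ℝ) + 1) * (((hh m u : ℝ) + 1) / √m)) atTop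
      (nhds ((2 * (k : ℝ) + 1) * u)) := hN.const_mul _
    have hl := bb_llt (fun m => (2 * k + 1) * ((hh m u : ℤ) + 1)) (fun m => by
      have := hh_parity m u
      have e : (m : ℤ) + (2 * k + 1) * ((hh m u : ℤ) + 1) =
        (m + ((hh m u : ℤ) + 1)) + 2 * (k * ((hh m u : ℤ) + 1)) := by ring
      rw [e]
      exact dvd_add this (Dvd.intro _ rfl)) ((2 * (k : ℝ) + 1) * u) (by
        refine hq.congr fun m => ?_
        push_cast
        ring)
    have := (hq.const_mul 4).mul hl
    unfold tt
    exact this.comp (tendsto_add_atTop_nat 1)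
  · have h1 : ∀ᶠ m : ℕ in atTop, u / 2 < ((hh m u : ℝ) + 1) / √m :=
      hN.eventually_const_lt (by linarith)
    have h2 := (tendsto_add_atTop_nat 1).eventually h1
    filter_upwards [h2] with n hn k
    rw [norm_mul, norm_pow, norm_neg, norm_one, one_pow, one_mul]
    set m := n + 1 with hm
    set v := ((hh m u : ℝ) + 1) / √m with hv
    have hm0 : (0 : ℝ) < √m := Real.sqrt_pos.2 (by rw [hm]; positivity)
    have hv0 : 0 < v := by linarith
    have hb : 0 ≤ bb m ((2 * k + 1) * ((hh m u : ℤ) + 1)) := bb_nonneg _ _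
    rw [Real.norm_eq_abs, abs_of_nonneg (by positivity)]
    have ht := term_bound m (by omega) ((2 * k + 1) * (hh m u + 1))
    push_cast at ht
    rw [mul_div_assoc, ← hv] at ht
    have e : 4 * ((2 * (k : ℝ) + 1) * v) * (√m * bb m ((2 * k + 1) * ((hh m u : ℤ) + 1))) =
        4 * ((2 * (k : ℝ) + 1) * ((hh m u : ℝ) + 1)) * bb m ((2 * k + 1) * ((hh m u : ℤ) + 1)) := by
      rw [hv]; field_simp
    rw [e]
    refine ht.trans ?_
    rw [mul_assoc, mul_assoc 24]
    refine mul_le_mul_of_nonneg_left ?_ (by norm_num)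
    refine (texp_bound _ (by positivity)).trans ?_
    rw [div_mul_div_comm, mul_one]
    have hk := Nat.cast_nonneg (α := ℝ) k
    rw [div_le_div_iff₀ (by positivity) (by positivity)]
    have h3 : ((k : ℝ) + 1) * (u / 2) ≤ (2 * (k : ℝ) + 1) * v := by gcongr; linarith
    have h4 : (((k : ℝ) + 1) * (u / 2)) ^ 3 ≤ ((2 * (k : ℝ) + 1) * v) ^ 3 := by gcongr
    have h5 : (((k : ℝ) + 1) * (u / 2)) ^ 3 = u ^ 3 * ((k : ℝ) + 1) ^ 3 / 8 := by ring
    linarith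

lemma AA_bound (r n : ℕ) (u : ℝ) (hu : 0 < u) :
    ‖AA r n u‖ ≤ 48 * (2 ^ r * (u ^ (r + 1) + 2 ^ (r + 1))) * exp (-(1 / 16) * u ^ 2) := by
  unfold AA
  set m := n + 1 with hm
  set h := hh m u with hh'
  have hm1 : (1 : ℝ) ≤ √m := by
    rw [Real.one_le_sqrt, hm]; push_cast; have := Nat.cast_nonneg (α := ℝ) n; linarith
  have hw := wr_nonneg h n h
  rw [Real.norm_eq_abs, abs_of_nonneg (by positivity)]
  have h1 : (m : ℝ) * (2 * wr h n h) ≤ 4 * ((h + 1 : ℕ) : ℝ) * bb m (h + 1 : ℕ) := by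
    have := wr_le h n
    calc (m : ℝ) * (2 * wr h n h)
        ≤ m * (2 * (2 * ((h : ℝ) + 1) / ((n : ℝ) + 1) * bb (n + 1) (h + 1))) := by gcongr
      _ = _ := by
        rw [hm]; push_cast; field_simp; ring
  have h2 := term_bound m (by omega) (h + 1)
  set t := ((h + 1 : ℕ) : ℝ) / √m with ht
  have hl := hh_lower m u
  have hup := hh_upper m u hu
  rw [← hh'] at hl hup
  have hm0 : (0 : ℝ) < √m := by linarith
  have t0 : 0 ≤ t := by positivity
  have t1 : t ≤ u + 2 := by
    rw [ht, div_le_iff₀ hm0]; push_cast; linarith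
  have t2 : u ≤ t + 1 := by
    rw [ht, ← sub_le_iff_le_add, le_div_iff₀ hm0]; push_cast; linarith
  have t3 : (h : ℝ) / √m ≤ t := by
    rw [ht]; gcongr; linarith
  have t4 : exp (-(t ^ 2 / 8)) ≤ 2 * exp (-(1 / 16) * u ^ 2) := by
    have e1 : exp (1 / 8 : ℝ) ≤ 2 := by
      have := Real.exp_one_lt_d9
      have h8 : exp (1 / 8 : ℝ) ^ 8 = exp 1 := by rw [← Real.exp_nat_mul]; norm_num
      by_contra hc
      push Not at hc
      have : (2 : ℝ) ^ 8 < exp (1 / 8 : ℝ) ^ 8 := by gcongr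
      rw [h8] at this
      norm_num at *
      linarith
    calc exp (-(t ^ 2 / 8)) ≤ exp (1 / 8 + -(1 / 16) * u ^ 2) := by
          apply Real.exp_le_exp.2
          have : u ^ 2 ≤ (t + 1) ^ 2 := by gcongr
          nlinarith [sq_nonneg (t - 1)]
      _ ≤ _ := by rw [Real.exp_add]; gcongr
  have t5 := add_pow_le hu.le (by norm_num : (0 : ℝ) ≤ 2) (r + 1)
  rw [Nat.add_sub_cancel] at t5
  calc ((h : ℝ) / √m) ^ r * ((m : ℝ) * (2 * wr h n h))
      ≤ t ^ r * (24 * t * exp (-(t ^ 2 / 8))) := by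
        exact mul_le_mul (pow_le_pow_left₀ (by positivity) t3 r) (h1.trans h2)
          (by positivity) (by positivity)
    _ = 24 * t ^ (r + 1) * exp (-(t ^ 2 / 8)) := by ring
    _ ≤ 24 * (u + 2) ^ (r + 1) * (2 * exp (-(1 / 16) * u ^ 2)) := by gcongr
    _ ≤ 24 * (2 ^ r * (u ^ (r + 1) + 2 ^ (r + 1))) * (2 * exp (-(1 / 16) * u ^ 2)) := by gcongr
    _ = _ := by ring

lemma AA_tendsto (r : ℕ) :
    Tendsto (fun n => ∫ u in Set.Ioi (0 : ℝ), AA r n u) atTop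
      (nhds (∫ u in Set.Ioi (0 : ℝ), u ^ r * ph u)) := by
  apply MeasureTheory.tendsto_integral_filter_of_dominated_convergence
    (fun u : ℝ => 48 * (2 ^ r * (u ^ (r + 1) + 2 ^ (r + 1))) * exp (-(1 / 16) * u ^ 2))
  · refine Eventually.of_forall fun n => Measurable.aestronglyMeasurable ?_
    have h1 : Measurable (hh (n + 1)) := by
      unfold hh
      have : Measurable (fun u : ℝ => ⌊√((n + 1 : ℕ) : ℝ) / 2 * u⌋₊) :=
        Nat.measurable_floor.comp (by fun_prop)
      exact (measurable_of_countable (fun j : ℕ => 2 * j + (n + 1 + 1) % 2)).comp this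
    exact (measurable_of_countable (fun h : ℕ => ((h : ℝ) / √(n + 1 : ℕ)) ^ r *
      (((n + 1 : ℕ) : ℝ) * (2 * wr h n h)))).comp h1
  · refine Eventually.of_forall fun n => ?_
    filter_upwards [MeasureTheory.ae_restrict_mem measurableSet_Ioi] with u hu
    exact AA_bound r n u hu
  · have h1 := integrableOn_rpow_mul_exp_neg_mul_sq (b := 1 / 16) (by norm_num) (s := (r + 1 : ℕ))
      (by have := Nat.cast_nonneg (α := ℝ) (r + 1); linarith)
    have h2 := (integrable_exp_neg_mul_sq (b := 1 / 16) (by norm_num)).integrableOn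
      (s := Set.Ioi (0 : ℝ))
    have := (h1.const_mul (48 * 2 ^ r)).add (h2.const_mul (48 * 2 ^ r * 2 ^ (r + 1)))
    refine this.congr (Eventually.of_forall fun u => ?_)
    simp only [Pi.add_apply, Real.rpow_natCast]
    ring
  · filter_upwards [MeasureTheory.ae_restrict_mem measurableSet_Ioi] with u hu
    have hu : 0 < u := hu
    have h1 := ((hh_tendsto u hu).2.comp (tendsto_add_atTop_nat 1)).pow r
    exact h1.mul (ptwise u hu)

lemma ph_eq (u : ℝ) (hu : 0 < u) : ph u = ∑' j : ℕ, (tt (4 * j + 1) u - tt (4 * j + 3) u) := by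
  have hs : Summable (fun k : ℕ => (-1 : ℝ) ^ k * tt (2 * k + 1) u) := by
    refine Summable.of_norm_bounded (summable_aux2.mul_left (4 * √(2 / π) * (128 / u ^ 3)))
      fun k => ?_
    rw [norm_mul, norm_pow, norm_neg, norm_one, one_pow, one_mul]
    unfold tt
    have hk := Nat.cast_nonneg (α := ℝ) k
    set t := (2 * (k : ℝ) + 1) * u with ht
    have t0 : 0 < t := by positivity
    rw [Real.norm_eq_abs, abs_of_nonneg (by positivity)]
    have h1 : t * exp (-(t ^ 2 / 2)) ≤ 128 / t ^ 3 := by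
      refine le_trans ?_ (texp_bound t t0)
      gcongr
      norm_num
    calc 4 * t * (√(2 / π) * exp (-(t ^ 2 / 2))) = 4 * √(2 / π) * (t * exp (-(t ^ 2 / 2))) := by ring
      _ ≤ 4 * √(2 / π) * (128 / t ^ 3) := by gcongr
      _ ≤ 4 * √(2 / π) * (128 / (((k : ℝ) + 1) * u) ^ 3) := by
        gcongr
        rw [ht]
        gcongr
        linarith
      _ = _ := by rw [mul_pow]; field_simp
  have he : Summable (fun k : ℕ => (-1 : ℝ) ^ (2 * k) * tt (2 * ((2 * k : ℕ) : ℝ) + 1) u) :=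
    hs.comp_injective (i := fun k : ℕ => 2 * k) (by intro a b; simp)
  have ho : Summable (fun k : ℕ => (-1 : ℝ) ^ (2 * k + 1) * tt (2 * ((2 * k + 1 : ℕ) : ℝ) + 1) u) :=
    hs.comp_injective (i := fun k : ℕ => 2 * k + 1) (by intro a b; simp)
  have h1 := tsum_even_add_odd (f := fun k : ℕ => (-1 : ℝ) ^ k * tt (2 * k + 1) u) he ho
  unfold ph
  rw [← h1, ← he.tsum_add ho]
  congr 1
  ext j
  rw [pow_succ (-1 : ℝ), pow_mul]
  rw [show 2 * ((2 * j : ℕ) : ℝ) + 1 = 4 * j + 1 by push_cast; ring,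
      show 2 * ((2 * j + 1 : ℕ) : ℝ) + 1 = 4 * j + 3 by push_cast; ring]
  norm_num
  ring

lemma ph_integral (r : ℕ) : ∫ u in Set.Ioi (0 : ℝ), u ^ r * ph u =
    4 * √(2 / π) * KK (r + 1) * ∑' j, DD r j := by
  rw [← tsum_mul_left, (pair_hasSum r).tsum_eq]
  apply MeasureTheory.setIntegral_congr_fun measurableSet_Ioi
  intro u hu
  simp only
  rw [ph_eq u hu]

lemma heightMoment_eq (r n : ℕ) (hn : 1 ≤ n) : heightMoment n r =
    √(n + 1 : ℕ) ^ r * ((∫ u in Set.Ioi (0 : ℝ), AA r n u) / ∫ u in Set.Ioi (0 : ℝ), AA 0 n u) := by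
  have h : ∀ r, ∑' h : ℕ, (h : ℝ) ^ r * (V n h : ℝ) = 2 ^ n * 2 * (√(n + 1 : ℕ) ^ r *
      (√(n + 1 : ℕ) / (4 * (n + 1 : ℕ)) * ∫ u in Set.Ioi (0 : ℝ), AA r n u)) := by
    intro r
    rw [← T_eq, ← tsum_mul_left]
    congr 1
    ext h
    rw [V_eq n h hn]
    ring
  have h0 := h 0
  simp only [pow_zero, one_mul] at h0
  unfold heightMoment
  rw [h r, h0]
  have hm : (0 : ℝ) < √(n + 1 : ℕ) := Real.sqrt_pos.2 (by positivity)
  have hm' : (0 : ℝ) < ((n + 1 : ℕ) : ℝ) := by positivity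
  generalize (∫ u in Set.Ioi (0 : ℝ), AA r n u) = a
  generalize (∫ u in Set.Ioi (0 : ℝ), AA 0 n u) = b
  field_simp


/-- For each fixed `r ≥ 1`, the `r`-th moment of the height of admissible walks on `ℕ₀`
satisfies `E H_n^r ∼ (2^{r/2+2}/π) Γ(r/2+1) β(r+1) n^{r/2}` as `n → ∞`. -/
theorem heightMoment_asymptotics (r : ℕ) (hr : 1 ≤ r) :
    Tendsto
      (fun n : ℕ =>
        heightMoment n r /
          ((2 : ℝ) ^ ((r : ℝ) / 2 + 2) / π * Real.Gamma ((r : ℝ) / 2 + 1) *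
            dirichletBeta ((r : ℝ) + 1) * (n : ℝ) ^ ((r : ℝ) / 2)))
      atTop (nhds 1) := by
  have hp := Real.pi_pos
  have hD := DD_beta r hr
  have hβ : 0 < dirichletBeta ((r : ℝ) + 1) := by
    rw [← hD.2]
    exact hD.1.tsum_pos (fun j => (DD_nonneg r j).le) 0 (DD_nonneg r 0)
  have hG : 0 < Real.Gamma ((r : ℝ) / 2 + 1) := Real.Gamma_pos_of_pos (by positivity)
  have h2 : (0 : ℝ) < 2 ^ ((r : ℝ) / 2) := by positivity
  have hr1 := AA_tendsto r
  have hr0 := AA_tendsto 0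
  rw [ph_integral, hD.2, KK_eq] at hr1
  rw [ph_integral, DD_zero.tsum_eq, KK_eq] at hr0
  simp only [Nat.cast_zero, zero_div, Real.rpow_zero, zero_add, Real.Gamma_one, mul_one] at hr0
  have hs : (0 : ℝ) < √(2 / π) := Real.sqrt_pos.2 (by positivity)
  have hq := hr1.div hr0 (by positivity)
  have hsq : Tendsto (fun n : ℕ => (√(n + 1 : ℕ) / √(n : ℝ)) ^ r) atTop (nhds 1) := by
    have : Tendsto (fun n : ℕ => √(1 + 1 / (n : ℝ))) atTop (nhds 1) := by
      have h := (tendsto_const_nhds (x := (1 : ℝ))).add (tendsto_one_div_atTop_nhds_zero_nat (𝕜 := ℝ))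
      have h' := h.sqrt
      simpa using h'
    have h3 := this.pow r
    rw [one_pow] at h3
    refine h3.congr' ?_
    filter_upwards [eventually_ge_atTop 1] with n hn
    have hn' : (0 : ℝ) < n := by exact_mod_cast hn
    rw [← Real.sqrt_div (by positivity)]
    congr 2
    push_cast
    field_simp
  set C : ℝ := (2 : ℝ) ^ ((r : ℝ) / 2 + 2) / π * Real.Gamma ((r : ℝ) / 2 + 1) *
    dirichletBeta ((r : ℝ) + 1) with hC
  have hfin := (hsq.mul hq).div_const C
  have e : 1 * (4 * √(2 / π) * (2 ^ ((r : ℝ) / 2) * Real.Gamma ((r : ℝ) / 2 + 1)) *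
      dirichletBeta ((r : ℝ) + 1) / (4 * √(2 / π) * (π / 4))) / C = 1 := by
    rw [hC, Real.rpow_add (by norm_num), Real.rpow_two]
    field_simp
    norm_num
  rw [e] at hfin
  refine hfin.congr' ?_
  filter_upwards [eventually_ge_atTop 1] with n hn
  rw [heightMoment_eq r n hn]
  have e2 : (n : ℝ) ^ ((r : ℝ) / 2) = √(n : ℝ) ^ r := by
    rw [Real.sqrt_eq_rpow, ← Real.rpow_natCast, ← Real.rpow_mul (by positivity)]
    congr 1
    ring
  rw [e2, div_pow]
  simp only [Pi.div_apply]
  ring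
end
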